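/- arXiv:2209.08753 — 2 statements merged into one kernel-verified Lean document; each statement's English description precedes it below -/
import Mathlib

section
/- Let L_0 and L_1 be disjoint finite relational languages, K_0 and K_1 be Fraïssé classes of finite L_0- and L_1-structures respectively, both having the strong amalgamation property, with Fraïssé limits F_0 and F_1. If the theories of F_0 and of F_1 are both NATP, then the theory of the Fraïssé limit F_0 ⊕ F_1 of the sum class K_0 ⊕ K_1 is NATP. -/
open FirstOrder FirstOrder.Language

universe u v w

namespace NATPPaper

variable {L : FirstOrder.Language.{u, v}}


/-- Two nodes of the binary tree `2^{<ω}` (coded as lists of booleans) are comparable if one is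
an initial segment (prefix) of the other. -/
def TreeComparable (η ν : List Bool) : Prop := η <+: ν ∨ ν <+: η

/-- A set of nodes of `2^{<ω}` is an antichain if its elements are pairwise incomparable. -/
def IsTreeAntichain (X : Set (List Bool)) : Prop :=
  ∀ η ∈ X, ∀ ν ∈ X, η ≠ ν → ¬ TreeComparable η ν

/-- The pair `(φ(x; y), (a_η)_{η ∈ 2^{<ω}})` witnesses the antichain tree property:
every (finite) antichain is consistent, while any two distinct comparable nodes are
inconsistent. -/
def ATPWitness {M : Type w} [L.Structure M] {n m : ℕ}
    (φ : L.Formula (Fin n ⊕ Fin m)) (a : List Bool → Fin m → M) : Prop :=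
  (∀ X : Finset (List Bool), IsTreeAntichain ↑X →
      ∃ b : Fin n → M, ∀ η ∈ X, φ.Realize (Sum.elim b (a η))) ∧
  (∀ η ν : List Bool, η ≠ ν → TreeComparable η ν →
      ¬ ∃ b : Fin n → M, φ.Realize (Sum.elim b (a η)) ∧ φ.Realize (Sum.elim b (a ν)))

/-- A theory has the antichain tree property (ATP) if some formula `φ(x; y)` has ATP,
witnessed by a tree-indexed family of parameters in some model. -/
def _root_.FirstOrder.Language.Theory.HasATP (T : L.Theory) : Prop :=
  ∃ (M : Theory.ModelType.{u, v, max u v} T) (n m : ℕ)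
    (φ : L.Formula (Fin n ⊕ Fin m)) (a : List Bool → Fin m → M), ATPWitness φ a

/-- A theory is NATP if it does not have the antichain tree property.  (For an incomplete
theory this is equivalent to saying that every completion is NATP.) -/
def _root_.FirstOrder.Language.Theory.IsNATP (T : L.Theory) : Prop := ¬ T.HasATP



/-- A class `K` of structures has the strong amalgamation property (SAP): amalgamation where the
images of the two structures intersect exactly in the image of the common substructure, together
with the disjoint joint embedding property (the case `A = ∅`). -/
def IsSAP (K : Set (CategoryTheory.Bundled.{w} L.Structure)) : Prop :=
  (∀ A B C : CategoryTheory.Bundled.{w} L.Structure, A ∈ K → B ∈ K → C ∈ K →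
      ∀ (e : A ↪[L] B) (f : A ↪[L] C),
        ∃ (D : CategoryTheory.Bundled.{w} L.Structure) (_ : D ∈ K)
          (g : B ↪[L] D) (h : C ↪[L] D),
            g.comp e = h.comp f ∧
            Set.range ⇑g ∩ Set.range ⇑h = Set.range ⇑(g.comp e)) ∧
  (∀ B C : CategoryTheory.Bundled.{w} L.Structure, B ∈ K → C ∈ K →
      ∃ (D : CategoryTheory.Bundled.{w} L.Structure) (_ : D ∈ K)
        (g : B ↪[L] D) (h : C ↪[L] D),
          Set.range ⇑g ∩ Set.range ⇑h = ∅)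

variable {L₁ : FirstOrder.Language.{u, v}} {L₂ : FirstOrder.Language.{u, v}}

/-- The sum `K₀ ⊕ K₁` of a class of finite `L₁`-structures and a class of finite
`L₂`-structures: the class of `(L₁ ∪ L₂)`-structures whose `L₁`-reduct lies in `K₀` and whose
`L₂`-reduct lies in `K₁`. -/
def sumClass (K₀ : Set (CategoryTheory.Bundled.{w} L₁.Structure))
    (K₁ : Set (CategoryTheory.Bundled.{w} L₂.Structure)) :
    Set (CategoryTheory.Bundled.{w} (L₁.sum L₂).Structure) :=
  {M | (⟨M, (LHom.sumInl : L₁ →ᴸ L₁.sum L₂).reduct M⟩ : CategoryTheory.Bundled L₁.Structure) ∈ K₀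
     ∧ (⟨M, (LHom.sumInr : L₂ →ᴸ L₁.sum L₂).reduct M⟩ : CategoryTheory.Bundled L₂.Structure) ∈ K₁}


section LeftIdeal

/-- A compact right topological semigroup has a closed left ideal all of whose idempotents are
right identities for it. -/
theorem exists_leftIdeal_idempotent_right_identity {S : Type*} [Nonempty S] [Semigroup S]
    [TopologicalSpace S] [CompactSpace S] [T2Space S] (hc : ∀ r : S, Continuous (· * r)) :
    ∃ I : Set S, IsClosed I ∧ I.Nonempty ∧ (∀ s, ∀ x ∈ I, s * x ∈ I) ∧
      ∀ e ∈ I, e * e = e → ∀ x ∈ I, x * e = x := by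
  let 𝓘 : Set (Set S) := {I | IsClosed I ∧ I.Nonempty ∧ ∀ s, ∀ x ∈ I, s * x ∈ I}
  obtain ⟨I, hI⟩ : ∃ I, Minimal (· ∈ 𝓘) I := by
    refine zorn_superset _ fun c hcs hch => ?_
    refine ⟨⋂₀ c, ⟨isClosed_sInter fun t ht => (hcs ht).1, ?_, fun s x hx => ?_⟩,
      fun s hs => Set.sInter_subset_of_mem hs⟩
    · obtain rfl | hne := c.eq_empty_or_nonempty
      · rw [Set.sInter_empty]
        exact Set.univ_nonempty
      · have := hne.coe_sort
        rw [Set.sInter_eq_iInter]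
        exact IsCompact.nonempty_iInter_of_directed_nonempty_isCompact_isClosed _
          (DirectedOn.directed_val (IsChain.directedOn hch.symm)) (fun i => (hcs i.2).2.1)
          (fun i => (hcs i.2).1.isCompact) fun i => (hcs i.2).1
    · rw [Set.mem_sInter] at hx ⊢
      exact fun t ht => (hcs ht).2.2 s x (hx t ht)
  refine ⟨I, hI.prop.1, hI.prop.2.1, hI.prop.2.2, fun e he hee x hx => ?_⟩
  have himage : (· * e) '' Set.univ = I := by
    refine hI.eq_of_subset ⟨(hc e).isClosedMap _ isClosed_univ, ⟨_, e, trivial, rfl⟩, ?_⟩ ?_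
    · rintro s _ ⟨y, -, rfl⟩
      exact ⟨s * y, trivial, mul_assoc _ _ _⟩
    · rintro _ ⟨y, -, rfl⟩
      exact hI.prop.2.2 y e he
  rw [← himage] at hx
  obtain ⟨y, -, rfl⟩ := hx
  simp only [mul_assoc, hee]

end LeftIdeal

section Sampling

open Filter

/-- Maps from the tree `2^{<ω}` to itself. -/
abbrev NodeMap := List Bool → List Bool

/-- There are ultrafilters `V false`, `V true` on `2^{<ω}`, concentrating on the two cones of height
one, such that concatenating a `V i`-random node with a `V j`-random one gives a `V i`-random
node. -/
theorem exists_cone_ultrafilters : ∃ V : Bool → Ultrafilter (List Bool),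
    (∀ i, ∀ᶠ w in V i, ∃ t, w = i :: t) ∧
    ∀ i j (P : List Bool → Prop),
      (∀ᶠ v in V i, ∀ᶠ w in V j, P (v ++ w)) ↔ ∀ᶠ v in V i, P v := by
  let _ : Semigroup (List Bool) :=
    { mul := (· ++ ·)
      mul_assoc := List.append_assoc }
  let _ : Semigroup (Ultrafilter (List Bool)) := Ultrafilter.semigroup
  have hc : ∀ r : Ultrafilter (List Bool), Continuous (· * r) := Ultrafilter.continuous_mul_left
  obtain ⟨I, hIc, ⟨x, hx⟩, hI, hid⟩ := exists_leftIdeal_idempotent_right_identity hc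
  have hcone : ∀ i : Bool, ∃ e ∈ I ∩ {U | {w : List Bool | ∃ t, w = i :: t} ∈ U}, e * e = e := by
    intro i
    refine exists_idempotent_in_compact_subsemigroup hc _ ?_ ?_ ?_
    · refine ⟨(pure [i] : Ultrafilter (List Bool)) * x, hI _ _ hx, ?_⟩
      refine Set.mem_ofPred_eq .. ▸
        (Ultrafilter.eventually_mul _ _ fun w => ∃ t, w = i :: t).2 ?_
      exact Filter.eventually_pure.2 (Eventually.of_forall fun t => ⟨t, rfl⟩)
    · exact (hIc.inter (ultrafilter_isClosed_basic _)).isCompact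
    · rintro U ⟨hU, hU'⟩ U' ⟨hV, hV'⟩
      refine ⟨hI _ _ hV, ?_⟩
      refine Set.mem_ofPred_eq .. ▸
        (Ultrafilter.eventually_mul _ _ fun w => ∃ t, w = i :: t).2 ?_
      filter_upwards [hU'] with w hw
      obtain ⟨t, rfl⟩ := hw
      exact Eventually.of_forall fun t' => ⟨t ++ t', rfl⟩
  choose V hV hVV using hcone
  refine ⟨V, fun i => (hV i).2, fun i j P => ?_⟩
  have h := hid _ (hV j).1 (hVV j) _ (hV i).1
  conv_rhs => rw [← h]
  exact (Ultrafilter.eventually_mul _ _ P).symm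

/-- The tree of nodes with root `v` whose left and right subtrees are `l` and `r`, translated
by `v`. -/
def graft (v : List Bool) (l r : NodeMap) : NodeMap
  | [] => v
  | false :: z => v ++ l z
  | true :: z => v ++ r z

theorem append_graft (u v : List Bool) (l r : NodeMap) :
    (fun z => u ++ graft v l r z) = graft (u ++ v) l r := by
  funext z
  rcases z with - | ⟨_ | _, z⟩ <;> simp [graft]

/-- The law of a random embedding of the binary tree of height `d` into `2^{<ω}` with a
`V j`-random root. -/
def treeLaw (V : Bool → Ultrafilter (List Bool)) : ℕ → Bool → Ultrafilter (NodeMap)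
  | 0, j => (V j).map fun v _ => v
  | d + 1, j => (V j).bind fun v => (treeLaw V d false).bind fun l =>
      (treeLaw V d true).map fun r => graft v l r

variable {V : Bool → Ultrafilter (List Bool)}

theorem eventually_treeLaw_zero {j : Bool} {P : NodeMap → Prop} :
    (∀ᶠ f : NodeMap in treeLaw V 0 j, P f) ↔ ∀ᶠ v in V j, P fun _ => v := Iff.rfl

theorem eventually_treeLaw_succ {d : ℕ} {j : Bool} {P : NodeMap → Prop} :
    (∀ᶠ f : NodeMap in treeLaw V (d + 1) j, P f) ↔
      ∀ᶠ v in V j, ∀ᶠ l : NodeMap in treeLaw V d false, ∀ᶠ r : NodeMap in treeLaw V d true,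
        P (graft v l r) := Iff.rfl

variable (hV : ∀ i j (P : List Bool → Prop),
  (∀ᶠ v in V i, ∀ᶠ w in V j, P (v ++ w)) ↔ ∀ᶠ v in V i, P v)
include hV

theorem eventually_treeLaw_translate (d : ℕ) (i j : Bool) (P : NodeMap → Prop) :
    (∀ᶠ v in V j, ∀ᶠ l : NodeMap in treeLaw V d i, P fun z => v ++ l z) ↔
      ∀ᶠ f : NodeMap in treeLaw V d j, P f := by
  cases d with
  | zero => exact hV j i fun v => P fun _ => v
  | succ d =>
    simp only [eventually_treeLaw_succ, append_graft]
    exact hV j i fun v => ∀ᶠ l : NodeMap in treeLaw V d false,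
      ∀ᶠ r : NodeMap in treeLaw V d true, P (graft v l r)

theorem eventually_treeLaw_cons (d : ℕ) (i j : Bool) (P : NodeMap → Prop) :
    (∀ᶠ f : NodeMap in treeLaw V (d + 1) j, P fun z => f (i :: z)) ↔
      ∀ᶠ f : NodeMap in treeLaw V d j, P f := by
  rw [eventually_treeLaw_succ, ← eventually_treeLaw_translate hV d i j P]
  cases i <;> simp only [graft, eventually_const]

theorem eventually_treeLaw_append (d : ℕ) (j : Bool) (y : List Bool)
    (P : NodeMap → Prop) :
    (∀ᶠ f : NodeMap in treeLaw V (y.length + d) j, P fun z => f (y ++ z)) ↔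
      ∀ᶠ f : NodeMap in treeLaw V d j, P f := by
  induction y with
  | nil => simp
  | cons i y ih =>
    rw [← ih, ← eventually_treeLaw_cons hV _ i j fun f => P fun z => f (y ++ z)]
    simp [Nat.add_right_comm]

theorem eventually_treeLaw_apply {d : ℕ} (j : Bool) {y : List Bool} (hy : y.length ≤ d)
    (P : List Bool → Prop) :
    (∀ᶠ f : NodeMap in treeLaw V d j, P (f y)) ↔ ∀ᶠ v in V j, P v := by
  obtain ⟨k, rfl⟩ := Nat.exists_eq_add_of_le hy
  have h := eventually_treeLaw_append hV k j y fun f => P (f [])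
  simp only [List.append_nil] at h
  rw [h]
  cases k with
  | zero => rfl
  | succ k => simp [eventually_treeLaw_succ, graft]

theorem eventually_treeLaw_apply_apply {d : ℕ} (i j : Bool) {y z : List Bool}
    (hyz : (y ++ i :: z).length ≤ d) (P : List Bool → List Bool → Prop) :
    (∀ᶠ f : NodeMap in treeLaw V d j, P (f y) (f (y ++ i :: z))) ↔
      ∀ᶠ v in V j, ∀ᶠ w in V i, P v (v ++ w) := by
  obtain ⟨k, rfl⟩ : ∃ k, d = y.length + (k + 1) := by
    refine ⟨d - y.length - 1, ?_⟩
    simp at hyz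
    omega
  have hz : z.length ≤ k := by
    simp at hyz
    omega
  have h := eventually_treeLaw_append hV (k + 1) j y fun f => P (f []) (f (i :: z))
  simp only [List.append_nil] at h
  rw [h, eventually_treeLaw_succ]
  refine eventually_congr (Eventually.of_forall fun v => ?_)
  rw [← eventually_treeLaw_apply hV i hz fun w => P v (v ++ w)]
  cases i <;> simp only [graft, eventually_const]

/-- The law of the restriction of a random embedding to an antichain does not change when the
elements of the antichain are extended. -/
theorem eventually_treeLaw_antichain (d D : ℕ) (j : Bool) (Y : Set (List Bool))
    (hY : IsTreeAntichain Y) (hd : ∀ y ∈ Y, y.length ≤ d) (e : NodeMap)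
    (he : ∀ y ∈ Y, y <+: e y) (hD : ∀ y ∈ Y, (e y).length ≤ D)
    (P : NodeMap → Prop)
    (hP : ∀ f g, (∀ y ∈ Y, f y = g y) → (P f ↔ P g)) :
    (∀ᶠ f : NodeMap in treeLaw V D j, P fun y => f (e y)) ↔
      ∀ᶠ f : NodeMap in treeLaw V d j, P f := by
  induction d generalizing D j Y e P with
  | zero =>
    have h0 : ∀ y ∈ Y, y = [] := fun y hy => List.length_eq_zero_iff.1 (Nat.le_zero.1 (hd y hy))
    by_cases hn : [] ∈ Y
    · rw [eventually_treeLaw_zero, ← eventually_treeLaw_apply hV j (hD [] hn) fun v => P fun _ => v]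
      refine eventually_congr (Eventually.of_forall fun f => hP _ _ fun y hy => ?_)
      rw [h0 y hy]
    · have hP' : ∀ f, P f ↔ P id := fun f => hP _ _ fun y hy => absurd (h0 y hy ▸ hy) hn
      simp only [hP' _, eventually_const]
  | succ d ih =>
    by_cases hn : [] ∈ Y
    · have h0 : ∀ y ∈ Y, y = [] := fun y hy => by
        by_contra hne
        exact hY y hy [] hn hne (Or.inr List.nil_prefix)
      rw [← eventually_congr (Eventually.of_forall fun f => hP (fun _ => f []) f
          fun y hy => by rw [h0 y hy]),
        eventually_treeLaw_apply hV j (Nat.zero_le _) fun v => P fun _ => v,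
        ← eventually_treeLaw_apply hV j (hD [] hn) fun v => P fun _ => v]
      refine eventually_congr (Eventually.of_forall fun f => hP _ _ fun y hy => ?_)
      rw [h0 y hy]
    rcases D with - | D
    · have h0 : ∀ y, y ∉ Y := fun y hy => by
        have h1 := List.length_eq_zero_iff.1 (Nat.le_zero.1 (hD y hy))
        have h2 := he y hy
        rw [h1, List.prefix_nil] at h2
        exact hn (h2 ▸ hy)
      have hP' : ∀ f, P f ↔ P id := fun f => hP _ _ fun y hy => absurd hy (h0 y)
      simp only [hP' _, eventually_const]
    have hcons : ∀ i y, i :: y ∈ Y → e (i :: y) = i :: (e (i :: y)).tail ∧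
        y <+: (e (i :: y)).tail ∧ (e (i :: y)).tail.length ≤ D := fun i y hy => by
      obtain ⟨t, ht⟩ := he _ hy
      have := hD _ hy
      rw [← ht] at this ⊢
      simp at this ⊢
      omega
    have hYi : ∀ i : Bool, IsTreeAntichain {y | i :: y ∈ Y} := by
      intro i η hη ν hν hne hc
      refine hY _ hη _ hν (by simpa using hne) ?_
      simpa [TreeComparable] using hc
    rw [eventually_treeLaw_succ, eventually_treeLaw_succ]
    refine eventually_congr (Eventually.of_forall fun v => ?_)
    have hgraft : ∀ l r, P (fun y => graft v l r (e y)) ↔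
        P (graft v (fun y => l (e (false :: y)).tail) fun y => r (e (true :: y)).tail) := by
      refine fun l r => hP _ _ fun y hy => ?_
      rcases y with - | ⟨_ | _, y⟩
      · exact absurd hy hn
      all_goals rw [(hcons _ y hy).1]; rfl
    simp only [hgraft]
    have hright : ∀ l,
        (∀ᶠ r : NodeMap in treeLaw V D true, P (graft v l fun y => r (e (true :: y)).tail)) ↔
        ∀ᶠ r : NodeMap in treeLaw V d true, P (graft v l r) := by
      refine fun l => ih D true {y | true :: y ∈ Y} (hYi true)
        (fun y hy => by simpa using hd _ hy) (fun y => (e (true :: y)).tail)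
        (fun y hy => (hcons _ y hy).2.1) (fun y hy => (hcons _ y hy).2.2)
        (fun r => P (graft v l r)) fun f g hfg => hP _ _ fun y hy => ?_
      rcases y with - | ⟨_ | _, y⟩
      · rfl
      · rfl
      · simp only [graft, hfg y hy]
    simp only [hright]
    refine ih D false {y | false :: y ∈ Y} (hYi false)
      (fun y hy => by simpa using hd _ hy) (fun y => (e (false :: y)).tail)
      (fun y hy => (hcons _ y hy).2.1) (fun y hy => (hcons _ y hy).2.2)
      (fun l => ∀ᶠ r : NodeMap in treeLaw V d true, P (graft v l r)) fun f g hfg =>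
        eventually_congr (Eventually.of_forall fun r => hP _ _ fun y hy => ?_)
    rcases y with - | ⟨_ | _, y⟩
    · rfl
    · simp only [graft, hfg y hy]
    · rfl

omit hV in
theorem eventually_treeLaw_incomparable (hcone : ∀ i, ∀ᶠ w in V i, ∃ t, w = i :: t)
    (d : ℕ) (j : Bool) :
    ∀ᶠ f : NodeMap in treeLaw V d j, (∀ z, ∃ t, f z = j :: t) ∧
      ∀ η ν : List Bool, η.length ≤ d → ν.length ≤ d → ¬ TreeComparable η ν →
        ¬ TreeComparable (f η) (f ν) := by
  induction d generalizing j with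
  | zero =>
    rw [eventually_treeLaw_zero]
    filter_upwards [hcone j] with v hv
    refine ⟨fun _ => hv, fun η ν hη hν h => absurd ?_ h⟩
    rw [List.length_eq_zero_iff.1 (Nat.le_zero.1 hη)]
    exact Or.inl List.nil_prefix
  | succ d ih =>
    rw [eventually_treeLaw_succ]
    filter_upwards [hcone j] with v hv
    filter_upwards [ih false] with l hl
    filter_upwards [ih true] with r hr
    obtain ⟨t, rfl⟩ := hv
    refine ⟨fun z => ?_, fun η ν hη hν h => ?_⟩
    · rcases z with - | ⟨_ | _, z⟩ <;> simp [graft]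
    · rcases η with - | ⟨a, η⟩
      · exact absurd (Or.inl List.nil_prefix) h
      rcases ν with - | ⟨b, ν⟩
      · exact absurd (Or.inr List.nil_prefix) h
      simp only [List.length_cons, Nat.add_le_add_iff_right] at hη hν
      obtain ⟨s, hs⟩ := hl.1 η
      obtain ⟨s', hs'⟩ := hl.1 ν
      obtain ⟨u, hu⟩ := hr.1 η
      obtain ⟨u', hu'⟩ := hr.1 ν
      rcases a with _ | _ <;> rcases b with _ | _
      · simpa [graft, TreeComparable] using hl.2 η ν hη hν (by simpa [TreeComparable] using h)
      · simp [graft, TreeComparable, hs, hu']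
      · simp [graft, TreeComparable, hs', hu]
      · simpa [graft, TreeComparable] using hr.2 η ν hη hν (by simpa [TreeComparable] using h)

end Sampling
section Ramsey

open Filter

/-- Every node of the tree, with a `0` inserted before each of its bits. -/
def insertFalse (η : List Bool) : List Bool := η.flatMap fun b => [false, b]

theorem length_insertFalse (η : List Bool) : (insertFalse η).length = 2 * η.length := by
  simp [insertFalse, List.length_flatMap, mul_comm]

theorem insertFalse_append_cons (η ν : List Bool) (b : Bool) :
    insertFalse (η ++ b :: ν) = insertFalse η ++ false :: b :: insertFalse ν := by
  simp [insertFalse]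

theorem prefix_of_insertFalse {η ν : List Bool} (h : insertFalse η <+: insertFalse ν) :
    η <+: ν := by
  induction η generalizing ν with
  | nil => exact List.nil_prefix
  | cons a η ih =>
    rcases ν with - | ⟨b, ν⟩
    · simp [insertFalse] at h
    · simp only [insertFalse, List.flatMap_cons, List.cons_append, List.nil_append,
        List.cons_prefix_cons, true_and] at h ⊢
      exact ⟨h.1, ih h.2⟩

theorem treeComparable_of_insertFalse {η ν : List Bool}
    (h : TreeComparable (insertFalse η) (insertFalse ν)) : TreeComparable η ν :=
  h.imp prefix_of_insertFalse prefix_of_insertFalse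

theorem isTreeAntichain_image {f : List Bool → List Bool} {Y : Finset (List Bool)}
    (hf : ∀ η ∈ Y, ∀ ν ∈ Y, ¬ TreeComparable η ν → ¬ TreeComparable (f η) (f ν))
    (hY : IsTreeAntichain (Y : Set (List Bool))) :
    IsTreeAntichain (Y.image f : Set (List Bool)) := by
  intro η hη ν hν hne
  simp only [Finset.coe_image, Set.mem_image, Finset.mem_coe] at hη hν
  obtain ⟨η, hη, rfl⟩ := hη
  obtain ⟨ν, hν, rfl⟩ := hν
  exact hf η hη ν hν (hY η hη ν hν fun h => hne (congrArg f h))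

theorem treeComparable_of_append {y y' x x' : List Bool}
    (h : TreeComparable (y ++ x) (y' ++ x')) : TreeComparable y y' := by
  rcases h with h | h
  · exact List.prefix_or_prefix_of_prefix ((List.prefix_append y x).trans h)
      (List.prefix_append y' x')
  · exact List.prefix_or_prefix_of_prefix (List.prefix_append y x)
      ((List.prefix_append y' x').trans h)

variable {ι : Type*} [Finite ι] {R : ι → Finset (List Bool) → Prop}
  (hered : ∀ i s t, s ⊆ t → R i t → R i s)
  (split : ∀ X : Finset (List Bool), IsTreeAntichain (X : Set (List Bool)) →
    ∃ c : List Bool → ι, ∀ i, ∀ s ⊆ X, (∀ x ∈ s, c x = i) → R i s)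
  {V : Bool → Ultrafilter (List Bool)}
  (hV : ∀ i j (P : List Bool → Prop),
    (∀ᶠ v in V i, ∀ᶠ w in V j, P (v ++ w)) ↔ ∀ᶠ v in V i, P v)
include hV

omit [Finite ι] in
include hered in
/-- If every colour fails on some antichain, then for every set of colours `l` there is an
antichain such that almost every embedding maps it to one which is not coloured by `l`. -/
theorem exists_antichain_avoiding
    (hbad : ∀ i, ∃ (d : ℕ) (Y : Finset (List Bool)), IsTreeAntichain (Y : Set (List Bool)) ∧
      (∀ y ∈ Y, y.length ≤ d) ∧ ∀ᶠ f : NodeMap in treeLaw V d false, ¬ R i (Y.image f))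
    (l : Set ι) (hl : l.Finite) :
    ∃ (d : ℕ) (X : Finset (List Bool)), IsTreeAntichain (X : Set (List Bool)) ∧
      (∀ x ∈ X, x.length ≤ d) ∧ ∀ᶠ f : NodeMap in treeLaw V d false, ∀ c : List Bool → ι,
        (∀ i, ∀ s ⊆ X.image f, (∀ x ∈ s, c x = i) → R i s) → ∃ x ∈ X, c (f x) ∉ l := by
  induction l, hl using Set.Finite.induction_on with
  | empty =>
    refine ⟨0, {[]}, ?_, by simp, Eventually.of_forall fun f c _ => ⟨[], by simp⟩⟩
    intro η hη ν hν hne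
    simp only [Finset.coe_singleton, Set.mem_singleton_iff] at hη hν
    exact absurd (hη.trans hν.symm) hne
  | @insert i l _ _ ih =>
    obtain ⟨dX, X, hX, hXd, hXf⟩ := ih
    obtain ⟨dY, Y, hY, hYd, hYf⟩ := hbad i
    refine ⟨dY + dX, Finset.image₂ (· ++ ·) Y X, ?_, ?_, ?_⟩
    · intro η hη ν hν hne hc
      simp only [Finset.coe_image₂, Set.mem_image2, Finset.mem_coe] at hη hν
      obtain ⟨y, hy, x, hx, rfl⟩ := hη
      obtain ⟨y', hy', x', hx', rfl⟩ := hν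
      have hyy : y = y' := by
        by_contra hne'
        exact hY y hy y' hy' hne' (treeComparable_of_append hc)
      subst hyy
      refine hX x hx x' hx' (fun h => hne (h ▸ rfl)) ?_
      simpa [TreeComparable] using hc
    · intro w hw
      obtain ⟨y, hy, x, hx, rfl⟩ := Finset.mem_image₂.1 hw
      have := hYd y hy
      have := hXd x hx
      simp only [List.length_append]
      omega
    have hsub : ∀ y ∈ Y, ∀ᶠ f : NodeMap in treeLaw V (dY + dX) false, ∀ c : List Bool → ι,
        (∀ i, ∀ s ⊆ X.image (fun x => f (y ++ x)), (∀ x ∈ s, c x = i) → R i s) →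
          ∃ x ∈ X, c (f (y ++ x)) ∉ l := by
      intro y hy
      obtain ⟨k, hk⟩ : ∃ k, dY + dX = y.length + (dX + k) :=
        ⟨dY - y.length, by have := hYd y hy; omega⟩
      rw [hk]
      refine (eventually_treeLaw_append hV (dX + k) false y fun f => ∀ c : List Bool → ι,
        (∀ i, ∀ s ⊆ X.image f, (∀ x ∈ s, c x = i) → R i s) → ∃ x ∈ X, c (f x) ∉ l).2 ?_
      refine (eventually_treeLaw_antichain hV dX (dX + k) false X hX hXd (fun y => y)
        (fun y _ => List.prefix_rfl) (fun y hy => (hXd y hy).trans (Nat.le_add_right _ _))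
        (fun f => ∀ c : List Bool → ι,
          (∀ i, ∀ s ⊆ X.image f, (∀ x ∈ s, c x = i) → R i s) → ∃ x ∈ X, c (f x) ∉ l) ?_).2 hXf
      intro f g hfg
      have him : X.image f = X.image g := Finset.image_congr hfg
      rw [him]
      refine forall_congr' fun c => imp_congr_right fun _ => exists_congr fun x =>
        and_congr_right fun hx => ?_
      rw [hfg x hx]
    have hchoice : ∀ z : Y → X, ∀ᶠ f : NodeMap in treeLaw V (dY + dX) false,
        ¬ R i (Y.attach.image fun y => f (y.1 ++ (z y).1)) := by
      intro z
      have h := (eventually_treeLaw_antichain hV dY (dY + dX) false Y hY hYd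
        (fun y => if h : y ∈ Y then y ++ (z ⟨y, h⟩).1 else y) ?_ ?_ (fun f => ¬ R i (Y.image f))
        ?_).2 hYf
      · refine h.mono fun f hf hR => hf (hered _ _ _ ?_ hR)
        intro w hw
        obtain ⟨y, hy, rfl⟩ := Finset.mem_image.1 hw
        refine Finset.mem_image.2 ⟨⟨y, hy⟩, Finset.mem_attach _ _, ?_⟩
        rw [dif_pos hy]
      · intro y hy
        have hy' : y ∈ Y := hy
        rw [dif_pos hy']
        exact List.prefix_append _ _
      · intro y hy
        have hy' : y ∈ Y := hy
        have := hYd y hy'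
        have := hXd _ (z ⟨y, hy'⟩).2
        rw [dif_pos hy', List.length_append]
        omega
      · intro f g hfg
        have him : Y.image f = Y.image g := Finset.image_congr hfg
        rw [him]
    filter_upwards [eventually_all.2 hchoice, (eventually_all_finset Y).2 hsub] with f hf₁ hf₂ c hc
    by_contra! hall
    have hx : ∀ y : Y, ∃ x : X, c (f (y.1 ++ x.1)) = i := by
      intro y
      obtain ⟨x, hxX, hxl⟩ := hf₂ y.1 y.2 c fun i s hs hsi => by
        refine hc i s (hs.trans ?_) hsi
        intro w hw
        obtain ⟨x, hx, rfl⟩ := Finset.mem_image.1 hw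
        exact Finset.mem_image_of_mem _ (Finset.mem_image₂_of_mem y.2 hx)
      have := hall _ (Finset.mem_image₂_of_mem y.2 hxX)
      exact ⟨⟨x, hxX⟩, this.resolve_right hxl⟩
    choose z hz using hx
    refine hf₁ z (hc i _ ?_ ?_)
    · intro w hw
      obtain ⟨y, -, rfl⟩ := Finset.mem_image.1 hw
      exact Finset.mem_image_of_mem _ (Finset.mem_image₂_of_mem y.2 (z y).2)
    · intro w hw
      obtain ⟨y, -, rfl⟩ := Finset.mem_image.1 hw
      exact hz y

include hered split in
theorem exists_color_forall_antichain (hcone : ∀ i, ∀ᶠ w in V i, ∃ t, w = i :: t) :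
    ∃ i, ∀ (d : ℕ) (Y : Finset (List Bool)), IsTreeAntichain (Y : Set (List Bool)) →
      (∀ y ∈ Y, y.length ≤ d) → ∀ᶠ f : NodeMap in treeLaw V d false, R i (Y.image f) := by
  by_contra hcon
  have hbad : ∀ i, ∃ (d : ℕ) (Y : Finset (List Bool)), IsTreeAntichain (Y : Set (List Bool)) ∧
      (∀ y ∈ Y, y.length ≤ d) ∧ ∀ᶠ f : NodeMap in treeLaw V d false, ¬ R i (Y.image f) := by
    intro i
    by_contra h
    refine hcon ⟨i, fun d Y hY hYd => ?_⟩
    by_contra h'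
    exact h ⟨d, Y, hY, hYd, Ultrafilter.eventually_not.2 h'⟩
  obtain ⟨d, X, hX, hXd, hf⟩ := exists_antichain_avoiding hered hV hbad Set.univ Set.finite_univ
  obtain ⟨f, hf, hinc⟩ := (hf.and (eventually_treeLaw_incomparable hcone d false)).exists
  obtain ⟨c, hc⟩ := split (X.image f) (isTreeAntichain_image
    (fun η hη ν hν => hinc.2 η ν (hXd η hη) (hXd ν hν)) hX)
  obtain ⟨x, -, hx⟩ := hf c hc
  exact hx trivial

omit V hV in
include hered split in
/-- A Ramsey theorem for trees: if every antichain of the binary tree is coloured with finitely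
many colours, and comparable pairs satisfy one of two relations, then there are arbitrarily high
embedded trees whose antichains are all monochromatic in a fixed colour and whose
comparable pairs all satisfy the same relation. -/
theorem exists_monochromatic_trees (S : ι → Bool → List Bool → List Bool → Prop)
    (hS : ∀ i η ν, η <+: ν → η ≠ ν → R i {η} → S i false η ν ∨ S i true η ν) :
    ∃ i j, ∀ d : ℕ, ∃ f : List Bool → List Bool,
      (∀ Y : Finset (List Bool), IsTreeAntichain (Y : Set (List Bool)) →
        (∀ y ∈ Y, y.length ≤ d) → R i (Y.image f)) ∧
      ∀ η ν : List Bool, ν.length ≤ d → η <+: ν → η ≠ ν → S i j (f η) (f ν) := by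
  obtain ⟨V, hcone, hV⟩ := exists_cone_ultrafilters
  obtain ⟨i, hi⟩ := exists_color_forall_antichain hered split hV hcone
  have hpair : ∀ᶠ v in V false, (∀ᶠ w in V false, S i false v (v ++ w)) ∨
      ∀ᶠ w in V false, S i true v (v ++ w) := by
    have h0 := hi 0 {[]} (by intro η hη ν hν hne; simp_all) (by simp)
    rw [eventually_treeLaw_zero] at h0
    filter_upwards [h0] with v hv
    rw [← Ultrafilter.eventually_or]
    filter_upwards [hcone false] with w hw
    obtain ⟨t, rfl⟩ := hw
    exact hS i _ _ (List.prefix_append _ _) (by simp) (by simpa using hv)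
  obtain ⟨j, hj⟩ : ∃ j, ∀ᶠ v in V false, ∀ᶠ w in V false, S i j v (v ++ w) := by
    rcases Ultrafilter.eventually_or.1 hpair with h | h
    exacts [⟨_, h⟩, ⟨_, h⟩]
  refine ⟨i, j, fun d => ?_⟩
  have hnodes : {η : List Bool | η.length ≤ d}.Finite := List.finite_length_le Bool d
  have hanti : ∀ᶠ f : NodeMap in treeLaw V (2 * d) false, ∀ Y ∈ hnodes.toFinset.powerset,
      IsTreeAntichain (Y : Set (List Bool)) → R i ((Y.image insertFalse).image f) := by
    refine (eventually_all_finset _).2 fun Y hY => ?_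
    by_cases h : IsTreeAntichain (Y : Set (List Bool))
    · simp only [h, true_imp_iff]
      refine hi _ _ (isTreeAntichain_image
        (fun η _ ν _ hc => mt treeComparable_of_insertFalse hc) h) fun w hw => ?_
      obtain ⟨y, hy, rfl⟩ := Finset.mem_image.1 hw
      have : y.length ≤ d := by simpa using Finset.mem_powerset.1 hY hy
      rw [length_insertFalse]
      omega
    · exact Eventually.of_forall fun f h' => absurd h' h
  have hcomp : ∀ᶠ f : NodeMap in treeLaw V (2 * d) false, ∀ ν ∈ hnodes.toFinset,
      ∀ η ∈ hnodes.toFinset, η <+: ν → η ≠ ν →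
        S i j (f (insertFalse η)) (f (insertFalse ν)) := by
    refine (eventually_all_finset _).2 fun ν hν => (eventually_all_finset _).2 fun η _ => ?_
    by_cases h : η <+: ν ∧ η ≠ ν
    · obtain ⟨⟨t, rfl⟩, hne⟩ := h
      rcases t with - | ⟨b, t⟩
      · simp at hne
      have hlen : (insertFalse (η ++ b :: t)).length ≤ 2 * d := by
        rw [length_insertFalse]
        have := hnodes.mem_toFinset.1 hν
        exact Nat.mul_le_mul_left 2 this
      rw [insertFalse_append_cons] at hlen ⊢
      filter_upwards [(eventually_treeLaw_apply_apply hV false false hlen (S i j)).2 hj]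
        with f hf _ _ using hf
    · exact Eventually.of_forall fun f h₁ h₂ => absurd ⟨h₁, h₂⟩ h
  obtain ⟨f, hf₁, hf₂⟩ := (hanti.and hcomp).exists
  refine ⟨f ∘ insertFalse, fun Y hY hYd => ?_, fun η ν hν hp hne => ?_⟩
  · rw [← Finset.image_image]
    exact hf₁ Y (Finset.mem_powerset.2 fun y hy => hnodes.mem_toFinset.2 (hYd y hy)) hY
  · exact hf₂ ν (hnodes.mem_toFinset.2 hν) η (hnodes.mem_toFinset.2 (hp.length_le.trans hν)) hp hne

end Ramsey
section QuantifierFreeType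

variable {L' : FirstOrder.Language.{u, v}} {ι κ : Type*}

/-- The data of a quantifier-free type in a relational language `L` in variables indexed by `ι`:
the atomic formulas which hold, and the equalities between variables. -/
abbrev QFData (L : FirstOrder.Language.{u, v}) (ι : Type*) :=
  Set (Σ r : Σ k, L.Relations k, Fin r.1 → ι) × Set (ι × ι)

/-- Substitution of variables. -/
def QFData.comap (g : κ → ι) (d : QFData L ι) : QFData L κ :=
  ({p | ⟨p.1, g ∘ p.2⟩ ∈ d.1}, {p | (g p.1, g p.2) ∈ d.2})

/-- Restriction to a sublanguage. -/
def QFData.reduct (ϕ : L →ᴸ L') (d : QFData L' ι) : QFData L ι :=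
  ({p | ⟨⟨p.1.1, ϕ.onRelation p.1.2⟩, p.2⟩ ∈ d.1}, d.2)

/-- The quantifier-free type of a tuple (in a relational language). -/
def qfType (L : FirstOrder.Language.{u, v}) {N : Type*} [L.Structure N] (t : ι → N) :
    QFData L ι :=
  ({p | Structure.RelMap p.1.2 (t ∘ p.2)}, {p | t p.1 = t p.2})

variable {N : Type*} {N' : Type*} [L.Structure N] [L.Structure N']

theorem qfType_comp (t : ι → N) (g : κ → ι) : qfType L (t ∘ g) = (qfType L t).comap g := rfl

theorem qfType_comp_eq {t : ι → N} {t' : ι → N'} (h : qfType L t = qfType L t') (g : κ → ι) :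
    qfType L (t ∘ g) = qfType L (t' ∘ g) := by
  rw [qfType_comp, qfType_comp, h]

theorem relMap_iff_of_qfType_eq {t : ι → N} {t' : ι → N'} (h : qfType L t = qfType L t') {k : ℕ}
    (r : L.Relations k) (g : Fin k → ι) :
    Structure.RelMap r (t ∘ g) ↔ Structure.RelMap r (t' ∘ g) :=
  Set.ext_iff.1 (congrArg Prod.fst h) ⟨⟨k, r⟩, g⟩

theorem eq_iff_of_qfType_eq {t : ι → N} {t' : ι → N'} (h : qfType L t = qfType L t') (x y : ι) :
    t x = t y ↔ t' x = t' y :=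
  Set.ext_iff.1 (congrArg Prod.snd h) (x, y)

theorem qfType_embedding_comp (f : N ↪[L] N') (t : ι → N) : qfType L (f ∘ t) = qfType L t := by
  refine Prod.ext (Set.ext fun p => ?_) (Set.ext fun p => ?_)
  · exact f.map_rel p.1.2 (t ∘ p.2)
  · exact f.injective.eq_iff

theorem QFData.comap_reduct (ϕ : L →ᴸ L') (d : QFData L' ι) (g : κ → ι) :
    (d.reduct ϕ).comap g = (d.comap g).reduct ϕ := rfl

theorem QFData.ext_sum {d d' : QFData (L₁.sum L₂) ι}
    (h₁ : d.reduct LHom.sumInl = d'.reduct LHom.sumInl)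
    (h₂ : d.reduct LHom.sumInr = d'.reduct LHom.sumInr) : d = d' := by
  refine Prod.ext (Set.ext ?_) (congrArg Prod.snd h₁ :)
  rintro ⟨⟨k, r | r⟩, g⟩
  · exact Set.ext_iff.1 (congrArg Prod.fst h₁) ⟨⟨k, r⟩, g⟩
  · exact Set.ext_iff.1 (congrArg Prod.fst h₂) ⟨⟨k, r⟩, g⟩

/-- Tuples with the same quantifier-free type in an ultrahomogeneous structure are conjugate. -/
theorem exists_equiv_of_qfType_eq [L.IsRelational] [Finite ι] (hN : L.IsUltrahomogeneous N)
    {t t' : ι → N} (h : qfType L t = qfType L t') : ∃ g : N ≃[L] N, g ∘ t = t' := by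
  let S : L.Substructure N := ⟨Set.range t, fun f => isEmptyElim f⟩
  have hS : ∀ x : S, t (Set.rangeSplitting t x) = x := fun x => Set.apply_rangeSplitting t x
  have : Finite S := inferInstanceAs (Finite (Set.range t))
  have hSfg : S.FG := (Substructure.fg_iff_structure_fg S).2 Structure.FG.of_finite
  let e : S ↪[L] N :=
    { toFun := fun x => t' (Set.rangeSplitting t x)
      inj' := fun x y hxy => by
        have := (eq_iff_of_qfType_eq h _ _).2 hxy
        rw [hS, hS] at this
        exact Subtype.ext this
      map_fun' := fun f => isEmptyElim f
      map_rel' := fun r x => by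
        refine (relMap_iff_of_qfType_eq h r (fun k => Set.rangeSplitting t (x k))).symm.trans ?_
        rw [show t ∘ (fun k => Set.rangeSplitting t (x k)) = fun k => (x k : N) from
          funext fun k => hS _]
        exact Iff.rfl }
  obtain ⟨g, hg⟩ := hN S hSfg e
  refine ⟨g, funext fun k => ?_⟩
  have hk := DFunLike.congr_fun hg ⟨t k, k, rfl⟩
  refine hk.symm.trans ?_
  exact (eq_iff_of_qfType_eq h _ _).1 (hS ⟨t k, k, rfl⟩)

theorem exists_formula_qfType [Finite (Σ k, L.Relations k)] [Finite ι] (d : QFData L ι) :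
    ∃ χ : L.Formula ι, ∀ {P : Type w} [L.Structure P] (t : ι → P),
      χ.Realize t ↔ qfType L t = d := by
  classical
  let χ₁ : (Σ r : Σ k, L.Relations k, Fin r.1 → ι) → L.Formula ι := fun p =>
    if p ∈ d.1 then p.1.2.formula fun k => Term.var (p.2 k)
    else ∼(p.1.2.formula fun k => Term.var (p.2 k))
  let χ₂ : ι × ι → L.Formula ι := fun p =>
    if p ∈ d.2 then Term.equal (Term.var p.1) (Term.var p.2)
    else ∼(Term.equal (Term.var p.1) (Term.var p.2))
  refine ⟨Formula.iInf χ₁ ⊓ Formula.iInf χ₂, fun {P} _ t => ?_⟩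
  rw [Formula.realize_inf, Formula.realize_iInf, Formula.realize_iInf, Prod.ext_iff, Set.ext_iff,
    Set.ext_iff]
  refine and_congr (forall_congr' fun p => ?_) (forall_congr' fun p => ?_)
  · by_cases hp : p ∈ d.1
    · simp only [χ₁, hp, if_true, iff_true]
      exact Formula.realize_rel
    · simp only [χ₁, hp, if_false, iff_false, Formula.realize_not]
      exact not_congr Formula.realize_rel
  · by_cases hp : p ∈ d.2
    · simp only [χ₂, hp, if_true, iff_true]
      exact Formula.realize_equal
    · simp only [χ₂, hp, if_false, iff_false, Formula.realize_not]
      exact not_congr Formula.realize_equal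

theorem exists_realize_of_completeTheory [Finite ι] {F M : Type w} [L.Structure F] [L.Structure M]
    (hM : M ⊨ L.completeTheory F) (θ : L.Formula ι) {t : ι → M} (ht : θ.Realize t) :
    ∃ t' : ι → F, θ.Realize t' := by
  have key : ∀ (P : Type w) [L.Structure P],
      P ⊨ ((θ.relabel (Sum.inr : ι → Empty ⊕ ι)).iExs ι : L.Formula Empty) ↔
        ∃ s : ι → P, θ.Realize s := by
    intro P _
    rw [Sentence.Realize, Formula.realize_iExs]
    simp only [Formula.realize_relabel, Sum.elim_comp_inr]
  rw [← key]
  exact (realize_iff_of_model_completeTheory F M _).1 ((key M).2 ⟨t, ht⟩)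

theorem exists_qfType_eq_of_completeTheory [Finite (Σ k, L.Relations k)] [Finite ι]
    {F M : Type w} [L.Structure F] [L.Structure M] (hM : M ⊨ L.completeTheory F) (t : ι → M) :
    ∃ t' : ι → F, qfType L t' = qfType L t := by
  obtain ⟨χ, hχ⟩ := exists_formula_qfType.{u, v, w} (qfType L t)
  obtain ⟨t', ht'⟩ := exists_realize_of_completeTheory hM χ ((hχ t).2 rfl)
  exact ⟨t', (hχ t').1 ht'⟩

end QuantifierFreeType

section FiniteTrees

/-- A formula which has trees of parameters of every finite height in `N` has ATP. -/
theorem hasATP_of_finite_trees (N : Type (max u v)) [L.Structure N] [Nonempty N] {n m : ℕ}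
    (χ : L.Formula (Fin n ⊕ Fin m))
    (h : ∀ d : ℕ, ∃ a : List Bool → Fin m → N,
      (∀ Y : Finset (List Bool), IsTreeAntichain (Y : Set (List Bool)) →
        (∀ y ∈ Y, y.length ≤ d) → ∃ b : Fin n → N, ∀ η ∈ Y, χ.Realize (Sum.elim b (a η))) ∧
      ∀ η ν : List Bool, ν.length ≤ d → η <+: ν → η ≠ ν →
        ¬ ∃ b : Fin n → N, χ.Realize (Sum.elim b (a η)) ∧ χ.Realize (Sum.elim b (a ν))) :
    (L.completeTheory N).HasATP := by
  choose a ha₁ ha₂ using h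
  let U : Ultrafilter ℕ := Filter.hyperfilter ℕ
  have hlarge : ∀ k : ℕ, ∀ᶠ d in (U : Filter ℕ), k ≤ d := fun k =>
    (Nat.hyperfilter_le_atTop (Filter.eventually_ge_atTop k))
  let P := (U : Filter ℕ).Product fun _ => N
  have hP : P ⊨ L.completeTheory N := by
    refine (Theory.model_iff _).2 fun σ hσ => (Ultraproduct.sentence_realize σ).2 ?_
    exact Filter.Eventually.of_forall fun _ => hσ
  have hcast : ∀ (b : ℕ → Fin n → N) (c : ℕ → Fin m → N),
      χ.Realize (Sum.elim (fun k => ((fun d => b d k : ℕ → N) : P))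
        (fun k => ((fun d => c d k : ℕ → N) : P))) ↔
        ∀ᶠ d in (U : Filter ℕ), χ.Realize (Sum.elim (b d) (c d)) := by
    intro b c
    have := Ultraproduct.realize_formula_cast (u := U) (M := fun _ : ℕ => N) χ
      (Sum.elim (fun k d => b d k) (fun k d => c d k))
    convert this using 3
    · rename_i k; cases k <;> rfl
    · congr! 1
      funext k; cases k <;> rfl
  refine ⟨⟨P⟩, n, m, χ, fun η k => ((fun d => a d η k : ℕ → N) : P), fun X hX => ?_, ?_⟩
  · have hb : ∀ d, ∃ b : Fin n → N, (∀ y ∈ X, y.length ≤ d) →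
        ∀ η ∈ X, χ.Realize (Sum.elim b (a d η)) := by
      intro d
      by_cases hd : ∀ y ∈ X, y.length ≤ d
      · obtain ⟨b, hb⟩ := ha₁ d X hX hd
        exact ⟨b, fun _ => hb⟩
      · exact ⟨fun _ => Classical.arbitrary N, fun hd' => absurd hd' hd⟩
    choose b hb using hb
    refine ⟨fun k => ((fun d => b d k : ℕ → N) : P), fun η hη => (hcast b _).2 ?_⟩
    filter_upwards [hlarge (X.sup List.length)] with d hd
    exact hb d (fun y hy => (Finset.le_sup (f := List.length) hy).trans hd) η hη
  · have main : ∀ η ν : List Bool, η ≠ ν → η <+: ν → ∀ b : Fin n → P,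
        χ.Realize (Sum.elim b fun k => ((fun d => a d η k : ℕ → N) : P)) →
        ¬ χ.Realize (Sum.elim b fun k => ((fun d => a d ν k : ℕ → N) : P)) := by
      intro η ν hne hp b h₁ h₂
      obtain ⟨b', rfl⟩ : ∃ b' : ℕ → Fin n → N, (fun k => ((fun d => b' d k : ℕ → N) : P)) = b := by
        refine ⟨fun d k => Quotient.out (b k) d, funext fun k => ?_⟩
        exact Quotient.out_eq (b k)
      obtain ⟨d, ⟨hd₁, hd₂⟩, hd⟩ :=
        ((((hcast b' _).1 h₁).and ((hcast b' _).1 h₂)).and (hlarge ν.length)).exists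
      exact ha₂ d η ν hd hp hne ⟨_, hd₁, hd₂⟩
    rintro η ν hne (hc | hc) ⟨b, h₁, h₂⟩
    · exact main η ν hne hc b h₁ h₂
    · exact main ν η hne.symm hc b h₂ h₁

end FiniteTrees

section Sum

variable {L' : FirstOrder.Language.{u, v}}

/-- The family of conditions saying that some `b` has quantifier-free type `i` both over `a` and
over `a'` is realised in `N` after restriction to the sublanguage `L`. -/
def ReductConsistent (ϕ : L →ᴸ L') (N : Type*) [L.Structure N] {M : Type*} [L'.Structure M]
    {n m : ℕ} (i : QFData L' (Fin n ⊕ Fin m)) (a a' : Fin m → M) : Prop :=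
  ∃ (b : Fin n → N) (c c' : Fin m → N),
    qfType L (Sum.elim c c') = (qfType L' (Sum.elim a a')).reduct ϕ ∧
    qfType L (Sum.elim b c) = i.reduct ϕ ∧ qfType L (Sum.elim b c') = i.reduct ϕ

theorem hasATP_of_not_reductConsistent [Finite (Σ k, L.Relations k)] (ϕ : L →ᴸ L')
    {M : Type*} [L'.Structure M] {N : Type (max u v)} [L.Structure N] [Nonempty N]
    (htr : ∀ {ι : Type} [Finite ι] (t : ι → M),
      ∃ t' : ι → N, qfType L t' = (qfType L' t).reduct ϕ)
    {n m : ℕ} (a : List Bool → Fin m → M) (i : QFData L' (Fin n ⊕ Fin m))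
    (h : ∀ d : ℕ, ∃ f : List Bool → List Bool,
      (∀ Y : Finset (List Bool), IsTreeAntichain (Y : Set (List Bool)) →
        (∀ y ∈ Y, y.length ≤ d) →
          ∃ b : Fin n → M, ∀ η ∈ Y, qfType L' (Sum.elim b (a (f η))) = i) ∧
      ∀ η ν : List Bool, ν.length ≤ d → η <+: ν → η ≠ ν →
        ¬ ReductConsistent ϕ N i (a (f η)) (a (f ν))) :
    (L.completeTheory N).HasATP := by
  obtain ⟨χ, hχ⟩ := exists_formula_qfType.{u, v, max u v} (i.reduct ϕ)
  refine hasATP_of_finite_trees N χ fun d => ?_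
  obtain ⟨f, hf₁, hf₂⟩ := h d
  have hnodes : {η : List Bool | η.length ≤ d}.Finite := List.finite_length_le Bool d
  let D : Set (List Bool) := {η | η.length ≤ d}
  let A : Set (Finset (List Bool)) :=
    {Y | IsTreeAntichain (Y : Set (List Bool)) ∧ ∀ y ∈ Y, y.length ≤ d}
  have : Finite D := hnodes.to_subtype
  have hA : A.Finite := (Finset.finite_toSet hnodes.toFinset.powerset).subset fun Y hY =>
    Finset.mem_coe.2 (Finset.mem_powerset.2 fun y hy => hnodes.mem_toFinset.2 (hY.2 y hy))
  have : Finite A := hA.to_subtype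
  choose b hb using fun Y : A => hf₁ Y.1 Y.2.1 Y.2.2
  let t : (D × Fin m) ⊕ (A × Fin n) → M :=
    Sum.elim (fun p => a (f p.1.1) p.2) (fun p => b p.1 p.2)
  obtain ⟨t', ht'⟩ := htr t
  have hcomp : ∀ {κ : Type} (g : κ → (D × Fin m) ⊕ (A × Fin n)),
      qfType L (t' ∘ g) = (qfType L' (t ∘ g)).reduct ϕ := fun g => by
    rw [qfType_comp, qfType_comp, ht', QFData.comap_reduct]
  classical
  let a' : List Bool → Fin m → N := fun η k =>
    if hη : η ∈ D then t' (.inl (⟨η, hη⟩, k)) else Classical.arbitrary N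
  have ha' : ∀ η (hη : η ∈ D), a' η = t' ∘ fun k => .inl (⟨η, hη⟩, k) := fun η hη =>
    funext fun k => dif_pos hη
  refine ⟨a', fun Y hY hYd => ⟨t' ∘ fun k => .inr (⟨Y, hY, hYd⟩, k), fun η hη => ?_⟩,
    fun η ν hν hp hne => ?_⟩
  · rw [hχ, ha' η (hYd η hη), ← Sum.comp_elim, hcomp, Sum.comp_elim]
    exact congrArg _ (hb ⟨Y, hY, hYd⟩ η hη)
  · rintro ⟨b, h₁, h₂⟩
    refine hf₂ η ν hν hp hne ⟨b, a' η, a' ν, ?_, (hχ _).1 h₁, (hχ _).1 h₂⟩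
    rw [ha' η (hp.length_le.trans hν), ha' ν hν, ← Sum.comp_elim, hcomp, Sum.comp_elim]
    rfl

theorem exists_qfType_eq_reduct [L'.IsRelational] (ϕ : L →ᴸ L')
    {N P : Type w} [L.Structure N] [L'.Structure P]
    (h : ∀ S ∈ L'.age P, (⟨S, ϕ.reduct S⟩ : CategoryTheory.Bundled L.Structure) ∈ L.age N)
    {ι : Type*} [Finite ι] (t : ι → P) :
    ∃ t' : ι → N, qfType L t' = (qfType L' t).reduct ϕ := by
  let S : L'.Substructure P := ⟨Set.range t, fun f => isEmptyElim f⟩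
  have : Finite S := inferInstanceAs (Finite (Set.range t))
  have hS : CategoryTheory.Bundled.mk S ∈ L'.age P := ⟨Structure.FG.of_finite, ⟨S.subtype⟩⟩
  obtain ⟨-, ⟨e⟩⟩ := h _ hS
  let s : ι → S := fun k => ⟨t k, k, rfl⟩
  let _ : L.Structure S := ϕ.reduct S
  refine ⟨e ∘ s, (qfType_embedding_comp e s).trans ?_⟩
  exact congrArg (QFData.reduct ϕ) (qfType_embedding_comp S.subtype s).symm

variable [L₁.IsRelational] [L₂.IsRelational] {F₀ F₁ F : Type w}
  [L₁.Structure F₀] [L₂.Structure F₁] [(L₁.sum L₂).Structure F]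

/-- Tuples with the same equalities can be superposed in a structure whose age is the sum of the
ages. -/
theorem exists_superposition
    (hF : sumClass (L₁.age F₀) (L₂.age F₁) ⊆ (L₁.sum L₂).age F)
    {ι : Type*} [Finite ι] (t₀ : ι → F₀) (t₁ : ι → F₁) (h : ∀ x y, t₀ x = t₀ y ↔ t₁ x = t₁ y) :
    ∃ t : ι → F, (qfType (L₁.sum L₂) t).reduct LHom.sumInl = qfType L₁ t₀ ∧
      (qfType (L₁.sum L₂) t).reduct LHom.sumInr = qfType L₂ t₁ := by
  let S : Type w := Set.range t₀
  have : Finite S := inferInstanceAs (Finite (Set.range t₀))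
  let e₀ : S → F₀ := Subtype.val
  let e₁ : S → F₁ := fun x => t₁ (Set.rangeSplitting t₀ x)
  have he₁ : Function.Injective e₁ := fun x y hxy => by
    have := (h _ _).2 hxy
    exact Subtype.ext ((Set.apply_rangeSplitting t₀ x).symm.trans
      (this.trans (Set.apply_rangeSplitting t₀ y)))
  let s : ι → S := fun k => ⟨t₀ k, k, rfl⟩
  have hs₁ : e₁ ∘ s = t₁ := funext fun k => (h _ _).1 (Set.apply_rangeSplitting t₀ (s k))
  let I₁ : L₁.Structure S := ⟨fun f => isEmptyElim f, fun r x => Structure.RelMap r (e₀ ∘ x)⟩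
  let I₂ : L₂.Structure S := ⟨fun f => isEmptyElim f, fun r x => Structure.RelMap r (e₁ ∘ x)⟩
  let I : (L₁.sum L₂).Structure S := Language.sumStructure L₁ L₂ S
  have hS : (⟨S, I⟩ : CategoryTheory.Bundled (L₁.sum L₂).Structure) ∈ (L₁.sum L₂).age F := by
    refine hF ⟨⟨?_, ⟨?_⟩⟩, ?_, ⟨?_⟩⟩
    · exact @Structure.FG.of_finite _ _ (LHom.sumInl.reduct S) this
    · exact @Embedding.mk _ _ _ (LHom.sumInl.reduct S) _ ⟨e₀, Subtype.val_injective⟩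
        (fun f => isEmptyElim f) fun _ _ => Iff.rfl
    · exact @Structure.FG.of_finite _ _ (LHom.sumInr.reduct S) this
    · exact @Embedding.mk _ _ _ (LHom.sumInr.reduct S) _ ⟨e₁, he₁⟩
        (fun f => isEmptyElim f) fun _ _ => Iff.rfl
  obtain ⟨-, ⟨e⟩⟩ := hS
  refine ⟨e ∘ s, ?_, ?_⟩
  · have : qfType (L₁.sum L₂) (e ∘ s) = qfType (L₁.sum L₂) s := qfType_embedding_comp e s
    rw [this]
    exact Prod.ext rfl (Set.ext fun p => Subtype.val_injective.eq_iff.symm)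
  · have : qfType (L₁.sum L₂) (e ∘ s) = qfType (L₁.sum L₂) s := qfType_embedding_comp e s
    rw [this, ← hs₁]
    exact Prod.ext rfl (Set.ext fun p => he₁.eq_iff.symm)

theorem not_reductConsistent_or [Finite (Σ k, (L₁.sum L₂).Relations k)]
    (hF : sumClass (L₁.age F₀) (L₂.age F₁) ⊆ (L₁.sum L₂).age F)
    (hhom : (L₁.sum L₂).IsUltrahomogeneous F)
    {M : Type w} [(L₁.sum L₂).Structure M] (hM : M ⊨ (L₁.sum L₂).completeTheory F)
    {n m : ℕ} (φ : (L₁.sum L₂).Formula (Fin n ⊕ Fin m)) {a a' : Fin m → M} {b : Fin n → M}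
    (hb : φ.Realize (Sum.elim b a))
    (hinc : ¬ ∃ b : Fin n → M, φ.Realize (Sum.elim b a) ∧ φ.Realize (Sum.elim b a')) :
    ¬ ReductConsistent LHom.sumInl F₀ (qfType (L₁.sum L₂) (Sum.elim b a)) a a' ∨
      ¬ ReductConsistent LHom.sumInr F₁ (qfType (L₁.sum L₂) (Sum.elim b a)) a a' := by
  rw [← not_and_or]
  rintro ⟨⟨b₀, c₀, c₀', hc₀, hb₀, hb₀'⟩, b₁, c₁, c₁', hc₁, hb₁, hb₁'⟩
  let ι := Fin n ⊕ (Fin m ⊕ Fin m)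
  let g₁ : Fin n ⊕ Fin m → ι := Sum.map id Sum.inl
  let g₂ : Fin n ⊕ Fin m → ι := Sum.map id Sum.inr
  have hg₁ : ∀ {Q : Type w} (x : Fin n → Q) (y y' : Fin m → Q),
      Sum.elim x (Sum.elim y y') ∘ g₁ = Sum.elim x y := fun x y y' => by
    funext k; cases k <;> rfl
  have hg₂ : ∀ {Q : Type w} (x : Fin n → Q) (y y' : Fin m → Q),
      Sum.elim x (Sum.elim y y') ∘ g₂ = Sum.elim x y' := fun x y y' => by
    funext k; cases k <;> rfl
  -- transfer the configuration `(b, a, a')` to `F`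
  obtain ⟨t, htφ, htinc, ht⟩ : ∃ t : ι → F, φ.Realize (t ∘ g₁) ∧
      (¬ ∃ x : Fin n → F, φ.Realize (Sum.elim x (t ∘ Sum.inr ∘ Sum.inl)) ∧
        φ.Realize (Sum.elim x (t ∘ Sum.inr ∘ Sum.inr))) ∧
      qfType (L₁.sum L₂) t = qfType (L₁.sum L₂) (Sum.elim b (Sum.elim a a')) := by
    obtain ⟨χ, hχ⟩ := exists_formula_qfType.{_, _, w}
      (qfType (L₁.sum L₂) (Sum.elim b (Sum.elim a a')))
    let k₁ : Fin n ⊕ Fin m → ι ⊕ Fin n := Sum.elim Sum.inr (Sum.inl ∘ Sum.inr ∘ Sum.inl)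
    let k₂ : Fin n ⊕ Fin m → ι ⊕ Fin n := Sum.elim Sum.inr (Sum.inl ∘ Sum.inr ∘ Sum.inr)
    let θ := φ.relabel g₁ ⊓ (∼((φ.relabel k₁ ⊓ φ.relabel k₂).iExs (Fin n)) ⊓ χ)
    have hθ : ∀ {Q : Type w} [(L₁.sum L₂).Structure Q] (t : ι → Q), θ.Realize t ↔
        φ.Realize (t ∘ g₁) ∧ (¬ ∃ x : Fin n → Q, φ.Realize (Sum.elim x (t ∘ Sum.inr ∘ Sum.inl)) ∧
          φ.Realize (Sum.elim x (t ∘ Sum.inr ∘ Sum.inr))) ∧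
        qfType (L₁.sum L₂) t = qfType (L₁.sum L₂) (Sum.elim b (Sum.elim a a')) := by
      intro Q _ t
      simp only [θ, k₁, k₂, Formula.realize_inf, Formula.realize_not, Formula.realize_iExs, hχ,
        Formula.realize_relabel, Sum.comp_elim, Sum.elim_comp_inr, ← Function.comp_assoc,
        Sum.elim_comp_inl]
    obtain ⟨t, ht⟩ := exists_realize_of_completeTheory hM θ
      ((hθ (Sum.elim b (Sum.elim a a'))).2 ⟨by rwa [hg₁], hinc, rfl⟩)
    exact ⟨t, (hθ t).1 ht⟩
  have hker : ∀ x y : ι, Sum.elim b₀ (Sum.elim c₀ c₀') x = Sum.elim b₀ (Sum.elim c₀ c₀') y ↔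
      Sum.elim b₁ (Sum.elim c₁ c₁') x = Sum.elim b₁ (Sum.elim c₁ c₁') y := by
    have h₁ : ∀ x y, Sum.elim b₀ c₀ x = Sum.elim b₀ c₀ y ↔ Sum.elim b₁ c₁ x = Sum.elim b₁ c₁ y :=
      fun x y => Set.ext_iff.1 ((congrArg Prod.snd hb₀).trans (congrArg Prod.snd hb₁).symm) (x, y)
    have h₂ : ∀ x y, Sum.elim b₀ c₀' x = Sum.elim b₀ c₀' y ↔
        Sum.elim b₁ c₁' x = Sum.elim b₁ c₁' y := fun x y =>
      Set.ext_iff.1 ((congrArg Prod.snd hb₀').trans (congrArg Prod.snd hb₁').symm) (x, y)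
    have h₃ : ∀ x y, Sum.elim c₀ c₀' x = Sum.elim c₀ c₀' y ↔
        Sum.elim c₁ c₁' x = Sum.elim c₁ c₁' y := fun x y =>
      Set.ext_iff.1 ((congrArg Prod.snd hc₀).trans (congrArg Prod.snd hc₁).symm) (x, y)
    rintro (x | x | x) (y | y | y)
    exacts [h₁ (.inl x) (.inl y), h₁ (.inl x) (.inr y), h₂ (.inl x) (.inr y),
      h₁ (.inr x) (.inl y), h₃ (.inl x) (.inl y), h₃ (.inl x) (.inr y),
      h₂ (.inr x) (.inl y), h₃ (.inr x) (.inl y), h₃ (.inr x) (.inr y)]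
  obtain ⟨s, hs₀, hs₁⟩ := exists_superposition hF _ _ hker
  have hsg : ∀ {κ : Type} (g : κ → ι) (d : QFData (L₁.sum L₂) κ),
      qfType L₁ (Sum.elim b₀ (Sum.elim c₀ c₀') ∘ g) = d.reduct LHom.sumInl →
      qfType L₂ (Sum.elim b₁ (Sum.elim c₁ c₁') ∘ g) = d.reduct LHom.sumInr →
      qfType (L₁.sum L₂) (s ∘ g) = d := fun g d h₀ h₁ => by
    refine QFData.ext_sum ?_ ?_
    · rw [← h₀, qfType_comp, qfType_comp, ← hs₀]; rfl
    · rw [← h₁, qfType_comp, qfType_comp, ← hs₁]; rfl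
  have hs_inr : qfType (L₁.sum L₂) (s ∘ Sum.inr) = qfType (L₁.sum L₂) (t ∘ Sum.inr) := by
    rw [qfType_comp_eq ht Sum.inr]
    exact hsg _ _ hc₀ hc₁
  obtain ⟨g, hg⟩ := exists_equiv_of_qfType_eq hhom hs_inr
  have hreal : ∀ k : Fin n ⊕ Fin m → ι,
      qfType (L₁.sum L₂) (s ∘ k) = qfType (L₁.sum L₂) (Sum.elim b a) →
      φ.Realize (g ∘ s ∘ k) := fun k hk => by
    have : qfType (L₁.sum L₂) (t ∘ g₁) = qfType (L₁.sum L₂) (s ∘ k) := by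
      rw [hk, qfType_comp_eq ht g₁, hg₁]
    obtain ⟨g', hg'⟩ := exists_equiv_of_qfType_eq hhom this
    rw [StrongHomClass.realize_formula, ← hg', StrongHomClass.realize_formula]
    exact htφ
  refine htinc ⟨g ∘ s ∘ Sum.inl, ?_, ?_⟩
  · convert hreal g₁ (hsg _ _ (by rw [hg₁]; exact hb₀) (by rw [hg₁]; exact hb₁)) using 1
    funext k
    rcases k with k | k
    · rfl
    · exact (congrFun hg (.inl k)).symm
  · convert hreal g₂ (hsg _ _ (by rw [hg₂]; exact hb₀') (by rw [hg₂]; exact hb₁')) using 1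
    funext k
    rcases k with k | k
    · rfl
    · exact (congrFun hg (.inr k)).symm

end Sum

/-- **Theorem 3.15**: Let `K₀`, `K₁` be Fraïssé classes of finite structures in disjoint finite
relational languages, both with the strong amalgamation property, and let `F₀`, `F₁` be their
Fraïssé limits.  If the theories of `F₀` and `F₁` are both NATP, then the theory of the Fraïssé
limit `F₀ ⊕ F₁` of the sum class `K₀ ⊕ K₁` is NATP. -/
theorem sum_of_fraisse_limits_preserves_NATP
    [L₁.IsRelational] [L₂.IsRelational]
    [Finite (Σ n, L₁.Relations n)] [Finite (Σ n, L₂.Relations n)]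
    (K₀ : Set (CategoryTheory.Bundled.{max u v} L₁.Structure))
    (K₁ : Set (CategoryTheory.Bundled.{max u v} L₂.Structure))
    (hK₀ : IsFraisse K₀) (hK₁ : IsFraisse K₁)
    (hfin₀ : ∀ M ∈ K₀, Finite M) (hfin₁ : ∀ M ∈ K₁, Finite M)
    (hSAP₀ : IsSAP K₀) (hSAP₁ : IsSAP K₁)
    (F₀ : Type (max u v)) [L₁.Structure F₀] [Countable F₀] (hF₀ : IsFraisseLimit K₀ F₀)
    (F₁ : Type (max u v)) [L₂.Structure F₁] [Countable F₁] (hF₁ : IsFraisseLimit K₁ F₁)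
    (F : Type (max u v)) [(L₁.sum L₂).Structure F] [Countable F]
    (hF : IsFraisseLimit (sumClass K₀ K₁) F)
    (hNATP₀ : (L₁.completeTheory F₀).IsNATP) (hNATP₁ : (L₂.completeTheory F₁).IsNATP) :
    ((L₁.sum L₂).completeTheory F).IsNATP := by
  have hage₀ : L₁.age F₀ = K₀ := hF₀.age
  have hage₁ : L₂.age F₁ = K₁ := hF₁.age
  have hage : (L₁.sum L₂).age F = sumClass K₀ K₁ := hF.age
  have : Finite (Σ k, (L₁.sum L₂).Relations k) :=
    Finite.of_injective
      (fun r => r.2.elim (fun x => Sum.inl ⟨r.1, x⟩) (fun x => Sum.inr ⟨r.1, x⟩) :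
        (Σ k, (L₁.sum L₂).Relations k) → (Σ k, L₁.Relations k) ⊕ (Σ k, L₂.Relations k)) <| by
      rintro ⟨k, x | x⟩ ⟨l, y | y⟩ h <;> simp_all
      · obtain ⟨rfl, h⟩ := h
        simp_all
      · obtain ⟨rfl, h⟩ := h
        simp_all
  rintro ⟨M, n, m, φ, a, ha, hinc⟩
  have htr₀ : ∀ {ι : Type} [Finite ι] (t : ι → M), ∃ t' : ι → F₀,
      qfType L₁ t' = (qfType (L₁.sum L₂) t).reduct LHom.sumInl := fun t => by
    obtain ⟨s, hs⟩ := exists_qfType_eq_of_completeTheory M.is_model t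
    rw [← hs]
    refine exists_qfType_eq_reduct LHom.sumInl (fun S hS => ?_) s
    rw [hage₀]
    exact (hage ▸ hS : S ∈ sumClass K₀ K₁).1
  have htr₁ : ∀ {ι : Type} [Finite ι] (t : ι → M), ∃ t' : ι → F₁,
      qfType L₂ t' = (qfType (L₁.sum L₂) t).reduct LHom.sumInr := fun t => by
    obtain ⟨s, hs⟩ := exists_qfType_eq_of_completeTheory M.is_model t
    rw [← hs]
    refine exists_qfType_eq_reduct LHom.sumInr (fun S hS => ?_) s
    rw [hage₁]
    exact (hage ▸ hS : S ∈ sumClass K₀ K₁).2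
  have hne : Nonempty M := M.nonempty'
  have : Nonempty F₀ := (htr₀ fun _ : Unit => hne.some).elim fun t _ => ⟨t ()⟩
  have : Nonempty F₁ := (htr₁ fun _ : Unit => hne.some).elim fun t _ => ⟨t ()⟩
  let R : QFData (L₁.sum L₂) (Fin n ⊕ Fin m) → Finset (List Bool) → Prop := fun i Y =>
    ∃ b : Fin n → M, ∀ η ∈ Y, φ.Realize (Sum.elim b (a η)) ∧
      qfType (L₁.sum L₂) (Sum.elim b (a η)) = i
  let S : QFData (L₁.sum L₂) (Fin n ⊕ Fin m) → Bool → List Bool → List Bool → Prop :=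
    fun i j η ν => if j then ¬ ReductConsistent LHom.sumInr F₁ i (a η) (a ν)
      else ¬ ReductConsistent LHom.sumInl F₀ i (a η) (a ν)
  obtain ⟨i, j, hij⟩ := exists_monochromatic_trees (R := R)
    (fun i s t hst ⟨b, hb⟩ => ⟨b, fun η hη => hb η (hst hη)⟩)
    (fun X hX => by
      obtain ⟨b, hb⟩ := ha X hX
      exact ⟨fun η => qfType (L₁.sum L₂) (Sum.elim b (a η)),
        fun i s hs hi => ⟨b, fun η hη => ⟨hb η (hs hη), hi η hη⟩⟩⟩)
    S (fun i η ν hp hne hR => by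
      obtain ⟨b, hb⟩ := hR
      obtain ⟨hbφ, rfl⟩ := hb η (Finset.mem_singleton_self η)
      exact not_reductConsistent_or (by rw [hage₀, hage₁, hage]) hF.ultrahomogeneous M.is_model φ
        hbφ (hinc η ν hne (.inl hp)))
  have hcolor : ∀ d : ℕ, ∀ f : List Bool → List Bool,
      (∀ Y : Finset (List Bool), IsTreeAntichain (Y : Set (List Bool)) →
        (∀ y ∈ Y, y.length ≤ d) → R i (Y.image f)) →
      ∀ Y : Finset (List Bool), IsTreeAntichain (Y : Set (List Bool)) →
        (∀ y ∈ Y, y.length ≤ d) →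
          ∃ b : Fin n → M, ∀ η ∈ Y, qfType (L₁.sum L₂) (Sum.elim b (a (f η))) = i :=
    fun d f hf Y hY hYd => (hf Y hY hYd).imp fun b hb η hη =>
      (hb (f η) (Finset.mem_image_of_mem f hη)).2
  cases j with
  | false =>
    exact hNATP₀ (hasATP_of_not_reductConsistent LHom.sumInl htr₀ a i fun d =>
      (hij d).imp fun f hf => ⟨hcolor d f hf.1, hf.2⟩)
  | true =>
    exact hNATP₁ (hasATP_of_not_reductConsistent LHom.sumInr htr₁ a i fun d =>
      (hij d).imp fun f hf => ⟨hcolor d f hf.1, hf.2⟩)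

end NATPPaper
end

section
/- Let T be a geometric complete theory and T* be either the theory T_p of lovely pairs or the theory T^ind of H-structures associated with T. If there is an L_H-formula φ(x,y) such that the formula φ(x,y) ∧ H(x) witnesses ATP of T*, then T has ATP. -/
open FirstOrder FirstOrder.Language

universe u v w

namespace NATPPaper

section Acl

variable {L : FirstOrder.Language.{u, v}}

/-- Model-theoretic algebraic closure. -/
def acl (L : FirstOrder.Language.{u, v}) (M : Type w) [L.Structure M] (A : Set M) : Set M :=
  {x | ∃ (k : ℕ) (φ : L.Formula (Fin 1 ⊕ Fin k)) (c : Fin k → M),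
        (∀ j, c j ∈ A) ∧ φ.Realize (Sum.elim (fun _ => x) c) ∧
        {y : M | φ.Realize (Sum.elim (fun _ => y) c)}.Finite}

/-- `T` eliminates the quantifier `∃^∞`. -/
def EliminatesExInf (T : L.Theory) : Prop :=
  ∀ (k : ℕ) (φ : L.Formula (Fin 1 ⊕ Fin k)), ∃ N : ℕ,
    ∀ (M : Theory.ModelType.{u, v, max u v} T) (c : Fin k → M),
      (∃ s : Finset M, N ≤ s.card ∧ ∀ x ∈ s, φ.Realize (Sum.elim (fun _ => x) c)) →
      {x : (M : Type (max u v)) | φ.Realize (Sum.elim (fun _ => x) c)}.Infinite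

/-- Algebraic closure satisfies the exchange property in every model of `T`. -/
def AclExchange (T : L.Theory) : Prop :=
  ∀ (M : Theory.ModelType.{u, v, max u v} T) (A : Set M) (a b : M),
    a ∈ acl L M (A ∪ {b}) → a ∉ acl L M A → b ∈ acl L M (A ∪ {a})

/-- A geometric theory: complete, eliminates `∃^∞`, and `acl` satisfies exchange. -/
def IsGeometric (T : L.Theory) : Prop :=
  T.IsComplete ∧ EliminatesExInf T ∧ AclExchange T

end Acl

section Types

variable {L : FirstOrder.Language.{u, v}}

structure ParamFormula (L : FirstOrder.Language.{u, v}) (N : Type w) : Type (max u v w) where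
  k : ℕ
  toFormula : L.Formula (Fin 1 ⊕ Fin k)
  params : Fin k → N

def ParamFormula.RealizeIn {N : Type w} (S : L.Structure N)
    (pf : ParamFormula L N) (x : N) : Prop :=
  @Formula.Realize L N S _ pf.toFormula (Sum.elim (fun _ => x) pf.params)

def ParamFormula.neg {N : Type w} (pf : ParamFormula L N) : ParamFormula L N :=
  ⟨pf.k, pf.toFormula.not, pf.params⟩

def IsCompleteTypeOver {N : Type w} (S : L.Structure N) (C : Set N)
    (q : Set (ParamFormula L N)) : Prop :=
  (∀ pf ∈ q, ∀ j, pf.params j ∈ C) ∧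
  (∀ pf : ParamFormula L N, (∀ j, pf.params j ∈ C) → (pf ∈ q ∨ pf.neg ∈ q)) ∧
  (∀ F : Finset (ParamFormula L N), ↑F ⊆ q → ∃ x : N, ∀ pf ∈ F, pf.RealizeIn S x)

def IsNonAlgebraic {N : Type w} (S : L.Structure N) (q : Set (ParamFormula L N)) : Prop :=
  ∀ pf ∈ q, {x : N | pf.RealizeIn S x}.Infinite

end Types

section Lovely

/-- The language consisting of a single unary predicate `H`. -/
def hLang : FirstOrder.Language.{u, v} := ⟨fun _ => PEmpty, fun n => ULift (PLift (n = 1))⟩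

/-- The language `L_H = L ∪ {H}`. -/
abbrev LH (L : FirstOrder.Language.{u, v}) : FirstOrder.Language.{u, v} := L.sum hLang

/-- The predicate symbol `H`. -/
def hSym (L : FirstOrder.Language.{u, v}) : (LH L).Relations 1 := Sum.inr ⟨⟨rfl⟩⟩

variable (L : FirstOrder.Language.{u, v}) (M : Type w) [(LH L).Structure M]

/-- The set `H(M)`. -/
def HSet : Set M := {x | Structure.RelMap (hSym L) ![x]}

/-- The `L`-reduct of an `L_H`-structure. -/
def lred : L.Structure M := (LHom.sumInl : L →ᴸ LH L).reduct M

/-- `(M, H(M))` is a dense/co-dense expansion: every non-algebraic 1-type in `L` over a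
finite-dimensional set `A` has realizations both in `H(M)` and in `M ∖ acl_T(A ∪ H(M))`. -/
def IsDenseCodense : Prop :=
  ∀ A : Set M, (∃ B : Finset M, A ⊆ @acl L M (lred L M) ↑B) →
    ∀ q : Set (ParamFormula L M), IsCompleteTypeOver (lred L M) A q →
      IsNonAlgebraic (lred L M) q →
      (∃ x ∈ HSet L M, ∀ pf ∈ q, pf.RealizeIn (lred L M) x) ∧
      (∃ y : M, y ∉ @acl L M (lred L M) (A ∪ HSet L M) ∧
        ∀ pf ∈ q, pf.RealizeIn (lred L M) y)

/-- `(M, H(M))` is a lovely pair of models of `T`: the `L`-reduct models `T`, it is a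
dense/co-dense expansion, and `H(M)` is (the underlying set of) an elementary
`L`-substructure. -/
def IsLovelyPair (T : L.Theory) : Prop :=
  (@Theory.Model L M (lred L M) T) ∧ IsDenseCodense L M ∧
    ∃ S : @Language.ElementarySubstructure L M (lred L M), (S : Set M) = HSet L M

/-- `(M, H(M))` is an H-structure associated with `T`: the `L`-reduct models `T`, it is a
dense/co-dense expansion, and `H(M)` is an `L`-algebraically independent set. -/
def IsHStructureExp (T : L.Theory) : Prop :=
  (@Theory.Model L M (lred L M) T) ∧ IsDenseCodense L M ∧
    ∀ x ∈ HSet L M, x ∉ @acl L M (lred L M) (HSet L M \ {x})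

end Lovely


/-- The pair `(φ(x,y) ∧ H(x), (a_η)_{η ∈ 2^{<ω}})` witnesses ATP (realizations constrained to
lie in `H`). -/
def ATPWitnessH {L : FirstOrder.Language.{u, v}} {M : Type w} [(LH L).Structure M] {n m : ℕ}
    (φ : (LH L).Formula (Fin n ⊕ Fin m)) (a : List Bool → Fin m → M) : Prop :=
  (∀ X : Finset (List Bool), IsTreeAntichain ↑X →
      ∃ b : Fin n → M, (∀ i, b i ∈ HSet L M) ∧ ∀ η ∈ X, φ.Realize (Sum.elim b (a η))) ∧
  (∀ η ν : List Bool, η ≠ ν → TreeComparable η ν →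
      ¬ ∃ b : Fin n → M, (∀ i, b i ∈ HSet L M) ∧
          φ.Realize (Sum.elim b (a η)) ∧ φ.Realize (Sum.elim b (a ν)))

section FirstOrderPredicates

/-- A predicate on tuples of elements of `L`-structures which is uniformly given by a formula. -/
def FO (L : FirstOrder.Language.{u, v}) (α : Type*)
    (P : ∀ (M : Type w) [L.Structure M], (α → M) → Prop) : Prop :=
  ∃ θ : L.Formula α, ∀ (M : Type w) [L.Structure M] (v : α → M), θ.Realize v ↔ P M v

/-- The set `S` has at least `K` elements. -/
def AtLeast {M : Type*} (K : ℕ) (S : Set M) : Prop :=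
  ∃ z : Fin K → M, Function.Injective z ∧ ∀ k, z k ∈ S

variable {L : FirstOrder.Language.{u, v}} {α β : Type*}
  {P Q : ∀ (M : Type w) [L.Structure M], (α → M) → Prop}

theorem FO.congr (h : FO.{u, v, w} L α P)
    (e : ∀ (M : Type w) [L.Structure M] (v : α → M), P M v ↔ Q M v) : FO.{u, v, w} L α Q :=
  let ⟨θ, hθ⟩ := h
  ⟨θ, fun M _ v => (hθ M v).trans (e M v)⟩

theorem FO.realize (θ : L.Formula β) (t : ∀ (M : Type w) [L.Structure M], (α → M) → β → M)
    (g : β → α) (hg : ∀ (M : Type w) [L.Structure M] (v : α → M), t M v = v ∘ g) :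
    FO.{u, v, w} L α (fun M _ v => θ.Realize (t M v)) :=
  ⟨θ.relabel g, fun M _ v => by rw [Formula.realize_relabel]; beta_reduce; rw [hg]⟩

theorem FO.realizeElim {γ : Type*} (θ : L.Formula (β ⊕ γ)) (f : β → α) (g : γ → α) :
    FO.{u, v, w} L α (fun _ _ v => θ.Realize (Sum.elim (fun i => v (f i)) (fun j => v (g j)))) :=
  FO.realize θ _ (Sum.elim f g) fun _ _ _ => by ext (_ | _) <;> rfl

theorem FO.realizeElim₃ {γ δ : Type*} (θ : L.Formula (β ⊕ (γ ⊕ δ))) (f : β → α) (g : γ → α)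
    (h : δ → α) : FO.{u, v, w} L α (fun _ _ v => θ.Realize
      (Sum.elim (fun i => v (f i)) (Sum.elim (fun j => v (g j)) (fun j => v (h j))))) :=
  FO.realize θ _ (Sum.elim f (Sum.elim g h)) fun _ _ _ => by ext (_ | _ | _) <;> rfl

theorem FO.eq (i j : α) : FO.{u, v, w} L α (fun _ _ v => v i = v j) :=
  ⟨(Term.var i).equal (Term.var j), fun M _ v => by simp⟩

theorem FO.not (h : FO.{u, v, w} L α P) : FO.{u, v, w} L α (fun M _ v => ¬ P M v) :=
  let ⟨θ, hθ⟩ := h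
  ⟨θ.not, fun M _ v => by rw [Formula.realize_not, hθ]⟩

theorem FO.and (h : FO.{u, v, w} L α P) (h' : FO.{u, v, w} L α Q) :
    FO.{u, v, w} L α (fun M _ v => P M v ∧ Q M v) :=
  let ⟨θ, hθ⟩ := h
  let ⟨θ', hθ'⟩ := h'
  ⟨θ ⊓ θ', fun M _ v => by rw [Formula.realize_inf, hθ, hθ']⟩

theorem FO.or (h : FO.{u, v, w} L α P) (h' : FO.{u, v, w} L α Q) :
    FO.{u, v, w} L α (fun M _ v => P M v ∨ Q M v) :=
  let ⟨θ, hθ⟩ := h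
  let ⟨θ', hθ'⟩ := h'
  ⟨θ ⊔ θ', fun M _ v => by rw [Formula.realize_sup, hθ, hθ']⟩

theorem FO.imp (h : FO.{u, v, w} L α P) (h' : FO.{u, v, w} L α Q) :
    FO.{u, v, w} L α (fun M _ v => P M v → Q M v) :=
  (h.not.or h').congr fun _ _ _ => imp_iff_not_or.symm

theorem FO.iff (h : FO.{u, v, w} L α P) (h' : FO.{u, v, w} L α Q) :
    FO.{u, v, w} L α (fun M _ v => P M v ↔ Q M v) :=
  ((h.imp h').and (h'.imp h)).congr fun _ _ _ => iff_iff_implies_and_implies.symm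

theorem FO.const (p : Prop) : FO.{u, v, w} L α (fun _ _ _ => p) := by
  by_cases hp : p
  · exact ⟨⊤, fun M _ v => by simp [hp]⟩
  · exact ⟨⊥, fun M _ v => by simp [hp]⟩

theorem FO.forallFinite {ι : Type*} [Finite ι]
    {P : ι → ∀ (M : Type w) [L.Structure M], (α → M) → Prop}
    (h : ∀ i, FO.{u, v, w} L α (P i)) : FO.{u, v, w} L α (fun M _ v => ∀ i, P i M v) := by
  choose θ hθ using h
  exact ⟨Formula.iInf θ, fun M _ v => by simp [Formula.realize_iInf, hθ]⟩

theorem FO.existsFinite {ι : Type*} [Finite ι]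
    {P : ι → ∀ (M : Type w) [L.Structure M], (α → M) → Prop}
    (h : ∀ i, FO.{u, v, w} L α (P i)) : FO.{u, v, w} L α (fun M _ v => ∃ i, P i M v) := by
  choose θ hθ using h
  exact ⟨Formula.iSup θ, fun M _ v => by simp [Formula.realize_iSup, hθ]⟩

theorem FO.exTuple [Finite β] {Q : ∀ (M : Type w) [L.Structure M], (α → M) → (β → M) → Prop}
    (h : FO.{u, v, w} L (α ⊕ β) (fun M _ v => Q M (fun i => v (.inl i)) (fun i => v (.inr i)))) :
    FO.{u, v, w} L α (fun M _ v => ∃ x, Q M v x) := by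
  obtain ⟨θ, hθ⟩ := h
  exact ⟨θ.iExs β, fun M _ v => by simp [Formula.realize_iExs, hθ]⟩

theorem FO.allTuple [Finite β] {Q : ∀ (M : Type w) [L.Structure M], (α → M) → (β → M) → Prop}
    (h : FO.{u, v, w} L (α ⊕ β) (fun M _ v => Q M (fun i => v (.inl i)) (fun i => v (.inr i)))) :
    FO.{u, v, w} L α (fun M _ v => ∀ x, Q M v x) :=
  (FO.exTuple (Q := fun M _ v x => ¬ Q M v x) h.not).not.congr fun _ _ _ => by simp

theorem FO.ex {Q : ∀ (M : Type w) [L.Structure M], (α → M) → M → Prop}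
    (h : FO.{u, v, w} L (α ⊕ Fin 1) (fun M _ v => Q M (fun i => v (.inl i)) (v (.inr 0)))) :
    FO.{u, v, w} L α (fun M _ v => ∃ x, Q M v x) :=
  (FO.exTuple (Q := fun M _ v x => Q M v (x 0)) h).congr fun _ _ _ =>
    ⟨fun ⟨x, hx⟩ => ⟨x 0, hx⟩, fun ⟨x, hx⟩ => ⟨fun _ => x, hx⟩⟩

theorem FO.all {Q : ∀ (M : Type w) [L.Structure M], (α → M) → M → Prop}
    (h : FO.{u, v, w} L (α ⊕ Fin 1) (fun M _ v => Q M (fun i => v (.inl i)) (v (.inr 0)))) :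
    FO.{u, v, w} L α (fun M _ v => ∀ x, Q M v x) :=
  (FO.ex (Q := fun M _ v x => ¬ Q M v x) h.not).not.congr fun _ _ _ => by simp

theorem FO.comap (h : FO.{u, v, w} L α P) (t : ∀ (M : Type w) [L.Structure M], (β → M) → α → M)
    (g : α → β) (hg : ∀ (M : Type w) [L.Structure M] (v : β → M), t M v = v ∘ g) :
    FO.{u, v, w} L β (fun M _ v => P M (t M v)) := by
  obtain ⟨θ, hθ⟩ := h
  exact (FO.realize θ t g hg).congr fun M _ v => hθ M _

theorem FO.atLeast (K : ℕ) {Q : ∀ (M : Type w) [L.Structure M], (α → M) → M → Prop}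
    (h : FO.{u, v, w} L (α ⊕ Fin 1) (fun M _ v => Q M (fun i => v (.inl i)) (v (.inr 0)))) :
    FO.{u, v, w} L α (fun M _ v => AtLeast K {x | Q M v x}) := by
  refine FO.exTuple (β := Fin K)
    (Q := fun M _ v z => Function.Injective z ∧ ∀ k, z k ∈ {x | Q M v x}) (FO.and ?_ ?_)
  · refine FO.forallFinite fun i => FO.forallFinite fun j => (FO.eq _ _).imp (FO.const _)
  · refine FO.forallFinite fun k => ?_
    exact h.comap (β := α ⊕ Fin K)
      (fun M _ v => Sum.elim (fun i => v (Sum.inl i)) (fun _ => v (Sum.inr k)))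
      (Sum.elim Sum.inl fun _ => Sum.inr k) (fun M _ v => by ext (_ | _) <;> rfl)

theorem FO.elementary {M N : Type w} [L.Structure M] [L.Structure N] (h : FO.{u, v, w} L α P)
    (f : M ↪ₑ[L] N) (v : α → M) : P N (f ∘ v) ↔ P M v := by
  obtain ⟨θ, hθ⟩ := h
  rw [← hθ, ← hθ, f.map_formula]

end FirstOrderPredicates

section AtLeast

variable {M : Type*} {S : Set M}

theorem AtLeast.mono {K K' : ℕ} (h : AtLeast K S) (hK : K' ≤ K) : AtLeast K' S :=
  let ⟨z, hz, hS⟩ := h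
  ⟨z ∘ Fin.castLE hK, hz.comp (Fin.castLE_injective hK), fun _ => hS _⟩

theorem atLeast_of_infinite (h : S.Infinite) (K : ℕ) : AtLeast K S :=
  ⟨fun k => h.natEmbedding S k, fun _ _ hij => Fin.ext ((h.natEmbedding S).injective (Subtype.ext hij)),
    fun k => (h.natEmbedding S k).2⟩

theorem exists_not_atLeast_of_finite (h : S.Finite) : ∃ K, ¬ AtLeast K S := by
  refine ⟨h.toFinset.card + 1, fun ⟨z, hz, hS⟩ => ?_⟩
  have := Finset.card_le_card (s := Finset.univ.map ⟨z, hz⟩) (t := h.toFinset) (by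
    intro x hx
    obtain ⟨k, -, rfl⟩ := Finset.mem_map.1 hx
    simpa using hS k)
  simp at this

theorem finite_of_not_atLeast {K : ℕ} (h : ¬ AtLeast K S) : S.Finite :=
  by_contra fun hS => h (atLeast_of_infinite hS K)

theorem exists_finset_of_atLeast {K : ℕ} (h : AtLeast K S) :
    ∃ s : Finset M, K ≤ s.card ∧ ∀ x ∈ s, x ∈ S := by
  obtain ⟨z, hz, hS⟩ := h
  exact ⟨Finset.univ.map ⟨z, hz⟩, by simp, by simpa using hS⟩

end AtLeast

section Compactness

variable {L : FirstOrder.Language.{u, v}}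

/-- A finitely satisfiable family of formulas with parameters is realized in an elementary
extension. -/
theorem exists_elementary_extension_realize {N : Type w} [L.Structure N] [Nonempty N]
    {σ : Type*} {J : Type w} (Θ : J → L.Formula (N ⊕ σ))
    (h : ∀ F : Finset J, ∃ s : σ → N, ∀ j ∈ F, (Θ j).Realize (Sum.elim id s)) :
    ∃ (N' : Type w) (_ : L.Structure N') (_ : Nonempty N') (f : N ↪ₑ[L] N') (s : σ → N'),
      ∀ j, (Θ j).Realize (Sum.elim f s) := by
  classical
  choose s hs using h
  let U : Ultrafilter (Finset J) := Ultrafilter.of Filter.atTop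
  let N' := (U : Filter (Finset J)).Product (fun _ => N)
  let f : N → N' := fun x => ((fun _ => x : Finset J → N) : N')
  have hf : ∀ {α : Type (max u v w)} (θ : L.Formula α) (v : α → N),
      θ.Realize (f ∘ v) ↔ θ.Realize v := by
    intro α θ v
    have := Ultraproduct.realize_formula_cast (u := U) (M := fun _ => N) θ (fun i _ => v i)
    refine Iff.trans this ?_
    simp
  refine ⟨N', inferInstance, inferInstance, ⟨f, fun n θ x => ?_⟩,
    fun i => ((fun F => s F i : Finset J → N) : N'), fun j => ?_⟩
  · have := Ultraproduct.realize_formula_cast (u := U) (M := fun _ => N) θ (fun i _ => x i)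
    refine Iff.trans this ?_
    simp
  · have := Ultraproduct.realize_formula_cast (u := U) (M := fun _ => N) (Θ j)
      (Sum.elim (fun x _ => x) (fun i F => s F i))
    have key : (fun i => ((Sum.elim (fun x _ => x) (fun i F => s F i) : N ⊕ σ → Finset J → N) i :
        N')) = Sum.elim f (fun i => ((fun F => s F i : Finset J → N) : N')) := by
      ext (_ | _) <;> rfl
    rw [key] at this
    refine this.2 ?_
    have hle : ∀ᶠ F : Finset J in (U : Filter (Finset J)), {j} ≤ F :=
      (Filter.eventually_ge_atTop {j}).filter_mono (Ultrafilter.of_le _)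
    filter_upwards [hle] with F hF
    have := hs F j (by simpa using hF)
    convert this using 1
    ext (_ | _) <;> rfl

end Compactness

section AclBasics

variable {L : FirstOrder.Language.{u, v}} {M : Type w} [L.Structure M]

/-- The formula `θ(x; y)` has uniformly boundedly many solutions `x`, in every structure and for
every value of the parameters `y`. -/
def UBdd {κ : Type*} (θ : L.Formula (Fin 1 ⊕ κ)) : Prop :=
  ∃ K : ℕ, ∀ (M : Type w) [L.Structure M] (c : κ → M),
    ¬ AtLeast K {x : M | θ.Realize (Sum.elim (fun _ => x) c)}

theorem UBdd.finite {κ : Type*} {θ : L.Formula (Fin 1 ⊕ κ)} (h : UBdd.{u, v, w} θ) (c : κ → M) :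
    {x : M | θ.Realize (Sum.elim (fun _ => x) c)}.Finite :=
  let ⟨_, hK⟩ := h
  finite_of_not_atLeast (hK M c)

theorem realize_relabel_equiv {κ κ' : Type*} (θ : L.Formula (Fin 1 ⊕ κ)) (e : κ ≃ κ') (c : κ → M)
    (y : M) : (θ.relabel (Sum.map id e)).Realize (Sum.elim (fun _ => y) (c ∘ e.symm)) ↔
      θ.Realize (Sum.elim (fun _ => y) c) := by
  rw [Formula.realize_relabel]
  have : (Sum.elim (fun _ => y) (c ∘ e.symm) ∘ Sum.map id e : Fin 1 ⊕ κ → M) =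
    Sum.elim (fun _ => y) c := by ext (_ | _) <;> simp
  rw [this]

theorem mem_acl_of_formula {κ : Type*} [Finite κ] {A : Set M} {x : M}
    (θ : L.Formula (Fin 1 ⊕ κ)) (c : κ → M) (hc : ∀ j, c j ∈ A)
    (hx : θ.Realize (Sum.elim (fun _ => x) c))
    (hfin : {y : M | θ.Realize (Sum.elim (fun _ => y) c)}.Finite) : x ∈ acl L M A := by
  obtain ⟨k, ⟨e⟩⟩ := Finite.exists_equiv_fin κ
  have key := realize_relabel_equiv θ e c
  refine ⟨k, θ.relabel (Sum.map id e), c ∘ e.symm, fun j => hc _, (key x).2 hx, ?_⟩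
  simpa only [key] using hfin

theorem mem_acl_of_uBdd {κ : Type*} [Finite κ] {A : Set M} {x : M}
    {θ : L.Formula (Fin 1 ⊕ κ)} (hθ : UBdd.{u, v, w} θ) (c : κ → M) (hc : ∀ j, c j ∈ A)
    (hx : θ.Realize (Sum.elim (fun _ => x) c)) : x ∈ acl L M A :=
  mem_acl_of_formula θ c hc hx (hθ.finite c)

theorem exists_uBdd {κ : Type*} [Finite κ] (θ : L.Formula (Fin 1 ⊕ κ)) (K : ℕ) :
    ∃ θ' : L.Formula (Fin 1 ⊕ κ), UBdd.{u, v, w} θ' ∧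
      ∀ (M : Type w) [L.Structure M] (x : M) (c : κ → M),
        θ'.Realize (Sum.elim (fun _ => x) c) ↔ θ.Realize (Sum.elim (fun _ => x) c) ∧
          ¬ AtLeast K {y : M | θ.Realize (Sum.elim (fun _ => y) c)} := by
  have hA : FO.{u, v, w} L (Fin 1 ⊕ κ) (fun M _ v =>
      AtLeast K {y : M | θ.Realize (Sum.elim (fun _ => y) (fun j => v (Sum.inr j)))}) :=
    FO.atLeast K (Q := fun M _ v y => θ.Realize (Sum.elim (fun _ => y) (fun j => v (Sum.inr j))))
      (FO.realize θ _ (Sum.elim (fun i => Sum.inr i) (fun j => Sum.inl (Sum.inr j)))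
        (fun M _ v => by
          ext (i | _)
          · obtain rfl := Subsingleton.elim i 0; rfl
          · rfl))
  obtain ⟨θ', h'⟩ := (FO.realize θ (fun _ _ v => v) id (fun _ _ _ => rfl)).and hA.not
  refine ⟨θ', ⟨K + 1, fun M _ c h => ?_⟩, fun M _ x c => (h' M _).trans (by simp)⟩
  simp only [h', Sum.elim_inr] at h
  refine (h.choose_spec.2 0).2 (AtLeast.mono ?_ K.le_succ)
  exact h.imp fun z hz => ⟨hz.1, fun k => (hz.2 k).1⟩

theorem mem_acl_iff {A : Set M} {x : M} : x ∈ acl L M A ↔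
    ∃ (k : ℕ) (θ : L.Formula (Fin 1 ⊕ Fin k)) (c : Fin k → M), UBdd.{u, v, w} θ ∧
      (∀ j, c j ∈ A) ∧ θ.Realize (Sum.elim (fun _ => x) c) := by
  constructor
  · rintro ⟨k, θ, c, hc, hx, hfin⟩
    obtain ⟨K, hK⟩ := exists_not_atLeast_of_finite hfin
    obtain ⟨θ', hθ', h⟩ := exists_uBdd.{u, v, w} θ K
    exact ⟨k, θ', c, hθ', hc, (h M x c).2 ⟨hx, hK⟩⟩
  · rintro ⟨k, θ, c, hθ, hc, hx⟩
    exact mem_acl_of_uBdd hθ c hc hx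

theorem acl_mono {A B : Set M} (h : A ⊆ B) : acl L M A ⊆ acl L M B :=
  fun _ ⟨k, φ, c, hc, hx⟩ => ⟨k, φ, c, fun j => h (hc j), hx⟩

theorem subset_acl (A : Set M) : A ⊆ acl L M A := fun x hx =>
  mem_acl_of_formula (κ := Fin 1)
    ((Term.var (Sum.inl 0)).equal (Term.var (Sum.inr 0)) : L.Formula (Fin 1 ⊕ Fin 1))
    (fun _ => x) (fun _ => hx) (by simp) (by simp)

theorem exists_finset_mem_acl {A : Set M} {x : M} (h : x ∈ acl L M A) :
    ∃ F : Finset M, ↑F ⊆ A ∧ x ∈ acl L M ↑F := by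
  classical
  obtain ⟨k, φ, c, hc, hx⟩ := h
  refine ⟨Finset.univ.image c, ?_, k, φ, c, fun j => ?_, hx⟩
  · simpa [Set.range_subset_iff] using hc
  · simp

theorem acl_acl_subset (A : Set M) : acl L M (acl L M A) ⊆ acl L M A := by
  intro x hx
  obtain ⟨k, φ, d, hφ, hd, hx⟩ := mem_acl_iff.1 hx
  choose m χ c hχ hc hd using fun j => mem_acl_iff.1 (hd j)
  have hFO : FO.{u, v, w} L (Fin 1 ⊕ Σ j, Fin (m j)) (fun M _ v => ∃ d : Fin k → M,
      (∀ j, (χ j).Realize (Sum.elim (fun _ => d j) (fun i => v (Sum.inr ⟨j, i⟩)))) ∧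
        φ.Realize (Sum.elim (fun _ => v (Sum.inl 0)) d)) := by
    refine FO.exTuple (α := Fin 1 ⊕ Σ j, Fin (m j)) (Q := fun M _ v d =>
      (∀ j, (χ j).Realize (Sum.elim (fun _ => d j) (fun i => v (Sum.inr ⟨j, i⟩)))) ∧
        φ.Realize (Sum.elim (fun _ => v (Sum.inl 0)) d)) (FO.and (FO.forallFinite fun j => ?_) ?_)
    · exact FO.realize _ _ (Sum.elim (fun _ => Sum.inr j) fun i => Sum.inl (Sum.inr ⟨j, i⟩))
        fun M _ v => by ext (_ | _) <;> rfl
    · exact FO.realize _ _ (Sum.elim (fun _ => Sum.inl (Sum.inl 0)) fun i => Sum.inr i)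
        fun M _ v => by ext (_ | _) <;> rfl
  obtain ⟨θ, hθ⟩ := hFO
  refine mem_acl_of_formula θ (fun p => c p.1 p.2) (fun p => hc _ _)
    ((hθ M _).2 ⟨d, hd, hx⟩) ?_
  simp only [hθ]
  refine Set.Finite.subset (Set.Finite.biUnion
    (Set.Finite.pi' fun j => (hχ j).finite (c j)) fun d' _ => hφ.finite d') ?_
  rintro y ⟨d', h1, h2⟩
  exact Set.mem_biUnion (x := d') h1 h2

theorem acl_subset_acl {A B : Set M} (h : A ⊆ acl L M B) : acl L M A ⊆ acl L M B :=
  (acl_mono h).trans (acl_acl_subset B)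

theorem infinite_of_notMem_acl {κ : Type*} [Finite κ] {x : M} {θ : L.Formula (Fin 1 ⊕ κ)}
    {c : κ → M} (hx : x ∉ acl L M (Set.range c)) (h : θ.Realize (Sum.elim (fun _ => x) c)) :
    {y : M | θ.Realize (Sum.elim (fun _ => y) c)}.Infinite :=
  fun hfin => hx (mem_acl_of_formula θ c (fun j => ⟨j, rfl⟩) h hfin)

end AclBasics

section HIndependence

variable {L : FirstOrder.Language.{u, v}} {M : Type w} [L.Structure M]

/-- Exchange for the algebraic closure in one structure. -/
def ExchangeIn (L : FirstOrder.Language.{u, v}) (M : Type w) [L.Structure M] : Prop :=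
  ∀ (A : Set M) (a b : M), a ∈ acl L M (A ∪ {b}) → a ∉ acl L M A → b ∈ acl L M (A ∪ {a})

/-- `U` is independent of `H` over `U ∩ H`: a basis `J` of `U` over `U ∩ H` stays independent
over `H`. -/
def HInd (L : FirstOrder.Language.{u, v}) {M : Type w} [L.Structure M] (H U : Set M) : Prop :=
  ∃ J ⊆ U, (∀ x ∈ J, x ∉ acl L M (J \ {x} ∪ H)) ∧ U ⊆ acl L M (J ∪ (U ∩ H))

variable {H U B : Set M}

theorem HInd.mem_acl (hex : ExchangeIn L M) (hU : HInd L H U) (hB : B ⊆ H) {x : M} (hx : x ∈ H)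
    (hxU : x ∈ acl L M (U ∪ B)) : x ∈ acl L M (U ∩ H ∪ B) := by
  classical
  obtain ⟨J, hJU, hJ, hUJ⟩ := hU
  have h1 : x ∈ acl L M (J ∪ (U ∩ H ∪ B)) := by
    refine acl_subset_acl (Set.union_subset ?_ ?_) hxU
    · exact hUJ.trans (acl_mono fun y hy => hy.elim Or.inl fun h => Or.inr (Or.inl h))
    · exact (subset_acl _).trans' fun y hy => Or.inr (Or.inr hy)
  have hC : U ∩ H ∪ B ⊆ H := Set.union_subset Set.inter_subset_right hB
  generalize U ∩ H ∪ B = C at h1 hC ⊢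
  obtain ⟨F, hF, hxF⟩ := exists_finset_mem_acl h1
  have h2 : x ∈ acl L M (↑(F.filter (· ∈ J)) ∪ C) := by
    refine acl_mono (fun y hy => ?_) hxF
    rcases hF hy with h | h
    · exact Or.inl (by simpa using ⟨hy, h⟩)
    · exact Or.inr h
  have h3 : ∀ y ∈ F.filter (· ∈ J), y ∈ J := fun y hy => (Finset.mem_filter.1 hy).2
  generalize F.filter (· ∈ J) = G at h2 h3
  induction G using Finset.induction_on with
  | empty => simpa using h2
  | insert y G hy ih =>
    by_contra hne
    have hn : x ∉ acl L M (↑G ∪ C) := fun h =>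
      hne (ih h fun z hz => h3 z (Finset.mem_insert_of_mem hz))
    have h4 : x ∈ acl L M (↑G ∪ C ∪ {y}) := by
      convert h2 using 2
      ext z; simp; tauto
    refine hJ y (h3 y (by simp)) (acl_mono ?_ (hex _ _ _ h4 hn))
    rintro z ((hz | hz) | hz)
    · exact Or.inl ⟨h3 z (Finset.mem_insert_of_mem hz), fun h => hy (by cases h; exact hz)⟩
    · exact Or.inr (hC hz)
    · cases hz; exact Or.inr hx

theorem HInd.union (hU : HInd L H U) (hB : B ⊆ H) : HInd L H (U ∪ B) := by
  obtain ⟨J, hJU, hJ, hUJ⟩ := hU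
  refine ⟨J, hJU.trans Set.subset_union_left, hJ, Set.union_subset ?_ ?_⟩
  · exact hUJ.trans (acl_mono fun y hy => hy.imp id fun h => ⟨Or.inl h.1, h.2⟩)
  · exact fun y hy => subset_acl _ (Or.inr ⟨Or.inr hy, hB hy⟩)

theorem HInd.insert_of_mem_acl (hU : HInd L H U) {x : M} (hx : x ∈ acl L M U) :
    HInd L H (insert x U) := by
  obtain ⟨J, hJU, hJ, hUJ⟩ := hU
  have h : acl L M U ⊆ acl L M (J ∪ (insert x U ∩ H)) :=
    acl_subset_acl (hUJ.trans (acl_mono fun y hy => hy.imp id fun h => ⟨Or.inr h.1, h.2⟩))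
  exact ⟨J, hJU.trans (Set.subset_insert _ _), hJ,
    Set.insert_subset (h hx) ((subset_acl _).trans h)⟩

theorem HInd.insert_of_notMem_acl (hex : ExchangeIn L M) (hU : HInd L H U) {x : M}
    (hx : x ∉ acl L M (U ∪ H)) : HInd L H (insert x U) := by
  obtain ⟨J, hJU, hJ, hUJ⟩ := hU
  have hxJ : x ∉ acl L M (J ∪ H) := fun h =>
    hx (acl_mono (Set.union_subset_union_left _ hJU) h)
  refine ⟨insert x J, Set.insert_subset_insert hJU, ?_, Set.insert_subset ?_ ?_⟩
  · rintro y (rfl | hy) h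
    · exact hxJ (acl_mono (Set.union_subset_union_left _ (by simp)) h)
    · have h' : y ∈ acl L M (J \ {y} ∪ H ∪ {x}) := by
        refine acl_mono ?_ h
        rintro z (⟨rfl | hz, hzy⟩ | hz)
        · exact Or.inr rfl
        · exact Or.inl (Or.inl ⟨hz, hzy⟩)
        · exact Or.inl (Or.inr hz)
      refine hxJ (acl_mono ?_ (hex _ _ _ h' (hJ y hy)))
      rintro z ((hz | hz) | rfl)
      · exact Or.inl hz.1
      · exact Or.inr hz
      · exact Or.inl hy
  · exact subset_acl _ (Or.inl (Or.inl rfl))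
  · exact hUJ.trans (acl_mono fun y hy => hy.imp Or.inr fun h => ⟨Or.inr h.1, h.2⟩)

theorem exists_hInd (hex : ExchangeIn L M) (H : Set M) (U : Finset M) :
    ∃ F : Finset M, ↑F ⊆ H ∧ HInd L H (↑U ∪ ↑F) := by
  classical
  induction U using Finset.induction_on with
  | empty => exact ⟨∅, by simp, ∅, by simp, by simp, by simp⟩
  | insert x U _ ih =>
    obtain ⟨F, hF, hUF⟩ := ih
    by_cases hx : x ∈ acl L M (↑U ∪ ↑F ∪ H)
    · obtain ⟨G, hG, hxG⟩ := exists_finset_mem_acl hx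
      refine ⟨F ∪ G.filter (· ∈ H), ?_, ?_⟩
      · intro y hy
        rcases Finset.mem_union.1 (Finset.mem_coe.1 hy) with h | h
        · exact hF h
        · exact (Finset.mem_filter.1 h).2
      · have h1 := hUF.union (B := ↑(G.filter (· ∈ H)))
          fun y hy => (Finset.mem_filter.1 (Finset.mem_coe.1 hy)).2
        have h2 := h1.insert_of_mem_acl (x := x) (acl_mono (fun y hy => ?_) hxG)
        · convert h2 using 1
          ext y; simp; tauto
        · rcases hG hy with h | h
          · exact Or.inl h
          · exact Or.inr (by simpa using ⟨hy, h⟩)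
    · refine ⟨F, hF, ?_⟩
      have h2 := hUF.insert_of_notMem_acl hex hx
      rwa [Finset.coe_insert, Set.insert_union]

end HIndependence

section Reduct

variable {L : FirstOrder.Language.{u, v}} {α : Type*}

attribute [local instance] lred

theorem FO.lift {P : ∀ (M : Type w) [L.Structure M], (α → M) → Prop} (h : FO.{u, v, w} L α P) :
    FO.{u, v, w} (LH L) α (fun M _ v => P M v) := by
  obtain ⟨θ, hθ⟩ := h
  refine ⟨(LHom.sumInl : L →ᴸ LH L).onFormula θ, fun M S v => ?_⟩
  have : (LHom.sumInl : L →ᴸ LH L).IsExpansionOn M := LHom.isExpansionOn_reduct _ _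
  exact (LHom.realize_onFormula _ θ).trans (hθ M v)

theorem FO.memHSet (i : α) :
    FO.{u, v, w} (LH L) α (fun M _ v => v i ∈ HSet L M) := by
  refine ⟨(hSym L).formula₁ (Term.var i), fun M _ v => ?_⟩
  rw [Formula.realize_rel₁]
  rfl

theorem FO.transfer {L : FirstOrder.Language.{u, v}} {P : ∀ (M : Type w) [L.Structure M], Prop}
    (h : FO.{u, v, w} L Empty (fun M _ _ => P M)) {M N : Type w} [L.Structure M] [L.Structure N]
    (hN : N ⊨ L.completeTheory M) (hM : P M) : P N := by
  obtain ⟨θ, hθ⟩ := h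
  have h1 : M ⊨ (θ : L.Sentence) := (hθ M _).2 hM
  exact (hθ N _).1 (hN.realize_of_mem θ h1)

/-- Algebraic formulas `χ(x; y)` in `N` which keep `H` closed. -/
def HClosed {κ : Type*} (N : Type w) [(LH L).Structure N] (χ : L.Formula (Fin 1 ⊕ κ)) : Prop :=
  ∀ (c : κ → N) (x : N), (∀ j, c j ∈ HSet L N) → χ.Realize (Sum.elim (fun _ => x) c) →
    x ∈ HSet L N

/-- The first-order properties of a model of the theory of lovely pairs or `H`-structures which are
needed to extract ATP of the reduct. -/
structure Nice (T : L.Theory) (N : Type max u v) [(LH L).Structure N] : Prop where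
  model : N ⊨ T
  dense : ∀ (κ : Type) [Finite κ] (θ : L.Formula (Fin 1 ⊕ κ)) (c : κ → N),
    {x : N | θ.Realize (Sum.elim (fun _ => x) c)}.Infinite →
      ∃ x ∈ HSet L N, θ.Realize (Sum.elim (fun _ => x) c)
  codense : ∀ (κ : Type) [Finite κ] (θ : L.Formula (Fin 1 ⊕ κ)) (c : κ → N),
    {x : N | θ.Realize (Sum.elim (fun _ => x) c)}.Infinite →
      ∀ (ρ : Type max u v) [Finite ρ] (l : ρ → ℕ) (χ : ∀ j, L.Formula (Fin 1 ⊕ (κ ⊕ Fin (l j)))),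
        (∀ j, UBdd.{u, v, max u v} (χ j)) →
        ∃ x, θ.Realize (Sum.elim (fun _ => x) c) ∧ ∀ j (h : Fin (l j) → N),
          (∀ i, h i ∈ HSet L N) → ¬ (χ j).Realize (Sum.elim (fun _ => x) (Sum.elim c h))
  exists_hClosed : ∀ (C : Set N) (x : N), C ⊆ HSet L N → x ∈ HSet L N → x ∈ acl L N C →
    ∃ (k : ℕ) (χ : L.Formula (Fin 1 ⊕ Fin k)) (c : Fin k → N), (∀ j, c j ∈ C) ∧
      χ.Realize (Sum.elim (fun _ => x) c) ∧ HClosed N χ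

theorem exists_mem_of_isDenseCodense {M : Type w} [(LH L).Structure M]
    (h : IsDenseCodense L M) {κ : Type*} [Finite κ] (θ : L.Formula (Fin 1 ⊕ κ)) (c : κ → M)
    (hinf : {x : M | θ.Realize (Sum.elim (fun _ => x) c)}.Infinite) :
    (∃ x ∈ HSet L M, θ.Realize (Sum.elim (fun _ => x) c)) ∧
      ∃ y, y ∉ acl L M (Set.range c ∪ HSet L M) ∧ θ.Realize (Sum.elim (fun _ => y) c) := by
  classical
  set D := {x : M | θ.Realize (Sum.elim (fun _ => x) c)} with hD
  have hne : (Filter.cofinite ⊓ Filter.principal D).NeBot :=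
    Filter.cofinite_inf_principal_neBot_iff.2 hinf
  let U : Ultrafilter M := Ultrafilter.of (Filter.cofinite ⊓ Filter.principal D)
  have hU : (U : Filter M) ≤ Filter.cofinite ⊓ Filter.principal D := Ultrafilter.of_le _
  let q : Set (ParamFormula L M) :=
    {pf | (∀ j, pf.params j ∈ Set.range c) ∧ ∀ᶠ x in (U : Filter M), pf.RealizeIn (lred L M) x}
  obtain ⟨k, ⟨e⟩⟩ := Finite.exists_equiv_fin κ
  have he : ∀ y, (θ.relabel (Sum.map id e)).Realize (Sum.elim (fun _ => y) (c ∘ e.symm)) ↔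
      θ.Realize (Sum.elim (fun _ => y) c) := realize_relabel_equiv θ e c
  have hθ : (⟨k, θ.relabel (Sum.map id e), c ∘ e.symm⟩ : ParamFormula L M) ∈ q :=
    ⟨fun j => ⟨_, rfl⟩, (hU.trans inf_le_right) fun x hx => (he x).2 hx⟩
  have hq : IsCompleteTypeOver (lred L M) (Set.range c) q := by
    refine ⟨fun pf hpf => hpf.1, fun pf hpf => ?_, fun F hF => ?_⟩
    · rcases Ultrafilter.eventually_or.1 (Filter.Eventually.of_forall (f := (U : Filter M))
        fun x => em (pf.RealizeIn (lred L M) x)) with h | h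
      · exact Or.inl ⟨hpf, h⟩
      · exact Or.inr ⟨hpf, h⟩
    · exact ((Filter.eventually_all_finset F).2 fun pf hpf => (hF hpf).2).exists
  have hq' : IsNonAlgebraic (lred L M) q := fun pf hpf hfin => by
    obtain ⟨x, hx, hx'⟩ := (hpf.2.and ((hU.trans inf_le_left) hfin.compl_mem_cofinite)).exists
    exact hx' hx
  have hA : ∃ B : Finset M, Set.range c ⊆ acl L M (B : Set M) := ⟨(Set.finite_range c).toFinset, by
    rw [Set.Finite.coe_toFinset]; exact subset_acl (Set.range c)⟩
  obtain ⟨⟨x, hx, hx'⟩, y, hy, hy'⟩ := h (Set.range c) hA q hq hq'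
  exact ⟨⟨x, hx, (he x).1 (hx' _ hθ)⟩, y, hy, (he y).1 (hy' _ hθ)⟩

theorem IsGeometric.exchangeIn {T : L.Theory} (hT : IsGeometric T) (M : Type max u v)
    [L.Structure M] [Nonempty M] (hM : M ⊨ T) : ExchangeIn L M :=
  fun A a b => hT.2.2 (Theory.ModelType.of T M) A a b

theorem IsGeometric.exists_bound {T : L.Theory} (hT : IsGeometric T) {κ : Type*} [Finite κ]
    (θ : L.Formula (Fin 1 ⊕ κ)) : ∃ K : ℕ, ∀ (M : Type max u v) [L.Structure M] [Nonempty M],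
      M ⊨ T → ∀ c : κ → M, AtLeast K {x : M | θ.Realize (Sum.elim (fun _ => x) c)} →
        {x : M | θ.Realize (Sum.elim (fun _ => x) c)}.Infinite := by
  obtain ⟨k, ⟨e⟩⟩ := Finite.exists_equiv_fin κ
  obtain ⟨K, hK⟩ := hT.2.1 k (θ.relabel (Sum.map id e))
  refine ⟨K, fun M _ _ hM c h => ?_⟩
  have key := realize_relabel_equiv θ e c
  obtain ⟨s, hs, h⟩ := exists_finset_of_atLeast h
  exact (hK (Theory.ModelType.of T M) (c ∘ e.symm) ⟨s, hs, fun x hx => (key x).2 (h x hx)⟩).mono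
    fun y => (key y).1

theorem UBdd.mem_elementarySubstructure {L : FirstOrder.Language.{u, v}} {M : Type w}
    [L.Structure M] {κ : Type*} {χ : L.Formula (Fin 1 ⊕ κ)} (hχ : UBdd.{u, v, w} χ)
    (S : L.ElementarySubstructure M) (c : κ → M) (hc : ∀ j, c j ∈ (S : Set M)) {x : M}
    (hx : χ.Realize (Sum.elim (fun _ => x) c)) : x ∈ (S : Set M) := by
  classical
  by_contra hxS
  have hex := exists_not_atLeast_of_finite (hχ.finite c)
  have hK := Nat.find_spec hex
  obtain ⟨K, hKeq⟩ : ∃ K, Nat.find hex = K + 1 := by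
    refine Nat.exists_eq_succ_of_ne_zero fun h0 => hK ?_
    rw [h0]
    exact ⟨Fin.elim0, fun i => i.elim0, fun i => i.elim0⟩
  have hK' : AtLeast K {x : M | χ.Realize (Sum.elim (fun _ => x) c)} :=
    not_not.1 (Nat.find_min hex (by omega))
  rw [hKeq] at hK
  have hFO : FO.{u, v, w} L κ (fun M _ c =>
      AtLeast K {x : M | χ.Realize (Sum.elim (fun _ => x) c)}) :=
    FO.atLeast K (FO.realizeElim χ _ _)
  let c' : κ → S := fun j => ⟨c j, hc j⟩
  obtain ⟨z, hz, hzS⟩ := (hFO.elementary S.subtype c').1 hK'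
  refine hK ⟨Fin.cons x fun i => z i, ?_, ?_⟩
  · refine Fin.cons_injective_iff.2 ⟨?_, Subtype.val_injective.comp hz⟩
    rintro ⟨i, rfl⟩
    exact hxS (z i).2
  · intro i
    refine Fin.cases hx (fun i => ?_) i
    have := hzS i
    rw [Set.mem_ofPred_eq, ← S.subtype.map_formula] at this
    have he : S.subtype ∘ Sum.elim (fun _ : Fin 1 => z i) c' =
        Sum.elim (fun _ : Fin 1 => (z i : M)) c := by
      ext (_ | _) <;> rfl
    rwa [he] at this

theorem nice_of_models {T : L.Theory} (hT : IsGeometric T) {M₀ N : Type max u v}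
    [(LH L).Structure M₀] [Nonempty M₀] (h : IsLovelyPair L M₀ T ∨ IsHStructureExp L M₀ T)
    [(LH L).Structure N] (hN : N ⊨ (LH L).completeTheory M₀) : Nice T N := by
  have hM₀ : M₀ ⊨ T := h.elim (fun h => h.1) fun h => h.1
  have hd : IsDenseCodense L M₀ := h.elim (fun h => h.2.1) fun h => h.2.1
  have hmodel : N ⊨ T := by
    refine ⟨fun θ hθ => ?_⟩
    have h1 : FO.{u, v, max u v} L Empty (fun M _ _ => M ⊨ θ) :=
      ⟨θ, fun M _ v => by rw [Subsingleton.elim v default]; rfl⟩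
    exact FO.transfer h1.lift hN (hM₀.realize_of_mem θ hθ)
  have : Nonempty N := (FO.transfer (P := fun M _ => ∃ _ : M, True)
    (FO.ex (Q := fun _ _ _ _ => True) (FO.const True)) hN ⟨Classical.arbitrary M₀, trivial⟩).nonempty
  refine ⟨hmodel, fun κ _ θ c hinf => ?_, fun κ _ θ c hinf ρ _ l χ hχ => ?_, ?_⟩
  · obtain ⟨K, hK⟩ := hT.exists_bound θ
    have h1 : FO.{u, v, max u v} (LH L) Empty (fun M _ _ => ∀ c : κ → M,
        AtLeast K {x : M | θ.Realize (Sum.elim (fun _ => x) c)} →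
          ∃ x, x ∈ HSet L M ∧ θ.Realize (Sum.elim (fun _ => x) c)) := by
      refine FO.allTuple (FO.imp (FO.atLeast K ?_) (FO.ex (FO.and (FO.memHSet _) ?_)))
      · exact (FO.realizeElim θ _ _).lift
      · exact (FO.realizeElim θ _ _).lift
    refine FO.transfer h1 hN (fun c hc => ?_) c (atLeast_of_infinite hinf K)
    exact (exists_mem_of_isDenseCodense hd θ c (hK M₀ hM₀ c hc)).1
  · obtain ⟨K, hK⟩ := hT.exists_bound θ
    have h1 : FO.{u, v, max u v} (LH L) Empty (fun M _ _ => ∀ c : κ → M,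
        AtLeast K {x : M | θ.Realize (Sum.elim (fun _ => x) c)} →
          ∃ x, θ.Realize (Sum.elim (fun _ => x) c) ∧ ∀ j (h : Fin (l j) → M),
          (∀ i, h i ∈ HSet L M) → ¬ (χ j).Realize (Sum.elim (fun _ => x) (Sum.elim c h))) := by
      refine FO.allTuple (FO.imp (FO.atLeast K ?_) (FO.ex (FO.and ?_ (FO.forallFinite fun j =>
        FO.allTuple (FO.imp (FO.forallFinite fun i => FO.memHSet _) (FO.not ?_))))))
      · exact (FO.realizeElim θ _ _).lift
      · exact (FO.realizeElim θ _ _).lift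
      · exact (FO.realizeElim₃ (χ j) _ _ _).lift
    refine FO.transfer h1 hN (fun c hc => ?_) c (atLeast_of_infinite hinf K)
    obtain ⟨y, hy, hyθ⟩ := (exists_mem_of_isDenseCodense hd θ c (hK M₀ hM₀ c hc)).2
    refine ⟨y, hyθ, fun j h hh hχy => hy (mem_acl_of_uBdd (hχ j) (Sum.elim c h) ?_ hχy)⟩
    rintro (i | i)
    · exact Or.inl ⟨i, rfl⟩
    · exact Or.inr (hh i)
  · intro C x hC hx hxC
    obtain ⟨k, χ, c, hχ, hc, hxχ⟩ := mem_acl_iff.1 hxC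
    rcases h with ⟨-, -, S, hS⟩ | ⟨-, -, hind⟩
    · refine ⟨k, χ, c, hc, hxχ, ?_⟩
      have h1 : FO.{u, v, max u v} (LH L) Empty (fun M _ _ => HClosed M χ) := by
        refine FO.allTuple (FO.all (FO.imp (FO.forallFinite fun i => FO.memHSet _)
          (FO.imp ?_ (FO.memHSet _))))
        exact (FO.realizeElim χ _ _).lift
      refine FO.transfer h1 hN fun c x hc hx => ?_
      rw [← hS] at hc ⊢
      exact hχ.mem_elementarySubstructure S c hc hx
    · have h1 : FO.{u, v, max u v} (LH L) Empty (fun M _ _ => ∀ (c : Fin k → M) (x : M),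
          (∀ j, c j ∈ HSet L M) → x ∈ HSet L M → χ.Realize (Sum.elim (fun _ => x) c) →
          ∃ j, x = c j) := by
        refine FO.allTuple (FO.all (FO.imp (FO.forallFinite fun i => FO.memHSet _)
          (FO.imp (FO.memHSet _) (FO.imp ?_ (FO.existsFinite fun j => FO.eq _ _)))))
        exact (FO.realizeElim χ _ _).lift
      have h2 := FO.transfer h1 hN fun c x hc hx hxc => ?_
      · obtain ⟨j, rfl⟩ := h2 c x (fun j => hC (hc j)) hx hxχ
        refine ⟨1, (Term.var (Sum.inl 0)).equal (Term.var (Sum.inr 0)), fun _ => c j,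
          fun _ => hc j, by simp, fun c' x' hc' hx' => ?_⟩
        simp only [Formula.realize_equal, Term.realize_var, Sum.elim_inl, Sum.elim_inr] at hx'
        exact hx' ▸ hc' 0
      · by_contra hne
        refine hind x hx (mem_acl_of_uBdd hχ c (fun j => ⟨hc j, fun h => hne ⟨j, ?_⟩⟩) hxc)
        exact (Set.mem_singleton_iff.1 h).symm

end Reduct

section ElementaryExtension

variable {L : FirstOrder.Language.{u, v}}

theorem exists_elementary_extension_FO {N : Type w} [L.Structure N] [Nonempty N] {κ σ : Type*}
    {J : Type w} (P : J → ∀ (M : Type w) [L.Structure M], (κ → M) → (σ → M) → Prop)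
    (hP : ∀ j, FO.{u, v, w} L (κ ⊕ σ)
      (fun M _ v => P j M (fun i => v (Sum.inl i)) (fun i => v (Sum.inr i))))
    (c : κ → N) (h : ∀ F : Finset J, ∃ s : σ → N, ∀ j ∈ F, P j N c s) :
    ∃ (N' : Type w) (_ : L.Structure N') (_ : Nonempty N') (f : N ↪ₑ[L] N') (s : σ → N'),
      ∀ j, P j N' (f ∘ c) s := by
  choose θ hθ using hP
  obtain ⟨N', i1, i2, f, s, hs⟩ := exists_elementary_extension_realize
    (fun j => (θ j).relabel (Sum.map c (id : σ → σ))) (fun F => by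
      obtain ⟨s, hs⟩ := h F
      refine ⟨s, fun j hj => ?_⟩
      rw [Formula.realize_relabel, hθ]
      exact hs j hj)
  refine ⟨N', i1, i2, f, s, fun j => ?_⟩
  have := hs j
  rw [Formula.realize_relabel, hθ] at this
  exact this

attribute [local instance] lred

variable {N N' : Type w} [(LH L).Structure N] [(LH L).Structure N']

theorem realize_reduct_elementary (f : N ↪ₑ[LH L] N') {α : Type*} (θ : L.Formula α) (c : α → N) :
    θ.Realize (f ∘ c) ↔ θ.Realize c :=
  (FO.realize θ (fun _ _ v => v) id (fun _ _ _ => rfl)).lift.elementary f c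

theorem realize_reduct_elementary₂ (f : N ↪ₑ[LH L] N') {α β : Type*} (θ : L.Formula (α ⊕ β))
    (c : α → N) (d : β → N) :
    θ.Realize (Sum.elim (f ∘ c) (f ∘ d)) ↔ θ.Realize (Sum.elim c d) := by
  rw [← Sum.comp_elim, realize_reduct_elementary]

theorem mem_hSet_elementary (f : N ↪ₑ[LH L] N') (x : N) : f x ∈ HSet L N' ↔ x ∈ HSet L N :=
  (FO.memHSet (0 : Fin 1)).elementary f fun _ => x

theorem acl_reduct_elementary (f : N ↪ₑ[LH L] N') {A : Set N} {x : N} (h : x ∈ acl L N A) :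
    f x ∈ acl L N' (f '' A) := by
  obtain ⟨k, θ, c, hθ, hc, hx⟩ := mem_acl_iff.1 h
  exact mem_acl_of_uBdd hθ (f ∘ c) (fun j => ⟨_, hc j, rfl⟩)
    ((realize_reduct_elementary₂ f θ (fun _ => x) c).2 hx)

/-- Non-membership in `acl(A ∪ H)` is preserved by elementary extensions of pairs. -/
theorem acl_union_hSet_elementary (f : N ↪ₑ[LH L] N') {A : Set N} {x : N}
    (h : f x ∈ acl L N' (f '' A ∪ HSet L N')) : x ∈ acl L N (A ∪ HSet L N) := by
  classical
  obtain ⟨k, θ, c, hθ, hc, hx⟩ := mem_acl_iff.1 h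
  choose d hd using fun j : {j // c j ∈ f '' A} => j.2
  have hFO : FO.{u, v, w} (LH L) (Fin 1 ⊕ {j // c j ∈ f '' A}) (fun M _ v =>
      ∃ c' : Fin k → M, ((∀ j : {j // c j ∈ f '' A}, c' j = v (Sum.inr j)) ∧
        ∀ j : {j // c j ∉ f '' A}, c' j ∈ HSet L M) ∧
        θ.Realize (Sum.elim (fun _ => v (Sum.inl 0)) c')) := by
    refine FO.exTuple (FO.and (FO.and (FO.forallFinite fun j => FO.eq _ _)
      (FO.forallFinite fun j => FO.memHSet _)) ?_)
    exact (FO.realizeElim θ _ _).lift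
  obtain ⟨c', ⟨h1, h2⟩, h3⟩ := (hFO.elementary f (Sum.elim (fun _ => x) d)).1
    ⟨c, ⟨fun j => (hd j).2.symm, fun j => ((hc j).resolve_left j.2)⟩, hx⟩
  refine mem_acl_of_uBdd hθ c' (fun j => ?_) h3
  by_cases hj : c j ∈ f '' A
  · refine Or.inl ?_
    rw [h1 ⟨j, hj⟩]
    exact (hd ⟨j, hj⟩).1
  · exact Or.inr (h2 ⟨j, hj⟩)

theorem HInd.elementary (f : N ↪ₑ[LH L] N') {U : Set N} (hU : HInd L (HSet L N) U) :
    HInd L (HSet L N') (f '' U) := by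
  obtain ⟨J, hJU, hJ, hUJ⟩ := hU
  refine ⟨f '' J, Set.image_mono hJU, ?_, ?_⟩
  · rintro _ ⟨x, hx, rfl⟩ h
    refine hJ x hx (acl_union_hSet_elementary f (acl_mono ?_ h))
    refine Set.union_subset_union_left _ ?_
    rintro _ ⟨⟨y, hy, rfl⟩, hne⟩
    exact ⟨y, ⟨hy, fun h => hne (congrArg f h)⟩, rfl⟩
  · rintro _ ⟨x, hx, rfl⟩
    refine acl_mono ?_ (acl_reduct_elementary f (hUJ hx))
    rintro _ ⟨y, hy | hy, rfl⟩
    · exact Or.inl ⟨y, hy, rfl⟩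
    · exact Or.inr ⟨⟨y, hy.1, rfl⟩, (mem_hSet_elementary f y).2 hy.2⟩

end ElementaryExtension

section Similarity

variable {L : FirstOrder.Language.{u, v}}

attribute [local instance] lred

/-- Two `H`-independent tuples with the same `L`-type and with the same coordinates in `H`. -/
structure Sim {N : Type w} [(LH L).Structure N] {ι : Type*} (u₁ u₂ : ι → N) : Prop where
  left : HInd L (HSet L N) (Set.range u₁)
  right : HInd L (HSet L N) (Set.range u₂)
  type : ∀ θ : L.Formula ι, θ.Realize u₁ ↔ θ.Realize u₂
  mark : ∀ i, u₁ i ∈ HSet L N ↔ u₂ i ∈ HSet L N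

variable {N : Type w} [(LH L).Structure N] {ι : Type*} {u₁ u₂ : ι → N}

theorem Sim.symm (h : Sim (L := L) u₁ u₂) : Sim (L := L) u₂ u₁ :=
  ⟨h.right, h.left, fun θ => (h.type θ).symm, fun i => (h.mark i).symm⟩

theorem Sim.elementary (h : Sim (L := L) u₁ u₂) {N' : Type w} [(LH L).Structure N']
    (f : N ↪ₑ[LH L] N') : Sim (L := L) (f ∘ u₁) (f ∘ u₂) :=
  ⟨by rw [Set.range_comp]; exact h.left.elementary f,
    by rw [Set.range_comp]; exact h.right.elementary f,
    fun θ => by rw [realize_reduct_elementary, realize_reduct_elementary, h.type],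
    fun i => by
      simp only [Function.comp_apply, mem_hSet_elementary, h.mark]⟩

theorem Sim.type_FO (h : Sim (L := L) u₁ u₂) {P : ∀ (M : Type w) [L.Structure M], (ι → M) → Prop}
    (hP : FO.{u, v, w} L ι P) : P N u₁ ↔ P N u₂ := by
  obtain ⟨θ, hθ⟩ := hP
  rw [← hθ, ← hθ, h.type]

end Similarity

section Extension

variable {L : FirstOrder.Language.{u, v}}

attribute [local instance] lred

theorem range_elim_const {N ι : Type*} (x : N) (u : ι → N) :
    Set.range (Sum.elim (fun _ : Fin 1 => x) u) = insert x (Set.range u) := by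
  rw [Set.Sum.elim_range, Set.range_const, Set.singleton_union]

section SameType

variable {N : Type w} [L.Structure N] {ι : Type*} {u₁ u₂ : ι → N} {w₁ w₂ : N}

theorem realize_of_sameType (ht : ∀ θ : L.Formula (Fin 1 ⊕ ι),
      θ.Realize (Sum.elim (fun _ => w₁) u₁) ↔ θ.Realize (Sum.elim (fun _ => w₂) u₂))
    {κ : Type*} {θ : L.Formula (Fin 1 ⊕ κ)} {g : κ → ι}
    (h : θ.Realize (Sum.elim (fun _ => w₁) (u₁ ∘ g))) :
    θ.Realize (Sum.elim (fun _ => w₂) (u₂ ∘ g)) := by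
  have := (ht (θ.relabel (Sum.map id g))).1
  simpa only [Formula.realize_relabel, Sum.elim_comp_map, Function.comp_id] using
    this (by simpa only [Formula.realize_relabel, Sum.elim_comp_map, Function.comp_id] using h)

theorem mem_acl_of_sameType (ht : ∀ θ : L.Formula (Fin 1 ⊕ ι),
      θ.Realize (Sum.elim (fun _ => w₁) u₁) ↔ θ.Realize (Sum.elim (fun _ => w₂) u₂))
    (h : w₁ ∈ acl L N (Set.range u₁)) : w₂ ∈ acl L N (Set.range u₂) := by
  obtain ⟨k, θ, c, hθ, hc, hx⟩ := mem_acl_iff.1 h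
  choose g hg using hc
  obtain rfl : u₁ ∘ g = c := funext hg
  exact mem_acl_of_uBdd hθ (u₂ ∘ g) (fun j => ⟨_, rfl⟩) (realize_of_sameType ht hx)

end SameType

variable {T : L.Theory} {N : Type max u v} [(LH L).Structure N] {ι : Type*}
  {u₁ u₂ : ι → N} {w₁ w₂ : N}

theorem Sim.mem_hSet_of_mem_acl (hN : Nice T N) (hex : ExchangeIn L N) (h : Sim (L := L) u₁ u₂)
    (ht : ∀ θ : L.Formula (Fin 1 ⊕ ι),
      θ.Realize (Sum.elim (fun _ => w₁) u₁) ↔ θ.Realize (Sum.elim (fun _ => w₂) u₂))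
    (hw : w₁ ∈ acl L N (Set.range u₁)) (hH : w₁ ∈ HSet L N) : w₂ ∈ HSet L N := by
  have h1 := h.left.mem_acl hex (Set.empty_subset _) hH (by rwa [Set.union_empty])
  rw [Set.union_empty] at h1
  obtain ⟨k, χ, c, hc, hx, hχ⟩ := hN.exists_hClosed _ _ Set.inter_subset_right hH h1
  choose g hg using fun j => (hc j).1
  obtain rfl : u₁ ∘ g = c := funext hg
  exact hχ (u₂ ∘ g) w₂ (fun j => (h.mark _).1 (hc j).2) (realize_of_sameType ht hx)

theorem Sim.insert_of_mem_acl (hN : Nice T N) (hex : ExchangeIn L N) (h : Sim (L := L) u₁ u₂)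
    (ht : ∀ θ : L.Formula (Fin 1 ⊕ ι),
      θ.Realize (Sum.elim (fun _ => w₁) u₁) ↔ θ.Realize (Sum.elim (fun _ => w₂) u₂))
    (hw : w₁ ∈ acl L N (Set.range u₁)) :
    Sim (L := L) (Sum.elim (fun _ : Fin 1 => w₁) u₁) (Sum.elim (fun _ : Fin 1 => w₂) u₂) := by
  have hw' := mem_acl_of_sameType ht hw
  refine ⟨?_, ?_, ht, ?_⟩
  · rw [range_elim_const]; exact h.left.insert_of_mem_acl hw
  · rw [range_elim_const]; exact h.right.insert_of_mem_acl hw'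
  · rintro (_ | i)
    · exact ⟨h.mem_hSet_of_mem_acl hN hex ht hw,
        h.symm.mem_hSet_of_mem_acl hN hex (fun θ => (ht θ).symm) hw'⟩
    · exact h.mark i

theorem Sim.insert_of_mem_hSet (h : Sim (L := L) u₁ u₂)
    (ht : ∀ θ : L.Formula (Fin 1 ⊕ ι),
      θ.Realize (Sum.elim (fun _ => w₁) u₁) ↔ θ.Realize (Sum.elim (fun _ => w₂) u₂))
    (hw : w₁ ∈ HSet L N) (hw' : w₂ ∈ HSet L N) :
    Sim (L := L) (Sum.elim (fun _ : Fin 1 => w₁) u₁) (Sum.elim (fun _ : Fin 1 => w₂) u₂) := by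
  refine ⟨?_, ?_, ht, ?_⟩
  · rw [range_elim_const, ← Set.union_singleton]
    exact h.left.union (Set.singleton_subset_iff.2 hw)
  · rw [range_elim_const, ← Set.union_singleton]
    exact h.right.union (Set.singleton_subset_iff.2 hw')
  · rintro (_ | i)
    · exact ⟨fun _ => hw', fun _ => hw⟩
    · exact h.mark i

theorem Sim.insert_of_notMem_acl (hex : ExchangeIn L N) (h : Sim (L := L) u₁ u₂)
    (ht : ∀ θ : L.Formula (Fin 1 ⊕ ι),
      θ.Realize (Sum.elim (fun _ => w₁) u₁) ↔ θ.Realize (Sum.elim (fun _ => w₂) u₂))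
    (hw : w₁ ∉ acl L N (Set.range u₁ ∪ HSet L N)) (hw' : w₂ ∉ acl L N (Set.range u₂ ∪ HSet L N)) :
    Sim (L := L) (Sum.elim (fun _ : Fin 1 => w₁) u₁) (Sum.elim (fun _ : Fin 1 => w₂) u₂) := by
  refine ⟨?_, ?_, ht, ?_⟩
  · rw [range_elim_const]; exact h.left.insert_of_notMem_acl hex hw
  · rw [range_elim_const]; exact h.right.insert_of_notMem_acl hex hw'
  · rintro (_ | i)
    · exact iff_of_false (fun h => hw (subset_acl _ (Or.inr h)))
        fun h => hw' (subset_acl _ (Or.inr h))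
    · exact h.mark i

theorem infinite_iff_atLeast {M : Type*} {S : Set M} : S.Infinite ↔ ∀ K, AtLeast K S :=
  ⟨atLeast_of_infinite, fun h hfin =>
    let ⟨K, hK⟩ := exists_not_atLeast_of_finite hfin
    hK (h K)⟩

theorem Sim.infinite_iff (h : Sim (L := L) u₁ u₂) (θ : L.Formula (Fin 1 ⊕ ι)) :
    {x : N | θ.Realize (Sum.elim (fun _ => x) u₁)}.Infinite ↔
      {x : N | θ.Realize (Sum.elim (fun _ => x) u₂)}.Infinite := by
  rw [infinite_iff_atLeast, infinite_iff_atLeast]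
  have hFO : ∀ K, FO.{u, v, max u v} L ι (fun M _ u =>
      AtLeast K {x : M | θ.Realize (Sum.elim (fun _ => x) u)}) :=
    fun K => FO.atLeast K (FO.realizeElim θ _ _)
  exact forall_congr' fun K => h.type_FO (hFO K)

end Extension

section BackAndForth

variable {L : FirstOrder.Language.{u, v}}

attribute [local instance] lred

/-- Every elementary extension of `N` satisfies `Nice`. -/
def AlwaysNice (T : L.Theory) (N : Type max u v) [(LH L).Structure N] : Prop :=
  ∀ (N' : Type max u v) [(LH L).Structure N'], Nonempty (N ↪ₑ[LH L] N') → Nice T N'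

variable {T : L.Theory} {N : Type max u v} [(LH L).Structure N]

theorem AlwaysNice.nice (hN : AlwaysNice T N) : Nice T N :=
  hN N ⟨ElementaryEmbedding.refl _ N⟩

theorem AlwaysNice.elementary (hN : AlwaysNice T N) {N' : Type max u v} [(LH L).Structure N']
    (f : N ↪ₑ[LH L] N') : AlwaysNice T N' :=
  fun N'' _ ⟨g⟩ => hN N'' ⟨g.comp f⟩

theorem Nice.exchangeIn [Nonempty N] (hT : IsGeometric T) (hN : Nice T N) : ExchangeIn L N :=
  hT.exchangeIn N hN.model

theorem sameType_of_imp {N : Type w} [L.Structure N] {α : Type*} {u₁ u₂ : α → N}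
    (h : ∀ θ : L.Formula α, θ.Realize u₁ → θ.Realize u₂) (θ : L.Formula α) :
    θ.Realize u₁ ↔ θ.Realize u₂ :=
  ⟨h θ, fun h2 => by_contra fun h1 => h θ.not h1 h2⟩

theorem exists_conj {J α : Type*} (θ : J → L.Formula α) (F : Finset J) : ∃ θ' : L.Formula α,
    ∀ (M : Type w) [L.Structure M] (v : α → M), θ'.Realize v ↔ ∀ j ∈ F, (θ j).Realize v :=
  ⟨Formula.iInf fun j : F => θ j, fun M _ v => by
    rw [Formula.realize_iInf]; exact Subtype.forall⟩

theorem exists_uBdd_of_mem_acl_union {M : Type w} [L.Structure M] {κ : Type*} [Finite κ]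
    {c : κ → M} {H : Set M} {x : M} (h : x ∈ acl L M (Set.range c ∪ H)) :
    ∃ (l : ℕ) (χ : L.Formula (Fin 1 ⊕ (κ ⊕ Fin l))) (b : Fin l → M), UBdd.{u, v, w} χ ∧
      (∀ i, b i ∈ H) ∧ χ.Realize (Sum.elim (fun _ => x) (Sum.elim c b)) := by
  classical
  obtain ⟨k, θ, d, hθ, hd, hx⟩ := mem_acl_iff.1 h
  let A := {j // d j ∉ Set.range c}
  obtain ⟨l, ⟨e⟩⟩ := Finite.exists_equiv_fin A
  have hdc : ∀ j, ∃ i : κ ⊕ Fin l, d j = Sum.elim c (fun i => d (e.symm i).1) i := fun j => by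
    by_cases hj : d j ∈ Set.range c
    · obtain ⟨i, hi⟩ := hj
      exact ⟨Sum.inl i, hi.symm⟩
    · exact ⟨Sum.inr (e ⟨j, hj⟩), by rw [Sum.elim_inr, Equiv.symm_apply_apply]⟩
  choose g hg using hdc
  refine ⟨l, θ.relabel (Sum.map id g), fun i => d (e.symm i).1, ?_,
    fun i => (hd _).resolve_left (e.symm i).2, ?_⟩
  · obtain ⟨K, hK⟩ := hθ
    refine ⟨K, fun M _ c => ?_⟩
    simp only [Formula.realize_relabel, Sum.elim_comp_map, Function.comp_id]
    exact hK M _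
  · rw [Formula.realize_relabel, Sum.elim_comp_map, Function.comp_id]
    rwa [show (Sum.elim c fun i => d (e.symm i).1) ∘ g = d from (funext hg).symm]

variable {ι : Type} [Finite ι] {u₁ u₂ : ι → N} {w₁ : N}

theorem Sim.exists_insert_aux [Nonempty N] (hT : IsGeometric T) (hN : AlwaysNice T N)
    (h : Sim (L := L) u₁ u₂) (hw : w₁ ∈ acl L N (Set.range u₁) ∨ w₁ ∈ HSet L N ∨
      w₁ ∉ acl L N (Set.range u₁ ∪ HSet L N)) :
    ∃ (N' : Type max u v) (_ : (LH L).Structure N') (f : N ↪ₑ[LH L] N') (w₂ : N'),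
      Sim (L := L) (Sum.elim (fun _ : Fin 1 => f w₁) (f ∘ u₁))
        (Sum.elim (fun _ : Fin 1 => w₂) (f ∘ u₂)) := by
  classical
  let J := {θ : L.Formula (Fin 1 ⊕ ι) // θ.Realize (Sum.elim (fun _ => w₁) u₁)}
  have hFO : ∀ j : J, FO.{u, v, max u v} (LH L) (ι ⊕ Fin 1) (fun M _ v =>
      j.1.Realize (Sum.elim (fun _ => v (Sum.inr 0)) (fun i => v (Sum.inl i)))) :=
    fun j => (FO.realizeElim j.1 _ _).lift
  have hconj : ∀ F : Finset J, ∃ θ : L.Formula (Fin 1 ⊕ ι),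
      θ.Realize (Sum.elim (fun _ => w₁) u₁) ∧ ∀ x : N, θ.Realize (Sum.elim (fun _ => x) u₂) →
        ∀ j ∈ F, j.1.Realize (Sum.elim (fun _ => x) u₂) := by
    intro F
    obtain ⟨θ, hθ⟩ := exists_conj (fun j : J => j.1) F
    exact ⟨θ, (hθ N _).2 fun j _ => j.2, fun x => (hθ N _).1⟩
  have htype : ∀ {N' : Type max u v} [(LH L).Structure N'] (f : N ↪ₑ[LH L] N') (w₂ : N'),
      (∀ j : J, j.1.Realize (Sum.elim (fun _ => w₂) (f ∘ u₂))) → ∀ θ : L.Formula (Fin 1 ⊕ ι),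
        θ.Realize (Sum.elim (fun _ => f w₁) (f ∘ u₁)) ↔
          θ.Realize (Sum.elim (fun _ => w₂) (f ∘ u₂)) := fun f w₂ hj =>
    sameType_of_imp fun θ hθ =>
      hj ⟨θ, (realize_reduct_elementary₂ f θ (fun _ => w₁) u₁).1 hθ⟩
  by_cases hw1 : w₁ ∈ acl L N (Set.range u₁)
  · let P : J → ∀ (M : Type max u v) [(LH L).Structure M], (ι → M) → (Fin 1 → M) → Prop :=
      fun j M _ v s => j.1.Realize (Sum.elim (fun _ => s 0) v)
    obtain ⟨N', i1, i2, f, s, hs⟩ := exists_elementary_extension_FO P hFO u₂ fun F => by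
      obtain ⟨θ, h1, h2⟩ := hconj F
      have hex : FO.{u, v, max u v} L ι (fun M _ v =>
          ∃ x, θ.Realize (Sum.elim (fun _ => x) v)) := FO.ex (FO.realizeElim θ _ _)
      obtain ⟨x, hx⟩ := (h.type_FO hex).1 ⟨w₁, h1⟩
      exact ⟨fun _ => x, h2 x hx⟩
    have hN' := hN N' ⟨f⟩
    refine ⟨N', i1, f, s 0, (h.elementary f).insert_of_mem_acl hN' (hN'.exchangeIn hT)
      (htype f _ hs) ?_⟩
    rw [Set.range_comp]
    exact acl_reduct_elementary f hw1
  have hinf : ∀ θ : L.Formula (Fin 1 ⊕ ι), θ.Realize (Sum.elim (fun _ => w₁) u₁) →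
      {x : N | θ.Realize (Sum.elim (fun _ => x) u₂)}.Infinite := fun θ hθ =>
    (h.infinite_iff θ).1 (infinite_of_notMem_acl hw1 hθ)
  by_cases hwH : w₁ ∈ HSet L N
  · let P : J → ∀ (M : Type max u v) [(LH L).Structure M], (ι → M) → (Fin 1 → M) → Prop :=
      fun j M _ v s => j.1.Realize (Sum.elim (fun _ => s 0) v) ∧ s 0 ∈ HSet L M
    obtain ⟨N', i1, i2, f, s, hs⟩ := exists_elementary_extension_FO P
      (fun j => FO.and (hFO j) (FO.memHSet _)) u₂ fun F => by
        obtain ⟨θ, h1, h2⟩ := hconj F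
        obtain ⟨x, hxH, hx⟩ := hN.nice.dense ι θ u₂ (hinf θ h1)
        exact ⟨fun _ => x, fun j hj => ⟨h2 x hx j hj, hxH⟩⟩
    exact ⟨N', i1, f, s 0, (h.elementary f).insert_of_mem_hSet (htype f _ fun j => (hs j).1)
      ((mem_hSet_elementary f _).2 hwH) (hs ⟨⊤, Formula.realize_top.2 trivial⟩).2⟩
  have hw3 : w₁ ∉ acl L N (Set.range u₁ ∪ HSet L N) := fun hmem =>
    hw.elim hw1 fun h => h.elim hwH fun h => h hmem
  let J' := {χ : Σ l : ℕ, L.Formula (Fin 1 ⊕ (ι ⊕ Fin l)) // UBdd.{u, v, max u v} χ.2}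
  let P : J × J' → ∀ (M : Type max u v) [(LH L).Structure M], (ι → M) → (Fin 1 → M) → Prop :=
    fun j M _ v s => j.1.1.Realize (Sum.elim (fun _ => s 0) v) ∧
      ∀ h : Fin j.2.1.1 → M, (∀ i, h i ∈ HSet L M) →
        ¬ j.2.1.2.Realize (Sum.elim (fun _ => s 0) (Sum.elim v h))
  have hP : ∀ j, FO.{u, v, max u v} (LH L) (ι ⊕ Fin 1) (fun M _ v =>
      P j M (fun i => v (Sum.inl i)) (fun i => v (Sum.inr i))) := fun j => by
    refine FO.and (hFO j.1)
      (FO.allTuple (FO.imp (FO.forallFinite fun i => FO.memHSet _) (FO.not ?_)))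
    exact (FO.realizeElim₃ j.2.1.2 _ _ _).lift
  obtain ⟨N', i1, i2, f, s, hs⟩ := exists_elementary_extension_FO P hP u₂ fun F => by
    obtain ⟨θ, h1, h2⟩ := hconj (F.image Prod.fst)
    obtain ⟨x, hx, hxχ⟩ := hN.nice.codense ι θ u₂ (hinf θ h1) F (fun j => j.1.2.1.1)
      (fun j => j.1.2.1.2) (fun j => j.1.2.2)
    exact ⟨fun _ => x, fun j hj => ⟨h2 x hx _ (Finset.mem_image_of_mem _ hj), hxχ ⟨j, hj⟩⟩⟩
  have hN' := hN N' ⟨f⟩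
  obtain ⟨χ₀, hχ₀, -⟩ := exists_uBdd.{u, v, max u v} (⊥ : L.Formula (Fin 1 ⊕ (ι ⊕ Fin 0))) 0
  refine ⟨N', i1, f, s 0, (h.elementary f).insert_of_notMem_acl (hN'.exchangeIn hT)
    (htype f _ fun j => (hs (j, ⟨⟨0, χ₀⟩, hχ₀⟩)).1) ?_ ?_⟩
  · rw [Set.range_comp]
    exact fun h => hw3 (acl_union_hSet_elementary f h)
  · intro hmem
    obtain ⟨l, χ, b, hχ, hb, hx⟩ := exists_uBdd_of_mem_acl_union hmem
    exact (hs (⟨⊤, Formula.realize_top.2 trivial⟩, ⟨⟨l, χ⟩, hχ⟩)).2 b hb hx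

end BackAndForth

section SimilarTuplesRealize

variable {L : FirstOrder.Language.{u, v}}

attribute [local instance] lred

variable {T : L.Theory}

theorem Sim.exists_insert_hSet (hT : IsGeometric T) {N : Type max u v} [(LH L).Structure N]
    [Nonempty N] (hN : AlwaysNice T N) {ι : Type} [Finite ι] {u₁ u₂ : ι → N}
    (h : Sim (L := L) u₁ u₂) {l : ℕ} (b : Fin l → N) (hb : ∀ i, b i ∈ HSet L N) :
    ∃ (N' : Type max u v) (_ : (LH L).Structure N') (f : N ↪ₑ[LH L] N') (ι' : Type) (_ : Finite ι')
      (u₁' u₂' : ι' → N') (e : ι → ι') (e' : Fin l → ι'), Sim (L := L) u₁' u₂' ∧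
        u₁' ∘ e = f ∘ u₁ ∧ u₂' ∘ e = f ∘ u₂ ∧ u₁' ∘ e' = f ∘ b := by
  induction l with
  | zero =>
    exact ⟨N, _, ElementaryEmbedding.refl _ N, ι, ‹_›, u₁, u₂, id, fun i => i.elim0, h, rfl, rfl,
      funext fun i => i.elim0⟩
  | succ l ih =>
    obtain ⟨N', i1, f, ι', i2, u₁', u₂', e, e', h', he₁, he₂, he'⟩ :=
      ih (fun i => b i.succ) fun i => hb _
    have : Nonempty N' := ⟨f (Classical.arbitrary N)⟩
    obtain ⟨N'', i3, f', w₂, h''⟩ := h'.exists_insert_aux hT (hN.elementary f) (w₁ := f (b 0))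
      (Or.inr (Or.inl ((mem_hSet_elementary f _).2 (hb 0))))
    refine ⟨N'', i3, f'.comp f, Fin 1 ⊕ ι', inferInstance, _, _, Sum.inr ∘ e,
      Fin.cons (Sum.inl 0) (Sum.inr ∘ e'), h'', ?_, ?_, ?_⟩
    · exact funext fun i => congrArg f' (congrFun he₁ i)
    · exact funext fun i => congrArg f' (congrFun he₂ i)
    · refine funext fun i => Fin.cases rfl (fun i => ?_) i
      exact congrArg f' (congrFun he' i)

theorem Sim.exists_insert (hT : IsGeometric T) {N : Type max u v} [(LH L).Structure N]
    [Nonempty N] (hN : AlwaysNice T N) {ι : Type} [Finite ι] {u₁ u₂ : ι → N}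
    (h : Sim (L := L) u₁ u₂) (w₁ : N) :
    ∃ (N' : Type max u v) (_ : (LH L).Structure N') (f : N ↪ₑ[LH L] N') (ι' : Type) (_ : Finite ι')
      (u₁' u₂' : ι' → N') (e : ι → ι') (i₀ : ι'), Sim (L := L) u₁' u₂' ∧
        u₁' ∘ e = f ∘ u₁ ∧ u₂' ∘ e = f ∘ u₂ ∧ u₁' i₀ = f w₁ := by
  by_cases hw : w₁ ∈ acl L N (Set.range u₁ ∪ HSet L N)
  · obtain ⟨l, χ, b, hχ, hb, hx⟩ := exists_uBdd_of_mem_acl_union hw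
    obtain ⟨N', i1, f, ι', i2, u₁', u₂', e, e', h', he₁, he₂, he'⟩ :=
      h.exists_insert_hSet hT hN b hb
    have : Nonempty N' := ⟨f w₁⟩
    have hw' : f w₁ ∈ acl L N' (Set.range u₁') := by
      have h1 := (realize_reduct_elementary₂ f χ (fun _ => w₁) (Sum.elim u₁ b)).2 hx
      refine mem_acl_of_uBdd hχ _ ?_ h1
      rintro (i | i)
      · exact ⟨e i, congrFun he₁ i⟩
      · exact ⟨e' i, congrFun he' i⟩
    obtain ⟨N'', i3, f', w₂, h''⟩ := h'.exists_insert_aux hT (hN.elementary f) (Or.inl hw')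
    refine ⟨N'', i3, f'.comp f, Fin 1 ⊕ ι', inferInstance, _, _, Sum.inr ∘ e, Sum.inl 0, h'',
      ?_, ?_, rfl⟩
    · exact funext fun i => congrArg f' (congrFun he₁ i)
    · exact funext fun i => congrArg f' (congrFun he₂ i)
  · obtain ⟨N', i1, f, w₂, h'⟩ := h.exists_insert_aux hT hN (Or.inr (Or.inr hw))
    exact ⟨N', i1, f, Fin 1 ⊕ ι, inferInstance, _, _, Sum.inr, Sum.inl 0, h', rfl, rfl, rfl⟩

theorem exists_reduct_term {β : Type*} (t : (LH L).Term β) : ∃ t' : L.Term β,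
    ∀ (M : Type w) [(LH L).Structure M] (v : β → M), t.realize v = t'.realize v := by
  induction t with
  | var i => exact ⟨Term.var i, fun M _ v => rfl⟩
  | func f ts ih =>
    rcases f with f | f
    · choose t' ht' using ih
      refine ⟨Term.func f t', fun M _ v => ?_⟩
      exact congrArg (Structure.funMap (L := LH L) (Sum.inl f)) (funext fun i => ht' i M v)
    · exact f.elim

theorem Sim.mem_hSet_of_term (hT : IsGeometric T) {N : Type max u v} [(LH L).Structure N]
    [Nonempty N] (hN : Nice T N) {ι : Type} [Finite ι] {u₁ u₂ : ι → N}
    (h : Sim (L := L) u₁ u₂) (t : L.Term ι) (ht : t.realize u₁ ∈ HSet L N) :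
    t.realize u₂ ∈ HSet L N := by
  refine h.mem_hSet_of_mem_acl hN (hN.exchangeIn hT) (fun θ => ?_) ?_ ht
  · have hFO : FO.{u, v, max u v} L ι
        (fun M _ u => θ.Realize (Sum.elim (fun _ => t.realize u) u)) :=
      ⟨BoundedFormula.subst θ (Sum.elim (fun _ => t) Term.var), fun M _ u => by
        refine BoundedFormula.realize_subst.trans (iff_of_eq ?_)
        exact congrArg (fun v => BoundedFormula.Realize θ v default) (by ext (_ | _) <;> rfl)⟩
    exact h.type_FO hFO
  · refine mem_acl_of_formula
      ((Term.var (Sum.inl 0)).equal (t.relabel Sum.inr) : L.Formula (Fin 1 ⊕ ι)) u₁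
      (fun j => ⟨j, rfl⟩) ?_ ?_
    · rw [Formula.realize_equal, Term.realize_relabel]
      rfl
    · refine (Set.finite_singleton (t.realize u₁)).subset fun y hy => ?_
      rw [Set.mem_ofPred_eq, Formula.realize_equal, Term.realize_relabel] at hy
      exact hy

/-- Similar tuples satisfy the same `L_H`-formulas. -/
theorem Sim.realize_boundedFormula (hT : IsGeometric T) {α : Type*} {n : ℕ}
    (φ : (LH L).BoundedFormula α n) : ∀ {N : Type max u v} [(LH L).Structure N] [Nonempty N],
    AlwaysNice T N → ∀ {ι : Type} [Finite ι] {u₁ u₂ : ι → N}, Sim (L := L) u₁ u₂ →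
      ∀ (g : α → ι) (g' : Fin n → ι), φ.Realize (u₁ ∘ g) (u₁ ∘ g') →
        φ.Realize (u₂ ∘ g) (u₂ ∘ g') := by
  induction φ with
  | falsum => exact fun _ _ _ _ _ _ _ _ h => h
  | equal t₁ t₂ =>
    intro N _ _ hN ι _ u₁ u₂ h g g'
    obtain ⟨s₁, hs₁⟩ := exists_reduct_term.{u, v, max u v} t₁
    obtain ⟨s₂, hs₂⟩ := exists_reduct_term.{u, v, max u v} t₂
    have hFO : FO.{u, v, max u v} L ι (fun M _ u =>
        s₁.realize (Sum.elim (u ∘ g) (u ∘ g')) = s₂.realize (Sum.elim (u ∘ g) (u ∘ g'))) :=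
      ⟨(s₁.relabel (Sum.elim g g')).equal (s₂.relabel (Sum.elim g g')), fun M _ u => by
        rw [Formula.realize_equal, Term.realize_relabel, Term.realize_relabel, Sum.comp_elim]⟩
    intro h1
    have h2 : t₁.realize (Sum.elim (u₁ ∘ g) (u₁ ∘ g')) = t₂.realize (Sum.elim (u₁ ∘ g) (u₁ ∘ g')) :=
      h1
    rw [hs₁, hs₂] at h2
    have h3 := (h.type_FO hFO).1 h2
    rw [← hs₁, ← hs₂] at h3
    exact h3
  | rel R ts =>
    intro N _ _ hN ι _ u₁ u₂ h g g'
    choose s hs using fun i => exists_reduct_term.{u, v, max u v} (ts i)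
    change Structure.RelMap R (fun i => (ts i).realize (Sum.elim (u₁ ∘ g) (u₁ ∘ g'))) →
      Structure.RelMap R (fun i => (ts i).realize (Sum.elim (u₂ ∘ g) (u₂ ∘ g')))
    simp only [hs]
    rcases R with R | R
    · have hFO : FO.{u, v, max u v} L ι (fun M _ u =>
          Structure.RelMap R fun i => (s i).realize (Sum.elim (u ∘ g) (u ∘ g'))) :=
        ⟨R.formula fun i => (s i).relabel (Sum.elim g g'), fun M _ u => by
          rw [Formula.realize_rel]
          simp only [Term.realize_relabel, Sum.comp_elim]⟩
      exact (h.type_FO hFO).1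
    · obtain ⟨⟨rfl⟩⟩ := R
      intro h1
      have key : ∀ u : ι → N, Structure.RelMap (hSym L)
          (fun i => (s i).realize (Sum.elim (u ∘ g) (u ∘ g'))) ↔
          ((s 0).relabel (Sum.elim g g')).realize u ∈ HSet L N := by
        intro u
        rw [Term.realize_relabel, Sum.comp_elim]
        refine iff_of_eq (congrArg (Structure.RelMap (hSym L)) (funext fun i => ?_))
        rw [Subsingleton.elim i 0]
        rfl
      exact (key u₂).2 (h.mem_hSet_of_term hT hN.nice _ ((key u₁).1 h1))
  | imp φ₁ φ₂ ih₁ ih₂ =>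
    intro N _ _ hN ι _ u₁ u₂ h g g'
    rw [BoundedFormula.realize_imp, BoundedFormula.realize_imp]
    exact fun h1 h2 => ih₂ hN h g g' (h1 (ih₁ hN h.symm g g' h2))
  | all φ ih =>
    intro N _ _ hN ι _ u₁ u₂ h g g' h1
    rw [BoundedFormula.realize_all]
    intro w₂
    obtain ⟨N', i1, f, ι', i2, u₂', u₁', e, i₀, h', he₂, he₁, hi₀⟩ := h.symm.exists_insert hT hN w₂
    have : Nonempty N' := ⟨f w₂⟩
    rw [← f.map_boundedFormula, BoundedFormula.realize_all] at h1
    have h2 := ih (hN.elementary f) h'.symm (e ∘ g) (Fin.snoc (e ∘ g') i₀)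
    rw [Fin.comp_snoc, Fin.comp_snoc, ← Function.comp_assoc, ← Function.comp_assoc,
      ← Function.comp_assoc, ← Function.comp_assoc, he₁, he₂, hi₀] at h2
    have h3 := h2 (h1 (u₁' i₀))
    rwa [Function.comp_assoc, Function.comp_assoc, ← Fin.comp_snoc, f.map_boundedFormula] at h3

end SimilarTuplesRealize

section TracesOnH

variable {L : FirstOrder.Language.{u, v}}

attribute [local instance] lred

variable {T : L.Theory} {N : Type max u v} [(LH L).Structure N] [Nonempty N]

theorem exists_tuple_hInd (hT : IsGeometric T) (hN : Nice T N) {κ : Type*} [Finite κ] (a : κ → N) :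
    ∃ (k : ℕ) (h : Fin k → N), (∀ i, h i ∈ HSet L N) ∧
      HInd L (HSet L N) (Set.range (Sum.elim a h)) := by
  obtain ⟨F, hF, hind⟩ := exists_hInd (hN.exchangeIn hT) (HSet L N) (Set.finite_range a).toFinset
  have hr : Set.range (fun i => (F.equivFin.symm i : N)) = F := by
    rw [show (fun i => (F.equivFin.symm i : N)) = Subtype.val ∘ F.equivFin.symm from rfl,
      F.equivFin.symm.surjective.range_comp]
    exact Subtype.range_coe
  refine ⟨F.card, fun i => F.equivFin.symm i, fun i => hF (F.equivFin.symm i).2, ?_⟩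
  rw [Set.Sum.elim_range, hr]
  rwa [Set.Finite.coe_toFinset] at hind

theorem exists_trace_formula (hT : IsGeometric T) (hN : AlwaysNice T N) {n m : ℕ}
    (φ : (LH L).Formula (Fin n ⊕ Fin m)) (a : Fin m → N) :
    ∃ (k : ℕ) (ψ : L.Formula (Fin n ⊕ (Fin m ⊕ Fin k))) (h : Fin k → N),
      (∀ i, h i ∈ HSet L N) ∧ ∀ x : Fin n → N, (∀ i, x i ∈ HSet L N) →
        (φ.Realize (Sum.elim x a) ↔ ψ.Realize (Sum.elim x (Sum.elim a h))) := by
  classical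
  obtain ⟨k, h, hh, hind⟩ := exists_tuple_hInd hT hN.nice a
  by_contra hcon
  have hno : ∀ ψ : L.Formula (Fin n ⊕ (Fin m ⊕ Fin k)), ¬ ∀ x : Fin n → N,
      (∀ i, x i ∈ HSet L N) →
        (φ.Realize (Sum.elim x a) ↔ ψ.Realize (Sum.elim x (Sum.elim a h))) :=
    fun ψ hψ => hcon ⟨k, ψ, h, hh, hψ⟩
  let P : L.Formula (Fin n ⊕ (Fin m ⊕ Fin k)) → ∀ (M : Type max u v) [(LH L).Structure M],
      (Fin m ⊕ Fin k → M) → (Fin n ⊕ Fin n → M) → Prop := fun θ M _ v s =>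
    (((∀ i, s (Sum.inl i) ∈ HSet L M) ∧ ∀ i, s (Sum.inr i) ∈ HSet L M) ∧
      (φ.Realize (Sum.elim (fun i => s (Sum.inl i)) (fun i => v (Sum.inl i))) ∧
        ¬ φ.Realize (Sum.elim (fun i => s (Sum.inr i)) (fun i => v (Sum.inl i))))) ∧
      (θ.Realize (Sum.elim (fun i => s (Sum.inl i)) v) ↔
        θ.Realize (Sum.elim (fun i => s (Sum.inr i)) v))
  have hP : ∀ θ, FO.{u, v, max u v} (LH L) ((Fin m ⊕ Fin k) ⊕ (Fin n ⊕ Fin n)) (fun M _ v =>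
      P θ M (fun i => v (Sum.inl i)) (fun i => v (Sum.inr i))) := fun θ => by
    refine FO.and (FO.and (FO.and (FO.forallFinite fun i => FO.memHSet _)
      (FO.forallFinite fun i => FO.memHSet _))
      (FO.and (FO.realizeElim φ _ _) (FO.not (FO.realizeElim φ _ _)))) (FO.iff ?_ ?_)
    · exact (FO.realizeElim θ _ _).lift
    · exact (FO.realizeElim θ _ _).lift
  obtain ⟨N', i1, i2, f, s, hs⟩ := exists_elementary_extension_FO P hP (Sum.elim a h) fun F => by
    let G := {p : F → Prop // ∃ c : Fin n → N, (∀ i, c i ∈ HSet L N) ∧ φ.Realize (Sum.elim c a) ∧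
      ∀ θ : F, θ.1.Realize (Sum.elim c (Sum.elim a h)) ↔ p θ}
    have hFO : FO.{u, v, max u v} L (Fin n ⊕ (Fin m ⊕ Fin k)) (fun M _ v =>
        ∃ p : G, ∀ θ : F, θ.1.Realize v ↔ p.1 θ) := by
      refine FO.existsFinite fun p => FO.forallFinite fun θ => FO.iff ?_ (FO.const _)
      exact ⟨θ.1, fun M _ v => Iff.rfl⟩
    obtain ⟨ψ, hψ⟩ := hFO
    have h1 := hno ψ
    push Not at h1
    obtain ⟨d, hd, h1⟩ := h1
    rw [hψ] at h1
    rcases h1 with ⟨hφ, hp⟩ | ⟨hφ, p, hp⟩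
    · exact absurd ⟨⟨_, d, hd, hφ, fun θ => Iff.rfl⟩, fun θ => Iff.rfl⟩ hp
    · obtain ⟨c, hc, hcφ, hcp⟩ := p.2
      refine ⟨Sum.elim c d, fun θ hθ => ⟨⟨⟨hc, hd⟩, hcφ, hφ⟩, ?_⟩⟩
      exact (hcp ⟨θ, hθ⟩).trans (hp ⟨θ, hθ⟩).symm
  obtain ⟨⟨⟨hc, hd⟩, hcφ, hdφ⟩, -⟩ := hs ⊤
  have hind' := hind.elementary f
  rw [← Set.range_comp] at hind'
  have hsim : Sim (L := L) (Sum.elim (fun i => s (Sum.inl i)) (f ∘ Sum.elim a h))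
      (Sum.elim (fun i => s (Sum.inr i)) (f ∘ Sum.elim a h)) := by
    refine ⟨?_, ?_, fun θ => (hs θ).2, ?_⟩
    · rw [Set.Sum.elim_range, Set.union_comm]
      exact hind'.union (Set.range_subset_iff.2 hc)
    · rw [Set.Sum.elim_range, Set.union_comm]
      exact hind'.union (Set.range_subset_iff.2 hd)
    · rintro (i | i)
      · exact iff_of_true (hc i) (hd i)
      · exact Iff.rfl
  have key := hsim.realize_boundedFormula hT φ (hN.elementary f)
    (Sum.elim Sum.inl fun i => Sum.inr (Sum.inl i)) Fin.elim0
  rw [Subsingleton.elim (_ ∘ Fin.elim0) default, Subsingleton.elim (_ ∘ Fin.elim0) default] at key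
  refine hdφ ?_
  have e : ∀ c : Fin n → N', Sum.elim c (f ∘ Sum.elim a h) ∘
      Sum.elim Sum.inl (fun i => Sum.inr (Sum.inl i)) =
      Sum.elim c (fun i => (f ∘ Sum.elim a h) (Sum.inl i)) := fun c => by ext (_ | _) <;> rfl
  rw [e, e] at key
  exact key hcφ

theorem exists_finset_trace_formula (hT : IsGeometric T) (hN : AlwaysNice T N) {n m : ℕ}
    (φ : (LH L).Formula (Fin n ⊕ Fin m)) :
    ∃ F : Finset (Σ k : ℕ, L.Formula (Fin n ⊕ (Fin m ⊕ Fin k))), ∀ a : Fin m → N, ∃ j ∈ F,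
      ∃ h : Fin j.1 → N, (∀ i, h i ∈ HSet L N) ∧ ∀ x : Fin n → N, (∀ i, x i ∈ HSet L N) →
        (φ.Realize (Sum.elim x a) ↔ j.2.Realize (Sum.elim x (Sum.elim a h))) := by
  by_contra! hcon
  let P : (Σ k : ℕ, L.Formula (Fin n ⊕ (Fin m ⊕ Fin k))) → ∀ (M : Type max u v)
      [(LH L).Structure M], (Empty → M) → (Fin m → M) → Prop := fun j M _ _ a =>
    ¬ ∃ h : Fin j.1 → M, (∀ i, h i ∈ HSet L M) ∧ ∀ x : Fin n → M, (∀ i, x i ∈ HSet L M) →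
        (φ.Realize (Sum.elim x a) ↔ j.2.Realize (Sum.elim x (Sum.elim a h)))
  have hP : ∀ j, FO.{u, v, max u v} (LH L) (Empty ⊕ Fin m) (fun M _ v =>
      P j M (fun i => v (Sum.inl i)) (fun i => v (Sum.inr i))) := fun j => by
    refine FO.not (FO.exTuple (FO.and (FO.forallFinite fun i => FO.memHSet _) (FO.allTuple
      (FO.imp (FO.forallFinite fun i => FO.memHSet _) (FO.iff (FO.realizeElim φ _ _) ?_)))))
    exact (FO.realizeElim₃ j.2 _ _ _).lift
  obtain ⟨N', i1, i2, f, a, ha⟩ := exists_elementary_extension_FO P hP Empty.elim fun F => by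
    obtain ⟨a, ha⟩ := hcon F
    refine ⟨a, fun j hj hex => ?_⟩
    obtain ⟨h, hh, hx⟩ : ∃ h : Fin j.1 → N, (∀ i, h i ∈ HSet L N) ∧
      ∀ x : Fin n → N, (∀ i, x i ∈ HSet L N) →
        (φ.Realize (Sum.elim x a) ↔ j.2.Realize (Sum.elim x (Sum.elim a h))) := hex
    obtain ⟨x, hxH, hx'⟩ := ha j hj h hh
    have := hx x hxH
    tauto
  obtain ⟨k, ψ, h, hh, hψ⟩ := exists_trace_formula hT (hN.elementary f) φ a
  exact ha ⟨k, ψ⟩ ⟨h, hh, hψ⟩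

/-- The traces on `H` of an `L_H`-definable family are contained in an `L`-definable family. -/
theorem exists_uniform_trace_formula [Nontrivial N] (hT : IsGeometric T) (hN : AlwaysNice T N)
    {n m : ℕ} (φ : (LH L).Formula (Fin n ⊕ Fin m)) :
    ∃ (κ : Type) (_ : Finite κ) (ψ : L.Formula (Fin n ⊕ κ)), ∀ a : Fin m → N, ∃ e : κ → N,
      ∀ x : Fin n → N, (∀ i, x i ∈ HSet L N) →
        (φ.Realize (Sum.elim x a) ↔ ψ.Realize (Sum.elim x e)) := by
  classical
  obtain ⟨F, hF⟩ := exists_finset_trace_formula hT hN φ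
  obtain ⟨p, q, hpq⟩ := exists_pair_ne N
  let j : Fin F.card → Σ k : ℕ, L.Formula (Fin n ⊕ (Fin m ⊕ Fin k)) := fun i => F.equivFin.symm i
  let κ := Fin m ⊕ ((Σ i : Fin F.card, Fin (j i).1) ⊕ (Fin F.card ⊕ Fin 1))
  have hFO : FO.{u, v, max u v} L (Fin n ⊕ κ) (fun M _ v => ∃ i : Fin F.card,
      ¬ v (Sum.inr (Sum.inr (Sum.inr (Sum.inl i)))) =
        v (Sum.inr (Sum.inr (Sum.inr (Sum.inr 0)))) ∧
      (j i).2.Realize (Sum.elim (fun i => v (Sum.inl i)) (Sum.elim (fun i => v (Sum.inr (Sum.inl i)))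
        (fun k => v (Sum.inr (Sum.inr (Sum.inl ⟨i, k⟩))))))) :=
    FO.existsFinite fun i => FO.and (FO.not (FO.eq _ _)) (FO.realizeElim₃ _ _ _ _)
  obtain ⟨ψ, hψ⟩ := hFO
  refine ⟨κ, inferInstance, ψ, fun a => ?_⟩
  obtain ⟨j₀, hj₀, h, hh, hx⟩ := hF a
  obtain ⟨i₀, rfl⟩ : ∃ i₀, j i₀ = j₀ := ⟨F.equivFin ⟨j₀, hj₀⟩, by
    change ((F.equivFin.symm (F.equivFin ⟨j₀, hj₀⟩) : F) : Σ k : ℕ, _) = j₀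
    rw [Equiv.symm_apply_apply]⟩
  refine ⟨Sum.elim a (Sum.elim (fun k => if hk : k.1 = i₀ then h (hk ▸ k.2) else p)
    (Sum.elim (fun i => if i = i₀ then q else p) fun _ => p)), fun x hxH => ?_⟩
  rw [hx x hxH, hψ]
  constructor
  · intro hr
    refine ⟨i₀, ?_, ?_⟩
    · simp only [Sum.elim_inr, Sum.elim_inl, if_true]
      exact hpq.symm
    · simp only [Sum.elim_inr, Sum.elim_inl, dite_true]
      exact hr
  · rintro ⟨i, hi, hr⟩
    simp only [Sum.elim_inr, Sum.elim_inl] at hi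
    by_cases hii : i = i₀
    · subst hii
      simp only [Sum.elim_inr, Sum.elim_inl, dite_true] at hr
      exact hr
    · exact absurd (if_neg hii) hi

end TracesOnH

section Trees

theorem treeComparable_append {τ η ν : List Bool} :
    TreeComparable (τ ++ η) (τ ++ ν) ↔ TreeComparable η ν :=
  or_congr (List.prefix_append_right_inj τ) (List.prefix_append_right_inj τ)

theorem not_treeComparable_cons {b b' : Bool} (h : b ≠ b') (η ν : List Bool) :
    ¬ TreeComparable (b :: η) (b' :: ν) := by
  rintro (h' | h')
  · exact h (List.cons_prefix_cons.1 h').1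
  · exact h (List.cons_prefix_cons.1 h').1.symm

theorem IsTreeAntichain.image_append {X : Finset (List Bool)} (hX : IsTreeAntichain (X : Set _))
    (τ : List Bool) : IsTreeAntichain (X.image (τ ++ ·) : Finset (List Bool)) := by
  intro η' hη' ν' hν' hne
  obtain ⟨η, hη, rfl⟩ := Finset.mem_image.1 (Finset.mem_coe.1 hη')
  obtain ⟨ν, hν, rfl⟩ := Finset.mem_image.1 (Finset.mem_coe.1 hν')
  rw [treeComparable_append]
  exact hX η hη ν hν fun h => hne (h ▸ rfl)

theorem isTreeAntichain_union_cons {X Y : Finset (List Bool)} (hX : IsTreeAntichain (X : Set _))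
    (hY : IsTreeAntichain (Y : Set _)) :
    IsTreeAntichain (X.image ([false] ++ ·) ∪ Y.image ([true] ++ ·) : Finset (List Bool)) := by
  intro η hη ν hν hne
  rcases Finset.mem_union.1 (Finset.mem_coe.1 hη) with hη' | hη' <;>
  rcases Finset.mem_union.1 (Finset.mem_coe.1 hν) with hν' | hν'
  · exact hX.image_append _ η hη' ν hν' hne
  · obtain ⟨η, -, rfl⟩ := Finset.mem_image.1 hη'
    obtain ⟨ν, -, rfl⟩ := Finset.mem_image.1 hν'
    exact not_treeComparable_cons Bool.false_ne_true η ν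
  · obtain ⟨η, -, rfl⟩ := Finset.mem_image.1 hη'
    obtain ⟨ν, -, rfl⟩ := Finset.mem_image.1 hν'
    exact not_treeComparable_cons Bool.false_ne_true.symm η ν
  · refine hY.image_append _ η hη' ν hν' ?_
    assumption

/-- A finite colouring of the antichains of the binary tree is constant on some cone. -/
theorem exists_cone_of_antichains {S : Type*} (F : Finset S)
    (Q : S → Finset (List Bool) → Prop) (hmono : ∀ s X Y, X ⊆ Y → Q s Y → Q s X)
    (h : ∀ X : Finset (List Bool), IsTreeAntichain (X : Set _) → ∃ s ∈ F, Q s X) :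
    ∃ τ : List Bool, ∃ s ∈ F, ∀ X : Finset (List Bool), IsTreeAntichain (X : Set _) →
      Q s (X.image (τ ++ ·)) := by
  classical
  induction F using Finset.induction_on generalizing Q with
  | empty =>
    obtain ⟨s, hs, -⟩ := h ∅ (by simp [IsTreeAntichain])
    simp at hs
  | insert s₀ F _ ih =>
    by_cases h₀ : ∀ X : Finset (List Bool), IsTreeAntichain (X : Set _) →
        Q s₀ (X.image ([false] ++ ·))
    · exact ⟨[false], s₀, Finset.mem_insert_self _ _, h₀⟩
    · push Not at h₀
      obtain ⟨X₀, hX₀, hQ₀⟩ := h₀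
      obtain ⟨τ, s, hs, hτ⟩ := ih (fun s Y => Q s (Y.image ([true] ++ ·)))
        (fun s X Y hXY => hmono s _ _ (Finset.image_subset_image hXY)) fun Y hY => by
          obtain ⟨s, hs, hQ⟩ := h _ (isTreeAntichain_union_cons hX₀ hY)
          have hne : s ≠ s₀ := fun hss =>
            hQ₀ (hmono _ _ _ Finset.subset_union_left (hss ▸ hQ))
          exact ⟨s, (Finset.mem_insert.1 hs).resolve_left hne,
            hmono _ _ _ Finset.subset_union_right hQ⟩
      refine ⟨[true] ++ τ, s, Finset.mem_insert_of_mem hs, fun X hX => ?_⟩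
      have := hτ X hX
      rw [Finset.image_image] at this
      simpa [Function.comp_def] using this

end Trees

section Large

/-- Infinitely many first coordinates such that, for each of them, infinitely many second
coordinates, and so on. -/
def Large {M : Type*} : (r : ℕ) → Set (Fin r → M) → Prop
  | 0, D => D.Nonempty
  | r + 1, D => {x : M | Large r {z | (Fin.cons x z : Fin (r + 1) → M) ∈ D}}.Infinite

/-- A family of tuples indexed by the branches of the tree of height `r` which branches `K` times
at each node. -/
def IsBranching {M : Type*} {r K : ℕ} (z : (Fin r → Fin K) → Fin r → M) : Prop :=
  ∀ (j : Fin r) (s s' : Fin r → Fin K), (∀ i < j, s i = s' i) → (z s j = z s' j ↔ s j = s' j)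

theorem Large.exists_isBranching {M : Type*} {r : ℕ} {D : Set (Fin r → M)} (h : Large r D)
    (K : ℕ) : ∃ z : (Fin r → Fin K) → Fin r → M, IsBranching z ∧ ∀ s, z s ∈ D := by
  induction r with
  | zero =>
    obtain ⟨z, hz⟩ := h
    exact ⟨fun _ => z, fun j => j.elim0, fun _ => hz⟩
  | succ r ih =>
    obtain ⟨x, hx, hxD⟩ := atLeast_of_infinite h K
    choose y hy hyD using fun k => ih (hxD k)
    refine ⟨fun s => Fin.cons (x (s 0)) (y (s 0) (Fin.tail s)), fun j => ?_,
      fun s => hyD (s 0) (Fin.tail s)⟩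
    refine Fin.cases (fun s s' _ => ?_) (fun j s s' hs => ?_) j
    · beta_reduce
      rw [Fin.cons_zero, Fin.cons_zero, hx.eq_iff]
    · beta_reduce
      rw [Fin.cons_succ, Fin.cons_succ, hs 0 (Fin.succ_pos j)]
      exact hy (s' 0) j _ _ fun i hi => hs i.succ (Fin.succ_lt_succ_iff.2 hi)

variable {L : FirstOrder.Language.{u, v}} {T : L.Theory}

theorem exists_cons_formula {r : ℕ} {κ : Type*} (θ : L.Formula (Fin (r + 1) ⊕ κ)) :
    ∃ θ' : L.Formula (Fin r ⊕ (Fin 1 ⊕ κ)), ∀ (M : Type w) [L.Structure M] (x : M) (z : Fin r → M)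
      (c : κ → M), θ'.Realize (Sum.elim z (Sum.elim (fun _ => x) c)) ↔
        θ.Realize (Sum.elim (Fin.cons x z : Fin (r + 1) → M) c) := by
  refine ⟨θ.relabel (Sum.elim (Fin.cons (Sum.inr (Sum.inl 0)) Sum.inl) fun i => Sum.inr (Sum.inr i)),
    fun M _ x z c => ?_⟩
  rw [Formula.realize_relabel]
  refine iff_of_eq (congrArg θ.Realize ?_)
  ext (i | i)
  · exact Fin.cases rfl (fun i => rfl) i
  · rfl

/-- In models of a geometric theory, `Large` is definable, and it is witnessed by branching families
with sufficiently many branches. -/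
theorem IsGeometric.large (hT : IsGeometric T) {r : ℕ} {κ : Type*} [Finite κ]
    (θ : L.Formula (Fin r ⊕ κ)) :
    ∃ (Λ : L.Formula κ) (K₀ : ℕ), ∀ (M : Type max u v) [L.Structure M] [Nonempty M], M ⊨ T →
      ∀ c : κ → M, (Λ.Realize c ↔ Large r {z | θ.Realize (Sum.elim z c)}) ∧
        ∀ K ≥ K₀, ∀ z : (Fin r → Fin K) → Fin r → M, IsBranching z →
          (∀ s, θ.Realize (Sum.elim (z s) c)) → Large r {z | θ.Realize (Sum.elim z c)} := by
  induction r generalizing κ with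
  | zero =>
    have hFO : FO.{u, v, max u v} L κ (fun M _ c => ∃ z : Fin 0 → M, θ.Realize (Sum.elim z c)) :=
      FO.exTuple (FO.realizeElim θ _ _)
    obtain ⟨Λ, hΛ⟩ := hFO
    exact ⟨Λ, 0, fun M _ _ _ c => ⟨hΛ M c, fun K _ z _ hz => ⟨_, hz fun i => i.elim0⟩⟩⟩
  | succ r ih =>
    obtain ⟨θ', hθ'⟩ := exists_cons_formula.{u, v, max u v} θ
    obtain ⟨Λ', K₁, h'⟩ := ih θ'
    obtain ⟨K₂, hK₂⟩ := hT.exists_bound Λ'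
    have hFO : FO.{u, v, max u v} L κ (fun M _ c =>
        AtLeast K₂ {x : M | Λ'.Realize (Sum.elim (fun _ => x) c)}) :=
      FO.atLeast K₂ (FO.realizeElim Λ' _ _)
    obtain ⟨Λ, hΛ⟩ := hFO
    refine ⟨Λ, max (max K₁ K₂) 1, fun M _ _ hM c => ?_⟩
    have key : ∀ x : M, Λ'.Realize (Sum.elim (fun _ => x) c) ↔
        Large r {z | (Fin.cons x z : Fin (r + 1) → M) ∈ {z | θ.Realize (Sum.elim z c)}} := by
      intro x
      rw [(h' M hM (Sum.elim (fun _ : Fin 1 => x) c)).1]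
      simp only [hθ']
      rfl
    have hset : {x : M | Λ'.Realize (Sum.elim (fun _ => x) c)}.Infinite ↔
        Large (r + 1) {z | θ.Realize (Sum.elim z c)} := by
      simp only [key]
      rfl
    refine ⟨?_, fun K hK z hz hzθ => ?_⟩
    · rw [hΛ, ← hset]
      exact ⟨hK₂ M hM c, fun h => atLeast_of_infinite h _⟩
    · have hK₀ : 0 < K := lt_of_lt_of_le Nat.one_pos (le_trans (le_max_right _ _) hK)
      have hKK₂ : K₂ ≤ K := (le_max_right K₁ K₂).trans ((le_max_left _ _).trans hK)
      have hKK₁ : K₁ ≤ K := (le_max_left K₁ K₂).trans ((le_max_left _ _).trans hK)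
      let s₀ : Fin r → Fin K := fun _ => ⟨0, hK₀⟩
      let x : Fin K → M := fun k => z (Fin.cons k s₀) 0
      have hx : ∀ k t, z (Fin.cons k t) 0 = x k := fun k t =>
        (hz 0 _ _ fun i hi => absurd hi (Fin.not_lt_zero i)).2 rfl
      have hcons : ∀ k t, (Fin.cons (x k) (Fin.tail (z (Fin.cons k t))) : Fin (r + 1) → M) =
          z (Fin.cons k t) := fun k t => by
        rw [← hx k t, Fin.cons_self_tail]
      rw [← hset]
      refine hK₂ M hM c (AtLeast.mono ⟨x, fun k k' hkk => ?_, fun k => ?_⟩ hKK₂)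
      · exact (hz 0 (Fin.cons k s₀) (Fin.cons k' s₀) fun i hi => absurd hi (Fin.not_lt_zero i)).1 hkk
      · refine ((h' M hM _).1).2 ((h' M hM _).2 K hKK₁ (fun t => Fin.tail (z (Fin.cons k t))) ?_ ?_)
        · intro j t t' ht
          refine (hz j.succ (Fin.cons k t) (Fin.cons k t') fun i => ?_)
          refine Fin.cases (fun _ => rfl) (fun i hi => ?_) i
          exact ht i (Fin.succ_lt_succ_iff.1 hi)
        · intro t
          rw [hθ', hcons]
          exact hzθ _

theorem exists_mem_acl_of_not_large (hT : IsGeometric T) {M : Type max u v} [L.Structure M]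
    [Nonempty M] (hM : M ⊨ T) {r : ℕ} {κ : Type*} [Finite κ] (θ : L.Formula (Fin r ⊕ κ))
    (c : κ → M) (h : ¬ Large r {z | θ.Realize (Sum.elim z c)}) (z : Fin r → M)
    (hz : θ.Realize (Sum.elim z c)) :
    ∃ j, z j ∈ acl L M (Set.range c ∪ {y | ∃ j', j' ≠ j ∧ z j' = y}) := by
  induction r generalizing κ with
  | zero => exact absurd ⟨z, hz⟩ h
  | succ r ih =>
    obtain ⟨θ', hθ'⟩ := exists_cons_formula.{u, v, max u v} θ
    obtain ⟨Λ', _, h'⟩ := hT.large θ'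
    have key : ∀ x : M, Λ'.Realize (Sum.elim (fun _ => x) c) ↔
        Large r {z | (Fin.cons x z : Fin (r + 1) → M) ∈ {z | θ.Realize (Sum.elim z c)}} := by
      intro x
      rw [(h' M hM (Sum.elim (fun _ : Fin 1 => x) c)).1]
      simp only [hθ']
      rfl
    by_cases h0 : Λ'.Realize (Sum.elim (fun _ => z 0) c)
    · refine ⟨0, mem_acl_of_formula Λ' c (fun j => Or.inl ⟨j, rfl⟩) h0 ?_⟩
      simp only [key]
      exact Set.not_infinite.1 h
    · rw [(h' M hM _).1] at h0
      obtain ⟨j, hj⟩ := ih θ' _ h0 (Fin.tail z) (by rw [hθ', Fin.cons_self_tail]; exact hz)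
      refine ⟨j.succ, acl_mono ?_ hj⟩
      rintro y (hy | ⟨j', hj', rfl⟩)
      · rw [range_elim_const] at hy
        rcases hy with rfl | hy
        · exact Or.inr ⟨0, (Fin.succ_ne_zero j).symm, rfl⟩
        · exact Or.inl hy
      · exact Or.inr ⟨j'.succ, fun h => hj' (Fin.succ_injective _ h), rfl⟩

attribute [local instance] lred

theorem Nice.exists_hSet_of_large (hT : IsGeometric T) {N : Type max u v} [(LH L).Structure N]
    [Nonempty N] (hN : Nice T N) {r : ℕ} {κ : Type} [Finite κ] (θ : L.Formula (Fin r ⊕ κ))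
    (c : κ → N) (h : Large r {z | θ.Realize (Sum.elim z c)}) :
    ∃ z : Fin r → N, (∀ j, z j ∈ HSet L N) ∧ θ.Realize (Sum.elim z c) := by
  induction r generalizing κ with
  | zero =>
    obtain ⟨z, hz⟩ := h
    exact ⟨z, fun j => j.elim0, hz⟩
  | succ r ih =>
    obtain ⟨θ', hθ'⟩ := exists_cons_formula.{u, v, max u v} θ
    obtain ⟨Λ', _, h'⟩ := hT.large θ'
    have key : ∀ x : N, Λ'.Realize (Sum.elim (fun _ => x) c) ↔
        Large r {z | (Fin.cons x z : Fin (r + 1) → N) ∈ {z | θ.Realize (Sum.elim z c)}} := by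
      intro x
      rw [(h' N hN.model (Sum.elim (fun _ : Fin 1 => x) c)).1]
      simp only [hθ']
      rfl
    obtain ⟨x, hxH, hx⟩ := hN.dense κ Λ' c (by simp only [key]; exact h)
    obtain ⟨z, hzH, hz⟩ := ih θ' _ (((h' N hN.model _).1).1 hx)
    rw [hθ'] at hz
    exact ⟨Fin.cons x z, Fin.cases hxH hzH, hz⟩

end Large

section Reduction

variable {L : FirstOrder.Language.{u, v}}

attribute [local instance] lred

variable {T : L.Theory} {N : Type max u v} [(LH L).Structure N]

/-- If the projection along `g` of a definable set is not large, then each of its points in `H`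
satisfies one of finitely many formulas, each of which forces some coordinate to lie in `H` as soon
as the other ones do. -/
theorem exists_finset_closing_formula [Nonempty N] (hT : IsGeometric T) (hN : AlwaysNice T N)
    {n r : ℕ} {κ : Type} [Finite κ] (g : Fin r → Fin n) (β : L.Formula (Fin n ⊕ κ)) (c : κ → N)
    (hlarge : ¬ Large r {z | ∃ b : Fin n → N, (∀ j, b (g j) = z j) ∧ β.Realize (Sum.elim b c)}) :
    ∃ (k : ℕ) (h : Fin k → N) (F : Finset (Fin r × L.Formula (Fin n ⊕ (κ ⊕ Fin k)))),
      (∀ p ∈ F, ∀ x : Fin n → N, (∀ j, j ≠ p.1 → x (g j) ∈ HSet L N) →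
        p.2.Realize (Sum.elim x (Sum.elim c h)) → x (g p.1) ∈ HSet L N) ∧
      ∀ b : Fin n → N, (∀ i, b i ∈ HSet L N) → β.Realize (Sum.elim b c) →
        ∃ p ∈ F, p.2.Realize (Sum.elim b (Sum.elim c h)) := by
  classical
  obtain ⟨k, h, hh, hind⟩ := exists_tuple_hInd hT hN.nice c
  let Closing : (Fin r × L.Formula (Fin n ⊕ (κ ⊕ Fin k))) → ∀ (M : Type max u v)
      [(LH L).Structure M], (κ ⊕ Fin k → M) → Prop := fun p M _ d =>
    ∀ x : Fin n → M, (∀ j, j ≠ p.1 → x (g j) ∈ HSet L M) →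
      p.2.Realize (Sum.elim x d) → x (g p.1) ∈ HSet L M
  have hClosing : ∀ p, FO.{u, v, max u v} (LH L) (κ ⊕ Fin k) (fun M _ d => Closing p M d) := by
    intro p
    refine FO.allTuple (FO.imp (FO.forallFinite fun j => FO.imp (FO.const _) (FO.memHSet _))
      (FO.imp ?_ (FO.memHSet _)))
    exact (FO.realizeElim p.2 _ _).lift
  let J := {p : Fin r × L.Formula (Fin n ⊕ (κ ⊕ Fin k)) // Closing p N (Sum.elim c h)}
  suffices hF : ∃ F : Finset J, ∀ b : Fin n → N, (∀ i, b i ∈ HSet L N) →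
      β.Realize (Sum.elim b c) → ∃ p ∈ F, p.1.2.Realize (Sum.elim b (Sum.elim c h)) by
    obtain ⟨F, hF⟩ := hF
    refine ⟨k, h, F.image Subtype.val, fun p hp => ?_, fun b hb hβ => ?_⟩
    · obtain ⟨q, -, rfl⟩ := Finset.mem_image.1 hp
      exact q.2
    · obtain ⟨p, hp, hpb⟩ := hF b hb hβ
      exact ⟨p.1, Finset.mem_image_of_mem _ hp, hpb⟩
  by_contra! hcon
  let P : Option J → ∀ (M : Type max u v) [(LH L).Structure M], (κ ⊕ Fin k → M) →
      (Fin n → M) → Prop := fun o M _ d b =>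
    ((∀ i, b i ∈ HSet L M) ∧ β.Realize (Sum.elim b (fun i => d (Sum.inl i)))) ∧
      o.elim True fun p => ¬ p.1.2.Realize (Sum.elim b d)
  have hP : ∀ o, FO.{u, v, max u v} (LH L) ((κ ⊕ Fin k) ⊕ Fin n) (fun M _ v =>
      P o M (fun i => v (Sum.inl i)) (fun i => v (Sum.inr i))) := fun o => by
    refine FO.and (FO.and (FO.forallFinite fun i => FO.memHSet _) ?_) ?_
    · exact (FO.realizeElim β _ _).lift
    · rcases o with _ | p
      · exact FO.const _
      · exact FO.not (FO.realizeElim p.1.2 _ _).lift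
  obtain ⟨N', i1, i2, f, b, hb⟩ := exists_elementary_extension_FO P hP (Sum.elim c h) fun F => by
    obtain ⟨b, hbH, hbβ, hb⟩ := hcon F.eraseNone
    refine ⟨b, fun o ho => ⟨⟨hbH, hbβ⟩, ?_⟩⟩
    rcases o with _ | p
    · trivial
    · exact hb p (Finset.mem_eraseNone.2 ho)
  obtain ⟨⟨hbH, hbβ⟩, -⟩ := hb none
  have hN' := hN N' ⟨f⟩
  have hFO : FO.{u, v, max u v} L (Fin r ⊕ κ) (fun M _ v => ∃ b : Fin n → M,
      (∀ j, b (g j) = v (Sum.inl j)) ∧ β.Realize (Sum.elim b (fun i => v (Sum.inr i)))) := by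
    refine FO.exTuple (FO.and (FO.forallFinite fun j => FO.eq _ _) ?_)
    exact FO.realizeElim β _ _
  obtain ⟨θ, hθ⟩ := hFO
  obtain ⟨Λ, -, hΛ⟩ : ∃ (Λ : L.Formula κ) (_ : True), ∀ (M : Type max u v) [L.Structure M]
      [Nonempty M], M ⊨ T → ∀ c : κ → M,
        (Λ.Realize c ↔ Large r {z | θ.Realize (Sum.elim z c)}) := by
    obtain ⟨Λ, _, hΛ⟩ := hT.large θ
    exact ⟨Λ, trivial, fun M _ _ hM c => (hΛ M hM c).1⟩
  have hlarge' : ¬ Large r {z : Fin r → N' | θ.Realize (Sum.elim z (f ∘ c))} := by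
    rw [← hΛ N' hN'.model, realize_reduct_elementary, hΛ N hN.nice.model]
    simp only [hθ]
    exact hlarge
  obtain ⟨j, hj⟩ := exists_mem_acl_of_not_large hT hN'.model θ (f ∘ c) hlarge' (fun j => b (g j))
    ((hθ N' _).2 ⟨b, fun j => rfl, hbβ⟩)
  have hind' := hind.elementary f
  have hj' := hind'.mem_acl (hN'.exchangeIn hT) (B := {y | ∃ j', j' ≠ j ∧ b (g j') = y})
    (fun y hy => by obtain ⟨j', -, rfl⟩ := hy; exact hbH _) (hbH (g j)) (by
      refine acl_mono (Set.union_subset_union_left _ ?_) hj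
      rintro _ ⟨i, rfl⟩
      exact ⟨c i, ⟨Sum.inl i, rfl⟩, rfl⟩)
  obtain ⟨m, χ, d, hd, hχ, hclosed⟩ := hN'.exists_hClosed _ _ (by
    rintro y (hy | ⟨j', -, rfl⟩)
    · exact hy.2
    · exact hbH _) (hbH (g j)) hj'
  have hd' : ∀ i, ∃ p : (κ ⊕ Fin k) ⊕ Fin r, d i = Sum.elim (f ∘ Sum.elim c h) (fun j => b (g j)) p ∧
      ∀ x : Fin n → N', (∀ j', j' ≠ j → x (g j') ∈ HSet L N') →
        Sum.elim (f ∘ Sum.elim c h) (fun j => x (g j)) p ∈ HSet L N' := by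
    intro i
    rcases hd i with ⟨⟨_, ⟨p, rfl⟩, hp⟩, hH⟩ | ⟨j', hne, hj'⟩
    · refine ⟨Sum.inl p, hp.symm, fun x _ => ?_⟩
      rw [← hp] at hH
      exact hH
    · exact ⟨Sum.inr j', hj'.symm, fun x hx => hx j' hne⟩
  choose p hp hpH using hd'
  have hFO : FO.{u, v, max u v} L (Fin n ⊕ (κ ⊕ Fin k)) (fun M _ v => χ.Realize
      (Sum.elim (fun _ => v (Sum.inl (g j))) fun i => v ((Sum.elim Sum.inr
        fun j => Sum.inl (g j) : (κ ⊕ Fin k) ⊕ Fin r → Fin n ⊕ (κ ⊕ Fin k)) (p i)))) :=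
    FO.realizeElim χ _ _
  obtain ⟨χ', hχ'⟩ := hFO
  have hsum : ∀ x : Fin n → N', (fun i => (Sum.elim x (f ∘ Sum.elim c h) : _ → N') ((Sum.elim Sum.inr
        fun j => Sum.inl (g j) : (κ ⊕ Fin k) ⊕ Fin r → Fin n ⊕ (κ ⊕ Fin k)) (p i))) =
      fun i => Sum.elim (f ∘ Sum.elim c h) (fun j => x (g j)) (p i) := by
    intro x
    ext i
    rcases p i with q | q <;> rfl
  have hcl : Closing (j, χ') N' (f ∘ Sum.elim c h) := by
    intro x hx hxχ
    rw [hχ', hsum] at hxχ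
    exact hclosed _ _ (fun i => hpH i x hx) hxχ
  refine (hb (some ⟨(j, χ'), ((hClosing _).elementary f _).1 hcl⟩)).2 ?_
  rw [hχ']
  beta_reduce
  rw [hsum, ← funext hp]
  exact hχ

variable {n : ℕ} {κ : Type}

/-- Realizations in `H` of the `ψ(·, e_η)` over antichains in a cone, which satisfy a formula
forcing a realization to lie in `H` as soon as its coordinates in the range of `g` do. -/
def HReducible (ψ : L.Formula (Fin n ⊕ κ)) (e : List Bool → κ → N) (r : ℕ) : Prop :=
  ∃ (τ : List Bool) (ρ : Type) (_ : Finite ρ) (h : ρ → N) (g : Fin r → Fin n)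
    (χ : L.Formula (Fin n ⊕ ρ)),
    (∀ x : Fin n → N, (∀ j, x (g j) ∈ HSet L N) → χ.Realize (Sum.elim x h) →
      ∀ i, x i ∈ HSet L N) ∧
    ∀ X : Finset (List Bool), IsTreeAntichain (X : Set _) → ∃ b : Fin n → N,
      (∀ i, b i ∈ HSet L N) ∧ χ.Realize (Sum.elim b h) ∧
        ∀ η ∈ X, ψ.Realize (Sum.elim b (e (τ ++ η)))

/-- As `HReducible`, where moreover the coordinates in the range of `g` of the realizations (in the
whole model) form large sets. -/
def LargeReducible (ψ : L.Formula (Fin n ⊕ κ)) (e : List Bool → κ → N) (r : ℕ) : Prop :=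
  ∃ (τ : List Bool) (ρ : Type) (_ : Finite ρ) (h : ρ → N) (g : Fin r → Fin n)
    (χ : L.Formula (Fin n ⊕ ρ)),
    (∀ x : Fin n → N, (∀ j, x (g j) ∈ HSet L N) → χ.Realize (Sum.elim x h) →
      ∀ i, x i ∈ HSet L N) ∧
    ∀ X : Finset (List Bool), IsTreeAntichain (X : Set _) →
      Large r {z | ∃ b : Fin n → N, (∀ j, b (g j) = z j) ∧ χ.Realize (Sum.elim b h) ∧
        ∀ η ∈ X, ψ.Realize (Sum.elim b (e (τ ++ η)))}

theorem HReducible.largeReducible_or [Nonempty N] [Finite κ] (hT : IsGeometric T)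
    (hN : AlwaysNice T N) {ψ : L.Formula (Fin n ⊕ κ)} {e : List Bool → κ → N} {r : ℕ}
    (h : HReducible ψ e r) :
    LargeReducible ψ e r ∨ ∃ r', r = r' + 1 ∧ HReducible ψ e r' := by
  classical
  obtain ⟨τ, ρ, _, h, g, χ, hclosed, hX⟩ := h
  refine or_iff_not_imp_left.2 fun hnot => ?_
  have hX₀ : ∃ X : Finset (List Bool), IsTreeAntichain (X : Set _) ∧
      ¬ Large r {z | ∃ b : Fin n → N, (∀ j, b (g j) = z j) ∧ χ.Realize (Sum.elim b h) ∧
        ∀ η ∈ X, ψ.Realize (Sum.elim b (e ((τ ++ [false]) ++ η)))} := by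
    by_contra! hcon
    exact hnot ⟨τ ++ [false], ρ, ‹_›, h, g, χ, hclosed, hcon⟩
  obtain ⟨X₀, hX₀, hnl⟩ := hX₀
  have hFO : FO.{u, v, max u v} L (Fin n ⊕ ((X₀ × κ) ⊕ ρ)) (fun M _ v =>
      χ.Realize (Sum.elim (fun i => v (Sum.inl i)) fun i => v (Sum.inr (Sum.inr i))) ∧
        ∀ η : X₀, ψ.Realize (Sum.elim (fun i => v (Sum.inl i))
          fun i => v (Sum.inr (Sum.inl (η, i))))) :=
    FO.and (FO.realizeElim χ _ _) (FO.forallFinite fun η => FO.realizeElim ψ _ _)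
  obtain ⟨β, hβ⟩ := hFO
  let c : (X₀ × κ) ⊕ ρ → N := Sum.elim (fun q => e ((τ ++ [false]) ++ q.1) q.2) h
  have hβ' : ∀ b : Fin n → N, β.Realize (Sum.elim b c) ↔ χ.Realize (Sum.elim b h) ∧
      ∀ η ∈ X₀, ψ.Realize (Sum.elim b (e ((τ ++ [false]) ++ η))) := fun b =>
    (hβ N _).trans (and_congr_right fun _ => Subtype.forall)
  obtain ⟨k, h', F, hF, hFb⟩ := exists_finset_closing_formula hT hN g β c (by
    simp only [hβ']
    exact hnl)
  obtain ⟨τ', p, hp, hτ'⟩ := exists_cone_of_antichains F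
    (fun p Y => ∃ b : Fin n → N, (∀ i, b i ∈ HSet L N) ∧ χ.Realize (Sum.elim b h) ∧
      p.2.Realize (Sum.elim b (Sum.elim c h')) ∧
        ∀ η ∈ Y, ψ.Realize (Sum.elim b (e (τ ++ ([true] ++ η)))))
    (fun p X Y hXY ⟨b, h1, h2, h3, h4⟩ => ⟨b, h1, h2, h3, fun η hη => h4 η (hXY hη)⟩) fun Y hY => by
      obtain ⟨b, hbH, hbχ, hb⟩ := hX _ (isTreeAntichain_union_cons hX₀ hY)
      obtain ⟨p, hp, hpb⟩ := hFb b hbH ((hβ' b).2 ⟨hbχ, fun η hη => by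
        rw [List.append_assoc]
        exact hb _ (Finset.mem_union_left _ (Finset.mem_image_of_mem _ hη))⟩)
      exact ⟨p, hp, b, hbH, hbχ, hpb, fun η hη =>
        hb _ (Finset.mem_union_right _ (Finset.mem_image_of_mem _ hη))⟩
  obtain ⟨j, χ'⟩ := p
  obtain ⟨r, rfl⟩ : ∃ r', r = r' + 1 :=
    Nat.exists_eq_succ_of_ne_zero fun h0 => (h0 ▸ j).elim0
  have hFO' : FO.{u, v, max u v} L (Fin n ⊕ (((X₀ × κ) ⊕ ρ) ⊕ Fin k)) (fun M _ v =>
      χ.Realize (Sum.elim (fun i => v (Sum.inl i))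
        fun i => v (Sum.inr (Sum.inl (Sum.inr i)))) ∧ χ'.Realize v) :=
    FO.and (FO.realizeElim χ _ _) ⟨χ', fun M _ v => Iff.rfl⟩
  obtain ⟨χ'', hχ''⟩ := hFO'
  have hχ₂ : ∀ x : Fin n → N, χ''.Realize (Sum.elim x (Sum.elim c h')) ↔
      χ.Realize (Sum.elim x h) ∧ χ'.Realize (Sum.elim x (Sum.elim c h')) := fun x => hχ'' N _
  refine ⟨r, rfl, τ ++ ([true] ++ τ'), ((X₀ × κ) ⊕ ρ) ⊕ Fin k, inferInstance, Sum.elim c h',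
    fun i => g (j.succAbove i), χ'', fun x hx hxχ => ?_, fun X hXa => ?_⟩
  · rw [hχ₂] at hxχ
    have hne : ∀ j', j' ≠ j → x (g j') ∈ HSet L N := fun j' hj' => by
      obtain ⟨i, rfl⟩ := Fin.exists_succAbove_eq hj'
      exact hx i
    refine hclosed x (fun j' => ?_) hxχ.1
    by_cases hj' : j' = j
    · subst hj'
      exact hF _ hp x hne hxχ.2
    · exact hne j' hj'
  · obtain ⟨b, hbH, hbχ, hbχ', hb⟩ := hτ' X hXa
    refine ⟨b, hbH, (hχ₂ b).2 ⟨hbχ, hbχ'⟩, fun η hη => ?_⟩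
    rw [List.append_assoc, List.append_assoc]
    exact hb _ (Finset.mem_image_of_mem _ hη)

theorem HReducible.exists_largeReducible [Nonempty N] [Finite κ] (hT : IsGeometric T)
    (hN : AlwaysNice T N) {ψ : L.Formula (Fin n ⊕ κ)} {e : List Bool → κ → N} {r : ℕ}
    (h : HReducible ψ e r) : ∃ r', LargeReducible ψ e r' := by
  induction r with
  | zero =>
    rcases h.largeReducible_or hT hN with h | ⟨r', h0, -⟩
    · exact ⟨0, h⟩
    · exact absurd h0 (Nat.succ_ne_zero r').symm
  | succ r ih =>
    rcases h.largeReducible_or hT hN with h | ⟨r', hr, h⟩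
    · exact ⟨_, h⟩
    · obtain rfl : r = r' := Nat.succ_injective hr
      exact ih h

end Reduction

section FinalATP

variable {L : FirstOrder.Language.{u, v}}

theorem hasATP_of_finite {T : L.Theory} {M : Type max u v} [L.Structure M] [Nonempty M]
    (hM : M ⊨ T) {ι μ : Type} [Finite ι] [Finite μ] (φ : L.Formula (ι ⊕ μ))
    (a : List Bool → μ → M)
    (hcons : ∀ X : Finset (List Bool), IsTreeAntichain (X : Set _) →
      ∃ b : ι → M, ∀ η ∈ X, φ.Realize (Sum.elim b (a η)))
    (hincons : ∀ η ν : List Bool, η ≠ ν → TreeComparable η ν →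
      ¬ ∃ b : ι → M, φ.Realize (Sum.elim b (a η)) ∧ φ.Realize (Sum.elim b (a ν))) :
    T.HasATP := by
  obtain ⟨n, ⟨s⟩⟩ := Finite.exists_equiv_fin ι
  obtain ⟨m, ⟨t⟩⟩ := Finite.exists_equiv_fin μ
  have key : ∀ (b : Fin n → M) η, (φ.relabel (Sum.map s t)).Realize (Sum.elim b (a η ∘ t.symm)) ↔
      φ.Realize (Sum.elim (b ∘ s) (a η)) := fun b η => by
    rw [Formula.realize_relabel, Sum.elim_comp_map, Function.comp_assoc, Equiv.symm_comp_self,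
      Function.comp_id]
  refine ⟨Theory.ModelType.of T M, n, m, φ.relabel (Sum.map s t), fun η => a η ∘ t.symm,
    fun X hX => ?_, fun η ν hne hc => ?_⟩
  · obtain ⟨b, hb⟩ := hcons X hX
    have hbs : (b ∘ s.symm) ∘ s = b := by
      rw [Function.comp_assoc, Equiv.symm_comp_self, Function.comp_id]
    exact ⟨b ∘ s.symm, fun η hη => (key _ η).2 (hbs.symm ▸ hb η hη)⟩
  · rintro ⟨b, h1, h2⟩
    exact hincons η ν hne hc ⟨b ∘ s, (key b η).1 h1, (key b ν).1 h2⟩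

attribute [local instance] lred

variable {T : L.Theory} {N : Type max u v} [(LH L).Structure N]

/-- The new formula says that its variables form a branching tree of tuples which all satisfy the
old formula: as an inconsistency in `H` makes the set of common solutions small, it makes the new
formula inconsistent. -/
theorem LargeReducible.hasATP [Nonempty N] (hT : IsGeometric T) (hN : Nice T N) {n r : ℕ}
    {κ : Type} [Finite κ] {ψ : L.Formula (Fin n ⊕ κ)} {e : List Bool → κ → N}
    (h : LargeReducible ψ e r)
    (hincons : ∀ η ν : List Bool, η ≠ ν → TreeComparable η ν → ¬ ∃ b : Fin n → N,
      (∀ i, b i ∈ HSet L N) ∧ ψ.Realize (Sum.elim b (e η)) ∧ ψ.Realize (Sum.elim b (e ν))) :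
    T.HasATP := by
  classical
  obtain ⟨τ, ρ, _, h, g, χ, hclosed, hlarge⟩ := h
  have hFO : FO.{u, v, max u v} L (Fin r ⊕ ((κ ⊕ κ) ⊕ ρ)) (fun M _ v => ∃ b : Fin n → M,
      (∀ j, b (g j) = v (Sum.inl j)) ∧
        χ.Realize (Sum.elim b fun i => v (Sum.inr (Sum.inr i))) ∧
        ψ.Realize (Sum.elim b fun i => v (Sum.inr (Sum.inl (Sum.inl i)))) ∧
        ψ.Realize (Sum.elim b fun i => v (Sum.inr (Sum.inl (Sum.inr i))))) := by
    refine FO.exTuple (FO.and (FO.forallFinite fun j => FO.eq _ _) (FO.and ?_ (FO.and ?_ ?_)))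
    · exact FO.realizeElim χ _ _
    · exact FO.realizeElim ψ _ _
    · exact FO.realizeElim ψ _ _
  obtain ⟨θ, hθ⟩ := hFO
  obtain ⟨-, K, hK⟩ : ∃ (_ : True) (K : ℕ), ∀ c : (κ ⊕ κ) ⊕ ρ → N,
      ∀ z : (Fin r → Fin K) → Fin r → N, IsBranching z →
        (∀ s, θ.Realize (Sum.elim (z s) c)) → Large r {z | θ.Realize (Sum.elim z c)} := by
    obtain ⟨_, K, hK⟩ := hT.large θ
    exact ⟨trivial, K, fun c => (hK N hN.model c).2 K le_rfl⟩
  have hFO' : FO.{u, v, max u v} L (((Fin r → Fin K) × Fin n) ⊕ (κ ⊕ ρ)) (fun M _ v =>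
      (∀ s, χ.Realize (Sum.elim (fun i => v (Sum.inl (s, i))) fun i => v (Sum.inr (Sum.inr i))) ∧
        ψ.Realize (Sum.elim (fun i => v (Sum.inl (s, i))) fun i => v (Sum.inr (Sum.inl i)))) ∧
      IsBranching fun s j => v (Sum.inl (s, g j))) := by
    refine FO.and (FO.forallFinite fun s => FO.and (FO.realizeElim χ _ _) (FO.realizeElim ψ _ _))
      (FO.forallFinite fun j => FO.forallFinite fun s => FO.forallFinite fun s' =>
        FO.imp (FO.const _) (FO.iff (FO.eq _ _) (FO.const _)))
  obtain ⟨φ, hφ⟩ := hFO'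
  have key : ∀ (b : (Fin r → Fin K) × Fin n → N) (η : List Bool),
      φ.Realize (Sum.elim b (Sum.elim (e (τ ++ η)) h)) ↔
        (∀ s, χ.Realize (Sum.elim (fun i => b (s, i)) h) ∧
          ψ.Realize (Sum.elim (fun i => b (s, i)) (e (τ ++ η)))) ∧
        IsBranching fun s j => b (s, g j) := fun b η => hφ N _
  refine hasATP_of_finite hN.model φ (fun η => Sum.elim (e (τ ++ η)) h) (fun X hX => ?_) ?_
  · obtain ⟨z, hz, hzD⟩ := (hlarge X hX).exists_isBranching K
    choose b hbg hbχ hb using hzD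
    refine ⟨fun p => b p.1 p.2, fun η hη => (key _ η).2 ⟨fun s => ⟨hbχ s, hb s η hη⟩, ?_⟩⟩
    simp only [hbg]
    exact hz
  · rintro η ν hne hc ⟨b, h1, h2⟩
    rw [key] at h1 h2
    let c : (κ ⊕ κ) ⊕ ρ → N := Sum.elim (Sum.elim (e (τ ++ η)) (e (τ ++ ν))) h
    have hl : Large r {z | θ.Realize (Sum.elim z c)} := hK c _ h1.2 fun s =>
      (hθ N _).2 ⟨fun i => b (s, i), fun j => rfl, (h1.1 s).1, (h1.1 s).2, (h2.1 s).2⟩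
    obtain ⟨z, hzH, hz⟩ := hN.exists_hSet_of_large hT θ c hl
    obtain ⟨b', hb'z, hb'χ, hb'η, hb'ν⟩ := (hθ N _).1 hz
    refine hincons (τ ++ η) (τ ++ ν) (fun heq => hne (List.append_cancel_left heq))
      (treeComparable_append.2 hc) ⟨b', hclosed b' (fun j => ?_) hb'χ, hb'η, hb'ν⟩
    rw [hb'z]
    exact hzH j

theorem ATPWitnessH.nontrivial {n m : ℕ} {φ : (LH L).Formula (Fin n ⊕ Fin m)}
    {a : List Bool → Fin m → N} (hwit : ATPWitnessH φ a) : Nontrivial N := by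
  by_contra hN
  rw [not_nontrivial_iff_subsingleton] at hN
  have hX : ∀ η : List Bool, IsTreeAntichain (({η} : Finset (List Bool)) : Set (List Bool)) :=
    fun η x hx y hy hne => by
      rw [Finset.coe_singleton, Set.mem_singleton_iff] at hx hy
      exact absurd (hx.trans hy.symm) hne
  obtain ⟨b, hbH, hb⟩ := hwit.1 {[]} (hX _)
  obtain ⟨b', -, hb'⟩ := hwit.1 {[false]} (hX _)
  obtain rfl := Subsingleton.elim b b'
  exact hwit.2 [] [false] (List.cons_ne_nil _ _).symm (Or.inl List.nil_prefix)
    ⟨b, hbH, hb _ (Finset.mem_singleton_self _), hb' _ (Finset.mem_singleton_self _)⟩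

theorem ATPWitnessH.hasATP (hT : IsGeometric T) (hN : AlwaysNice T N) {n m : ℕ}
    {φ : (LH L).Formula (Fin n ⊕ Fin m)} {a : List Bool → Fin m → N} (hwit : ATPWitnessH φ a) :
    T.HasATP := by
  have := hwit.nontrivial
  obtain ⟨κ, _, ψ, hψ⟩ := exists_uniform_trace_formula hT hN φ
  choose e he using fun η => hψ (a η)
  have h : HReducible ψ e n := by
    refine ⟨[], Empty, inferInstance, Empty.elim, id, ⊤, fun x hx _ => hx, fun X hX => ?_⟩
    obtain ⟨b, hbH, hb⟩ := hwit.1 X hX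
    exact ⟨b, hbH, Formula.realize_top.2 trivial, fun η hη => (he η b hbH).1 (hb η hη)⟩
  obtain ⟨r, hr⟩ := h.exists_largeReducible hT hN
  refine hr.hasATP hT hN.nice fun η ν hne hc => ?_
  rintro ⟨b, hbH, h1, h2⟩
  exact hwit.2 η ν hne hc ⟨b, hbH, (he η b hbH).2 h1, (he ν b hbH).2 h2⟩

end FinalATP

/-- **Lemma 4.12**: Let `T` be a geometric complete theory and `T*` the theory of lovely pairs
(resp. of H-structures) associated with `T`, realized as the complete `L_H`-theory of a lovely
pair (resp. H-structure) `M₀`.  If there is an `L_H`-formula `φ(x,y)` such that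
`φ(x,y) ∧ H(x)` witnesses ATP of `T*` (in some model of `T*`), then `T` has ATP. -/
theorem hasATP_of_H_bounded_ATP_witness
    {L : FirstOrder.Language.{u, v}} (T : L.Theory) (hgeo : IsGeometric T)
    (M₀ : Type (max u v)) [(LH L).Structure M₀] [Nonempty M₀]
    (h : IsLovelyPair L M₀ T ∨ IsHStructureExp L M₀ T)
    (N : Type (max u v)) [(LH L).Structure N] [Nonempty N]
    (hN : N ⊨ (LH L).completeTheory M₀)
    {n m : ℕ} (φ : (LH L).Formula (Fin n ⊕ Fin m)) (a : List Bool → Fin m → N)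
    (hwit : ATPWitnessH φ a) :
    T.HasATP := by
  refine hwit.hasATP hgeo fun N' _ ⟨f⟩ => ?_
  exact nice_of_models hgeo h ((f.theory_model_iff _).1 hN)

end NATPPaper
end
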